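/- Fix an integer d ≥ 2 and a real c > c_d^*, and let t_c be the smallest root in (0,1) of t = e^{−c(1−t)^d}. Then asymptotically almost surely |SH_ℝ(Y_d(n, c/n))| = C(n,d+1)·((1−t_c)^{d+1} + o(1)); that is, for every ε > 0, the probability that | |SH_ℝ(Y_d(n,c/n))| / C(n,d+1) − (1−t_c)^{d+1} | ≤ ε tends to 1 as n → ∞. -/

import Mathlib

open Finset Filter
open scoped Classical

noncomputable section

/-- The set of all possible `d`-faces: `(d+1)`-element subsets of `[n]`. -/
def allFaces (n d : ℕ) : Finset (Finset (Fin n)) :=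
  Finset.univ.filter (fun σ => σ.card = d + 1)

/-- Probability of the event `E` under `Y_d(n,p)`. -/
def probY (n d : ℕ) (p : ℝ) (E : Finset (Finset (Fin n)) → Prop) : ℝ :=
  ∑ F ∈ (allFaces n d).powerset,
    if E F then p ^ F.card * (1 - p) ^ ((allFaces n d).card - F.card) else 0

/-- Expectation of `X` under `Y_d(n,p)`. -/
def expectY (n d : ℕ) (p : ℝ) (X : Finset (Finset (Fin n)) → ℝ) : ℝ :=
  ∑ F ∈ (allFaces n d).powerset,
    p ^ F.card * (1 - p) ^ ((allFaces n d).card - F.card) * X F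

/-- Coefficient of the `d`-face `τ` in the boundary of `σ`. -/
def bdCoeff {n : ℕ} (τ σ : Finset (Fin n)) : ℝ :=
  if τ ⊆ σ ∧ τ.card + 1 = σ.card then
    ∑ v ∈ σ \ τ, (-1 : ℝ) ^ (σ.filter (fun w => w < v)).card
  else 0

/-- The boundary operator `∂_d(F) : ℝ^F → ℝ^{(d-1)-faces}`. -/
def boundaryMap (n : ℕ) (F : Finset (Finset (Fin n))) :
    (↥F → ℝ) →ₗ[ℝ] (Finset (Fin n) → ℝ) where
  toFun x := fun τ => ∑ σ ∈ F.attach, x σ * bdCoeff τ σ.1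
  map_add' x y := by
    funext τ
    simp [add_mul, Finset.sum_add_distrib]
  map_smul' c x := by
    funext τ
    simp [Finset.mul_sum, mul_assoc]

/-- Dimension of the kernel of `∂_d(F)`, i.e. `dim H_d`. -/
def dimKer (n : ℕ) (F : Finset (Finset (Fin n))) : ℕ :=
  Module.finrank ℝ (LinearMap.ker (boundaryMap n F))

/-- The real shadow of `F`. -/
def shadowR (n d : ℕ) (F : Finset (Finset (Fin n))) : Finset (Finset (Fin n)) :=
  (allFaces n d).filter (fun σ => σ ∉ F ∧ dimKer n F < dimKer n (insert σ F))

/-- The `(d+2)`-subsets all of whose `(d+1)`-subsets are faces of `F`. -/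
def simplexBoundaries (n d : ℕ) (F : Finset (Finset (Fin n))) : Finset (Finset (Fin n)) :=
  Finset.univ.filter (fun τ => τ.card = d + 2 ∧ ∀ s ∈ τ.powerset, s.card = d + 1 → s ∈ F)

/-- The boundary cycle of the `(d+2)`-subset `τ`, as a vector in `ℝ^F`. -/
def simplexCycle (n : ℕ) (F : Finset (Finset (Fin n))) (τ : Finset (Fin n)) : ↥F → ℝ :=
  fun σ => bdCoeff σ.1 τ



section Part1

/-! ### Bernoulli expectations -/

/-- Expectation of `f` over a `p`-random subset of `A`. -/
def EB {α : Type*} (p : ℝ) (A : Finset α) (f : Finset α → ℝ) : ℝ :=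
  ∑ F ∈ A.powerset, p ^ F.card * (1 - p) ^ (A.card - F.card) * f F

section EBsec
variable {α : Type*} [DecidableEq α]

lemma EB_empty (p : ℝ) (f : Finset α → ℝ) : EB p ∅ f = f ∅ := by
  simp [EB]

lemma EB_insert (p : ℝ) {A : Finset α} {a : α} (ha : a ∉ A) (f : Finset α → ℝ) :
    EB p (insert a A) f = (1 - p) * EB p A f + p * EB p A (fun F => f (insert a F)) := by
  unfold EB
  rw [Finset.sum_powerset_insert ha, Finset.mul_sum, Finset.mul_sum]
  congr 1
  · refine Finset.sum_congr rfl fun F hF => ?_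
    have h1 := Finset.card_le_card (Finset.mem_powerset.1 hF)
    rw [Finset.card_insert_of_notMem ha, Nat.succ_sub h1, pow_succ]
    ring
  · refine Finset.sum_congr rfl fun F hF => ?_
    have h2 : a ∉ F := fun h => ha (Finset.mem_powerset.1 hF h)
    rw [Finset.card_insert_of_notMem ha, Finset.card_insert_of_notMem h2, pow_succ,
      Nat.add_sub_add_right]
    ring

lemma EB_erase (p : ℝ) {A : Finset α} {a : α} (ha : a ∈ A) (f : Finset α → ℝ) :
    EB p A f = (1 - p) * EB p (A.erase a) f + p * EB p (A.erase a) (fun F => f (insert a F)) := by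
  conv_lhs => rw [← Finset.insert_erase ha]
  exact EB_insert p (Finset.notMem_erase a A) f

lemma EB_congr (p : ℝ) {A : Finset α} {f g : Finset α → ℝ} (h : ∀ F ⊆ A, f F = g F) :
    EB p A f = EB p A g :=
  Finset.sum_congr rfl fun F hF => by rw [h F (Finset.mem_powerset.1 hF)]

lemma EB_const (p : ℝ) (A : Finset α) (k : ℝ) : EB p A (fun _ => k) = k := by
  induction A using Finset.induction_on with
  | empty => simp [EB_empty]
  | insert a A ha ih => rw [EB_insert p ha, ih]; ring

lemma EB_add (p : ℝ) (A : Finset α) (f g : Finset α → ℝ) :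
    EB p A (fun F => f F + g F) = EB p A f + EB p A g := by
  simp only [EB, mul_add, Finset.sum_add_distrib]

lemma EB_sub (p : ℝ) (A : Finset α) (f g : Finset α → ℝ) :
    EB p A (fun F => f F - g F) = EB p A f - EB p A g := by
  simp only [EB, mul_sub, Finset.sum_sub_distrib]

lemma EB_mul (p : ℝ) (A : Finset α) (k : ℝ) (f : Finset α → ℝ) :
    EB p A (fun F => k * f F) = k * EB p A f := by
  simp only [EB, Finset.mul_sum]
  refine Finset.sum_congr rfl fun F _ => by ring

lemma EB_mul_right (p : ℝ) (A : Finset α) (k : ℝ) (f : Finset α → ℝ) :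
    EB p A (fun F => f F * k) = EB p A f * k := by
  simp only [EB, Finset.sum_mul]
  refine Finset.sum_congr rfl fun F _ => by ring

lemma EB_sum {β : Type*} (p : ℝ) (A : Finset α) (s : Finset β) (f : β → Finset α → ℝ) :
    EB p A (fun F => ∑ j ∈ s, f j F) = ∑ j ∈ s, EB p A (f j) := by
  simp only [EB, Finset.mul_sum]
  rw [Finset.sum_comm]

lemma EB_mono {p : ℝ} (h0 : 0 ≤ p) (h1 : p ≤ 1) {A : Finset α} {f g : Finset α → ℝ}
    (h : ∀ F ⊆ A, f F ≤ g F) : EB p A f ≤ EB p A g := by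
  refine Finset.sum_le_sum fun F hF => mul_le_mul_of_nonneg_left (h F (Finset.mem_powerset.1 hF)) ?_
  have : 0 ≤ 1 - p := by linarith
  positivity

lemma EB_nonneg {p : ℝ} (h0 : 0 ≤ p) (h1 : p ≤ 1) {A : Finset α} {f : Finset α → ℝ}
    (h : ∀ F ⊆ A, 0 ≤ f F) : 0 ≤ EB p A f := by
  have := EB_mono h0 h1 (f := fun _ => 0) h
  rwa [EB_const] at this

lemma EB_abs_le {p : ℝ} (h0 : 0 ≤ p) (h1 : p ≤ 1) {A : Finset α} {f : Finset α → ℝ} :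
    |EB p A f| ≤ EB p A (fun F => |f F|) := by
  rw [abs_le]
  constructor
  · have : EB p A (fun F => (-1) * |f F|) ≤ EB p A f :=
      EB_mono h0 h1 fun F _ => by have := neg_abs_le (f F); linarith
    rw [EB_mul] at this; linarith
  · exact EB_mono h0 h1 fun F _ => le_abs_self _

lemma EB_abs_le_const {p : ℝ} (h0 : 0 ≤ p) (h1 : p ≤ 1) {A : Finset α} {f : Finset α → ℝ} {M : ℝ}
    (h : ∀ F ⊆ A, |f F| ≤ M) : |EB p A f| ≤ M := by
  refine EB_abs_le h0 h1 |>.trans ?_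
  have := EB_mono h0 h1 (g := fun _ => M) h
  rwa [EB_const] at this

/-- Palm formula. -/
lemma EB_palm (p : ℝ) (A : Finset α) (g : α → Finset α → ℝ) :
    EB p A (fun F => ∑ σ ∈ F, g σ F)
      = ∑ σ ∈ A, p * EB p (A.erase σ) (fun F => g σ (insert σ F)) := by
  have h1 : EB p A (fun F => ∑ σ ∈ F, g σ F)
      = EB p A (fun F => ∑ σ ∈ A, if σ ∈ F then g σ F else 0) := by
    refine EB_congr p fun F hF => ?_
    rw [← Finset.sum_filter, Finset.filter_mem_eq_inter, Finset.inter_eq_right.2 hF]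
  rw [h1, EB_sum]
  refine Finset.sum_congr rfl fun σ hσ => ?_
  rw [EB_erase p hσ]
  have h2 : EB p (A.erase σ) (fun F => if σ ∈ F then g σ F else 0) = 0 := by
    rw [EB_congr p (g := fun _ => 0), EB_const]
    intro F hF
    rw [if_neg]
    exact fun h => Finset.notMem_erase σ A (hF h)
  rw [h2]
  simp

/-- Palm formula for absent elements. -/
lemma EB_palm' (p : ℝ) (A : Finset α) (g : α → Finset α → ℝ) :
    EB p A (fun F => ∑ σ ∈ A, if σ ∈ F then 0 else g σ F)
      = ∑ σ ∈ A, (1 - p) * EB p (A.erase σ) (g σ) := by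
  rw [EB_sum]
  refine Finset.sum_congr rfl fun σ hσ => ?_
  rw [EB_erase p hσ]
  have h2 : EB p (A.erase σ) (fun F => if σ ∈ F then 0 else g σ F) = EB p (A.erase σ) (g σ) := by
    refine EB_congr p fun F hF => ?_
    rw [if_neg]
    exact fun h => Finset.notMem_erase σ A (hF h)
  rw [h2]
  simp [EB_const]

lemma EB_card (p : ℝ) (A : Finset α) : EB p A (fun F => (F.card : ℝ)) = p * A.card := by
  have := EB_palm p A (fun _ _ => 1)
  simp only [EB_const] at this
  simp at this
  rw [this]; ring

lemma EB_erase_near {p : ℝ} (h0 : 0 ≤ p) (h1 : p ≤ 1) {A : Finset α} {a : α} (ha : a ∈ A)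
    {f : Finset α → ℝ} {M : ℝ} (h : ∀ F ⊆ A, |f F| ≤ M) :
    |EB p (A.erase a) f - EB p A f| ≤ 2 * p * M := by
  rw [EB_erase p ha]
  have e1 : |EB p (A.erase a) f| ≤ M :=
    EB_abs_le_const h0 h1 fun F hF => h F (hF.trans (Finset.erase_subset _ _))
  have e2 : |EB p (A.erase a) (fun F => f (insert a F))| ≤ M :=
    EB_abs_le_const h0 h1 fun F hF => h _ (Finset.insert_subset ha (hF.trans (Finset.erase_subset _ _)))
  have : EB p (A.erase a) f - ((1 - p) * EB p (A.erase a) f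
      + p * EB p (A.erase a) (fun F => f (insert a F)))
      = p * (EB p (A.erase a) f - EB p (A.erase a) (fun F => f (insert a F))) := by ring
  rw [this, abs_mul, abs_of_nonneg h0]
  have := abs_sub (EB p (A.erase a) f) (EB p (A.erase a) (fun F => f (insert a F)))
  nlinarith

/-- Covariance lemma. -/
lemma EB_cov {β : Type*} {p : ℝ} (h0 : 0 ≤ p) (h1 : p ≤ 1) (s : Finset β) {K : ℝ}
    (A : Finset α) : ∀ (f g : β → Finset α → ℝ),
    (∀ a ∈ A, ∀ F ⊆ A, ∀ F' ⊆ A, a ∉ F → a ∉ F' →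
      ∑ j ∈ s, |f j (insert a F) - f j F| * |g j (insert a F') - g j F'| ≤ K) →
    ∑ j ∈ s, |EB p A (fun F => f j F * g j F) - EB p A (f j) * EB p A (g j)|
      ≤ p * A.card * K := by
  induction A using Finset.induction_on with
  | empty => intro f g _; simp [EB_empty]
  | insert a A ha ih =>
    intro f g h
    have q0 : 0 ≤ 1 - p := by linarith
    have sub : ∀ {F : Finset α}, F ⊆ A → F ⊆ insert a A := fun hF => hF.trans (Finset.subset_insert _ _)
    have sub' : ∀ {F : Finset α}, F ⊆ A → insert a F ⊆ insert a A :=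
      fun hF => Finset.insert_subset_insert a hF
    have nm : ∀ {F : Finset α}, F ⊆ A → a ∉ F := fun hF h => ha (hF h)
    have c00 := ih f g (fun b hb F hF F' hF' hn hn' =>
      h b (Finset.mem_insert_of_mem hb) F (sub hF) F' (sub hF') hn hn')
    have key : ∀ b ∈ A, ∀ F ⊆ A, b ∉ F → b ∉ insert a F := fun b hb F hF hn h => by
      rcases Finset.mem_insert.1 h with h | h
      · exact ha (h ▸ hb)
      · exact hn h
    have c11 := ih (fun j F => f j (insert a F)) (fun j F => g j (insert a F))
      (fun b hb F hF F' hF' hn hn' => by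
        have := h b (Finset.mem_insert_of_mem hb) (insert a F) (sub' hF) (insert a F') (sub' hF')
          (key b hb F hF hn) (key b hb F' hF' hn')
        simpa only [Finset.insert_comm a b] using this)
    have c01 := ih f (fun j F => g j (insert a F))
      (fun b hb F hF F' hF' hn hn' => by
        have := h b (Finset.mem_insert_of_mem hb) F (sub hF) (insert a F') (sub' hF')
          hn (key b hb F' hF' hn')
        simpa only [Finset.insert_comm a b] using this)
    have c10 := ih (fun j F => f j (insert a F)) g
      (fun b hb F hF F' hF' hn hn' => by
        have := h b (Finset.mem_insert_of_mem hb) (insert a F) (sub' hF) F' (sub hF')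
          (key b hb F hF hn) hn'
        simpa only [Finset.insert_comm a b] using this)
    have cd : EB p A (fun F => ∑ j ∈ s, |f j (insert a F) - f j F| * |g j (insert a F) - g j F|)
        ≤ K := by
      have := EB_mono h0 h1 (A := A) (g := fun _ => K)
        (f := fun F => ∑ j ∈ s, |f j (insert a F) - f j F| * |g j (insert a F) - g j F|)
        (fun F hF => h a (Finset.mem_insert_self _ _) F (sub hF) F (sub hF) (nm hF) (nm hF))
      rwa [EB_const] at this
    rw [EB_sum] at cd
    have K0 : 0 ≤ K := le_trans (Finset.sum_nonneg fun j _ => by positivity)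
      (h a (Finset.mem_insert_self _ _) ∅ (by simp) ∅ (by simp) (by simp) (by simp))
    have each : ∀ j ∈ s, |EB p (insert a A) (fun F => f j F * g j F)
        - EB p (insert a A) (f j) * EB p (insert a A) (g j)|
        ≤ (1 - p) ^ 2 * |EB p A (fun F => f j F * g j F) - EB p A (f j) * EB p A (g j)|
        + p ^ 2 * |EB p A (fun F => f j (insert a F) * g j (insert a F))
            - EB p A (fun F => f j (insert a F)) * EB p A (fun F => g j (insert a F))|
        + p * (1 - p) * |EB p A (fun F => f j F * g j (insert a F))
            - EB p A (f j) * EB p A (fun F => g j (insert a F))|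
        + p * (1 - p) * |EB p A (fun F => f j (insert a F) * g j F)
            - EB p A (fun F => f j (insert a F)) * EB p A (g j)|
        + p * (1 - p) * EB p A (fun F => |f j (insert a F) - f j F| * |g j (insert a F) - g j F|) := by
      intro j _
      have ex : EB p A (fun F => (f j (insert a F) - f j F) * (g j (insert a F) - g j F))
          = EB p A (fun F => f j (insert a F) * g j (insert a F))
            - EB p A (fun F => f j (insert a F) * g j F)
            - EB p A (fun F => f j F * g j (insert a F)) + EB p A (fun F => f j F * g j F) := by
        rw [← EB_sub, ← EB_sub, ← EB_add]
        refine EB_congr p fun F _ => by ring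
      have ab : |EB p A (fun F => (f j (insert a F) - f j F) * (g j (insert a F) - g j F))|
          ≤ EB p A (fun F => |f j (insert a F) - f j F| * |g j (insert a F) - g j F|) := by
        refine (EB_abs_le h0 h1).trans (le_of_eq ?_)
        simp only [abs_mul]
      rw [EB_insert p ha, EB_insert p ha, EB_insert p ha]
      generalize EB p A (fun F => |f j (insert a F) - f j F| * |g j (insert a F) - g j F|) = z at *
      generalize EB p A (fun F => (f j (insert a F) - f j F) * (g j (insert a F) - g j F)) = w at *
      generalize EB p A (fun F => f j (insert a F) * g j (insert a F)) = w11 at *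
      generalize EB p A (fun F => f j (insert a F) * g j F) = w10 at *
      generalize EB p A (fun F => f j F * g j (insert a F)) = w01 at *
      generalize EB p A (fun F => f j F * g j F) = w00 at *
      generalize EB p A (fun F => f j (insert a F)) = f1 at *
      generalize EB p A (fun F => g j (insert a F)) = g1 at *
      generalize EB p A (f j) = f0 at *
      generalize EB p A (g j) = g0 at *
      have e : (1 - p) * w00 + p * w11 - ((1 - p) * f0 + p * f1) * ((1 - p) * g0 + p * g1)
          = (1 - p) ^ 2 * (w00 - f0 * g0) + p ^ 2 * (w11 - f1 * g1)
            + p * (1 - p) * (w01 - f0 * g1) + p * (1 - p) * (w10 - f1 * g0)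
            + p * (1 - p) * w := by rw [ex]; ring
      rw [e]
      have pq : 0 ≤ p * (1 - p) := mul_nonneg h0 q0
      refine (abs_add_le _ _).trans (add_le_add ((abs_add_le _ _).trans (add_le_add
        ((abs_add_le _ _).trans (add_le_add ((abs_add_le _ _).trans (add_le_add ?_ ?_)) ?_)) ?_)) ?_)
      · rw [abs_mul, abs_of_nonneg (by positivity : 0 ≤ (1 - p) ^ 2)]
      · rw [abs_mul, abs_of_nonneg (by positivity : 0 ≤ p ^ 2)]
      · rw [abs_mul, abs_of_nonneg pq]
      · rw [abs_mul, abs_of_nonneg pq]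
      · rw [abs_mul, abs_of_nonneg pq]; exact mul_le_mul_of_nonneg_left ab pq
    refine (Finset.sum_le_sum each).trans ?_
    simp only [Finset.sum_add_distrib, ← Finset.mul_sum]
    rw [Finset.card_insert_of_notMem ha]
    push_cast
    have pq : 0 ≤ p * (1 - p) := mul_nonneg h0 q0
    have b1 := mul_le_mul_of_nonneg_left c00 (by positivity : 0 ≤ (1 - p) ^ 2)
    have b2 := mul_le_mul_of_nonneg_left c11 (by positivity : 0 ≤ p ^ 2)
    have b3 := mul_le_mul_of_nonneg_left c01 pq
    have b4 := mul_le_mul_of_nonneg_left c10 pq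
    have b5 := mul_le_mul_of_nonneg_left cd pq
    have b6 : p * (1 - p) * K ≤ p * K := by
      have : 0 ≤ p * K := mul_nonneg h0 K0
      nlinarith
    calc _ ≤ (1 - p) ^ 2 * (p * A.card * K) + p ^ 2 * (p * A.card * K)
          + p * (1 - p) * (p * A.card * K) + p * (1 - p) * (p * A.card * K) + p * K := by linarith
      _ = p * (A.card + 1) * K := by ring

/-- Variance bound for functions with unit increments. -/
lemma EB_var {p : ℝ} (h0 : 0 ≤ p) (h1 : p ≤ 1) (A : Finset α) (f : Finset α → ℝ)
    (h : ∀ a ∈ A, ∀ F ⊆ A, a ∉ F → |f (insert a F) - f F| ≤ 1) :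
    EB p A (fun F => (f F - EB p A f) ^ 2) ≤ p * A.card := by
  have := EB_cov h0 h1 ({()} : Finset Unit) (K := 1) A (fun _ => f) (fun _ => f)
    (fun a ha F hF F' hF' hn hn' => by
      simp only [Finset.sum_singleton]
      have := h a ha F hF hn
      have := h a ha F' hF' hn'
      have := abs_nonneg (f (insert a F) - f F)
      have := abs_nonneg (f (insert a F') - f F')
      nlinarith)
  simp only [Finset.sum_singleton, mul_one] at this
  refine le_trans (le_of_eq ?_) ((le_abs_self _).trans this)
  have e : ∀ F, (f F - EB p A f) ^ 2 = f F * f F - 2 * EB p A f * f F + EB p A f * EB p A f := by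
    intro F; ring
  simp only [e]
  rw [EB_add, EB_sub, EB_mul, EB_const]; ring

/-- Cauchy-Schwarz. -/
lemma EB_abs_sq {p : ℝ} (h0 : 0 ≤ p) (h1 : p ≤ 1) (A : Finset α) (f : Finset α → ℝ) :
    EB p A (fun F => |f F|) ^ 2 ≤ EB p A (fun F => f F ^ 2) := by
  have : 0 ≤ EB p A (fun F => (|f F| - EB p A (fun F => |f F|)) ^ 2) :=
    EB_nonneg h0 h1 fun F _ => sq_nonneg _
  have e : ∀ F, (|f F| - EB p A (fun F => |f F|)) ^ 2
    = f F ^ 2 - 2 * EB p A (fun F => |f F|) * |f F|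
      + EB p A (fun F => |f F|) * EB p A (fun F => |f F|) := by
    intro F; rw [sub_sq, sq_abs]; ring
  simp only [e] at this
  rw [EB_add, EB_sub, EB_mul, EB_const] at this
  nlinarith

/-- Union coupling. -/
lemma EB_union (p p' p2 : ℝ) (hp : 1 - p2 = (1 - p) * (1 - p')) (A : Finset α) :
    ∀ g : Finset α → ℝ, EB p A (fun F => EB p' A (fun F' => g (F ∪ F'))) = EB p2 A g := by
  induction A using Finset.induction_on with
  | empty => intro g; simp [EB_empty]
  | insert a A ha ih =>
    intro g
    rw [EB_insert p ha, EB_insert p2 ha]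
    have e1 : EB p A (fun F => EB p' (insert a A) (fun F' => g (F ∪ F')))
        = (1 - p') * EB p2 A g + p' * EB p2 A (fun F => g (insert a F)) := by
      simp only [EB_insert p' ha, EB_add, EB_mul, Finset.union_insert]
      rw [ih g, ih (fun F => g (insert a F))]
    have e2 : EB p A (fun F => EB p' (insert a A) (fun F' => g (insert a F ∪ F')))
        = EB p2 A (fun F => g (insert a F)) := by
      simp only [EB_insert p' ha, EB_add, EB_mul, Finset.union_insert, Finset.insert_union,
        Finset.insert_idem]
      rw [ih (fun F => g (insert a F))]; ring
    rw [e1, e2, hp]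
    have : p2 = 1 - (1 - p) * (1 - p') := by linarith
    rw [this]; ring

/-- Intersection coupling. -/
lemma EB_inter (p q p2 : ℝ) (hp : p2 = p * q) (A : Finset α) :
    ∀ g : Finset α → ℝ, EB p A (fun F => EB q A (fun F' => g (F ∩ F'))) = EB p2 A g := by
  induction A using Finset.induction_on with
  | empty => intro g; simp [EB_empty]
  | insert a A ha ih =>
    intro g
    rw [EB_insert p ha, EB_insert p2 ha]
    have e1 : EB p A (fun F => EB q (insert a A) (fun F' => g (F ∩ F'))) = EB p2 A g := by
      rw [← ih g]
      refine EB_congr p fun F hF => ?_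
      rw [EB_insert q ha]
      have : ∀ F', F ∩ insert a F' = F ∩ F' := fun F' =>
        Finset.inter_insert_of_notMem fun h => ha (hF h)
      simp only [this]; ring
    have e2 : EB p A (fun F => EB q (insert a A) (fun F' => g (insert a F ∩ F')))
        = (1 - q) * EB p2 A g + q * EB p2 A (fun F => g (insert a F)) := by
      simp only [EB_insert q ha, EB_add, EB_mul]
      rw [← ih g, ← ih (fun F => g (insert a F))]
      congr 2
      · refine EB_congr p fun F hF => EB_congr q fun F' hF' => ?_
        rw [Finset.insert_inter_of_notMem fun h => ha (hF' h)]
      · refine EB_congr p fun F hF => EB_congr q fun F' hF' => ?_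
        rw [← Finset.insert_inter_distrib]
    rw [e1, e2, hp]; ring

/-- Invariance under relabelling. -/
lemma EB_map (p : ℝ) (A : Finset α) (π : α ≃ α) (hA : A.map π.toEmbedding = A)
    (f : Finset α → ℝ) : EB p A (fun F => f (F.map π.toEmbedding)) = EB p A f := by
  unfold EB
  refine Finset.sum_bij (fun F _ => F.map π.toEmbedding) ?_ ?_ ?_ ?_
  · intro F hF
    rw [Finset.mem_powerset] at hF ⊢
    rw [← hA]; exact Finset.map_subset_map.2 hF
  · intro F _ F' _ h
    exact Finset.map_injective _ h
  · intro F hF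
    refine ⟨F.map π.symm.toEmbedding, ?_, ?_⟩
    · rw [Finset.mem_powerset] at hF ⊢
      rw [← hA] at hF
      have := Finset.map_subset_map (f := π.symm.toEmbedding).2 hF
      simpa [Finset.map_map] using this
    · ext x; simp
  · intro F _
    simp

end EBsec

end Part1

section Part2

section Mat
open Matrix
variable {α ι : Type*} [Fintype ι] [DecidableEq ι]

def Lap (b : α → ι → ℝ) (F : Finset α) : Matrix ι ι ℝ := ∑ σ ∈ F, vecMulVec (b σ) (b σ)

lemma Lap_mulVec (b : α → ι → ℝ) (F : Finset α) (w : ι → ℝ) :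
    Lap b F *ᵥ w = ∑ σ ∈ F, (b σ ⬝ᵥ w) • b σ := by
  unfold Lap
  rw [Matrix.sum_mulVec]
  refine Finset.sum_congr rfl fun σ _ => ?_
  ext i
  simp [vecMulVec_mulVec]
  ring

lemma Lap_quad (b : α → ι → ℝ) (F : Finset α) (u w : ι → ℝ) :
    u ⬝ᵥ (Lap b F *ᵥ w) = ∑ σ ∈ F, (b σ ⬝ᵥ u) * (b σ ⬝ᵥ w) := by
  rw [Lap_mulVec, dotProduct_sum]
  refine Finset.sum_congr rfl fun σ _ => ?_
  rw [dotProduct_smul, dotProduct_comm u, smul_eq_mul]; ring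

lemma Lap_quad_nonneg (b : α → ι → ℝ) (F : Finset α) (w : ι → ℝ) :
    0 ≤ w ⬝ᵥ (Lap b F *ᵥ w) := by
  rw [Lap_quad]; exact Finset.sum_nonneg fun σ _ => mul_self_nonneg _

lemma Lap_apply (b : α → ι → ℝ) (F : Finset α) (i j : ι) :
    Lap b F i j = ∑ σ ∈ F, b σ i * b σ j := by
  simp [Lap, Matrix.sum_apply, vecMulVec_apply]

lemma Lap_herm (b : α → ι → ℝ) (F : Finset α) : (Lap b F).IsHermitian := by
  ext i j
  simp [Lap_apply, mul_comm]

lemma Lap_posSemidef (b : α → ι → ℝ) (F : Finset α) : (Lap b F).PosSemidef :=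
  Matrix.PosSemidef.of_dotProduct_mulVec_nonneg (Lap_herm b F)
    fun x => by simpa using Lap_quad_nonneg b F x

def AM (l : ℝ) (b : α → ι → ℝ) (F : Finset α) : Matrix ι ι ℝ := l • (1 : Matrix ι ι ℝ) + Lap b F

lemma AM_mulVec (l : ℝ) (b : α → ι → ℝ) (F : Finset α) (w : ι → ℝ) :
    AM l b F *ᵥ w = l • w + Lap b F *ᵥ w := by
  simp [AM, add_mulVec, smul_mulVec]

lemma AM_posDef {l : ℝ} (hl : 0 < l) (b : α → ι → ℝ) (F : Finset α) : (AM l b F).PosDef := by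
  rw [Matrix.posDef_iff_dotProduct_mulVec]
  refine ⟨?_, fun x hx => ?_⟩
  · ext i j
    simp [AM, Lap_apply, mul_comm, Matrix.one_apply, eq_comm]
  · rw [AM_mulVec, dotProduct_add, dotProduct_smul, smul_eq_mul]
    have h1 := Lap_quad_nonneg b F x
    have h2 : 0 < x ⬝ᵥ x := by
      have := Matrix.dotProduct_star_self_pos_iff.2 hx
      simpa using this
    simp only [star_trivial]
    positivity

/-- `λ (λ + L_F)⁻¹ v` -/
def Hv (l : ℝ) (b : α → ι → ℝ) (F : Finset α) (v : ι → ℝ) : ι → ℝ := l • ((AM l b F)⁻¹ *ᵥ v)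

lemma Hv_spec {l : ℝ} (hl : 0 < l) (b : α → ι → ℝ) (F : Finset α) (v : ι → ℝ) :
    l • Hv l b F v + Lap b F *ᵥ Hv l b F v = l • v := by
  rw [← AM_mulVec, Hv, mulVec_smul, mulVec_mulVec, Matrix.mul_nonsing_inv, one_mulVec]
  exact (Matrix.isUnit_iff_isUnit_det _).1 (AM_posDef hl b F).isUnit

lemma Hv_unique {l : ℝ} (hl : 0 < l) (b : α → ι → ℝ) (F : Finset α) (v w : ι → ℝ)
    (h : l • w + Lap b F *ᵥ w = l • v) : w = Hv l b F v := by
  rw [← AM_mulVec] at h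
  have h2 := congrArg (fun u => (AM l b F)⁻¹ *ᵥ u) h
  simp only [mulVec_mulVec, mulVec_smul] at h2
  rw [Matrix.nonsing_inv_mul, one_mulVec] at h2
  · exact h2
  exact (Matrix.isUnit_iff_isUnit_det _).1 (AM_posDef hl b F).isUnit

lemma Hv_symm {l : ℝ} (hl : 0 < l) (b : α → ι → ℝ) (F : Finset α) (u v : ι → ℝ) :
    u ⬝ᵥ Hv l b F v = Hv l b F u ⬝ᵥ v := by
  have h1 := congrArg (fun w => Hv l b F v ⬝ᵥ w) (Hv_spec hl b F u)
  have h2 := congrArg (fun w => Hv l b F u ⬝ᵥ w) (Hv_spec hl b F v)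
  simp only [dotProduct_add, dotProduct_smul, smul_eq_mul, Lap_quad] at h1 h2
  have h3 : ∑ σ ∈ F, (b σ ⬝ᵥ Hv l b F v) * (b σ ⬝ᵥ Hv l b F u)
    = ∑ σ ∈ F, (b σ ⬝ᵥ Hv l b F u) * (b σ ⬝ᵥ Hv l b F v) :=
    Finset.sum_congr rfl fun _ _ => mul_comm _ _
  rw [h3, dotProduct_comm (Hv l b F v) (Hv l b F u), dotProduct_comm _ u] at h1
  have : l * (u ⬝ᵥ Hv l b F v) = l * (Hv l b F u ⬝ᵥ v) := by linarith
  exact mul_left_cancel₀ hl.ne' this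

lemma Hv_sq {l : ℝ} (hl : 0 < l) (b : α → ι → ℝ) (F : Finset α) (v : ι → ℝ) :
    Hv l b F v ⬝ᵥ Hv l b F v ≤ v ⬝ᵥ Hv l b F v := by
  have h1 := congrArg (fun w => Hv l b F v ⬝ᵥ w) (Hv_spec hl b F v)
  simp only [dotProduct_add, dotProduct_smul, smul_eq_mul] at h1
  have h2 := Lap_quad_nonneg b F (Hv l b F v)
  rw [dotProduct_comm v]
  have : l * (Hv l b F v ⬝ᵥ Hv l b F v) ≤ l * (Hv l b F v ⬝ᵥ v) := by linarith
  exact le_of_mul_le_mul_left this hl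

lemma Hv_sum (l : ℝ) (b : α → ι → ℝ) (F : Finset α) (v : ι → ℝ) (i : ι) :
    Hv l b F v i = ∑ j, v j * Hv l b F (Pi.single j 1) i := by
  simp only [Hv, Pi.smul_apply, smul_eq_mul, mulVec_single_one, mulVec, dotProduct,
    Finset.mul_sum, Matrix.col_apply]
  refine Finset.sum_congr rfl fun j _ => by ring

def QQ (l : ℝ) (b : α → ι → ℝ) (F : Finset α) (v : ι → ℝ) : ℝ := v ⬝ᵥ Hv l b F v

lemma QQ_nonneg {l : ℝ} (hl : 0 < l) (b : α → ι → ℝ) (F : Finset α) (v : ι → ℝ) :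
    0 ≤ QQ l b F v := by
  refine le_trans ?_ (Hv_sq hl b F v)
  exact Finset.sum_nonneg fun i _ => mul_self_nonneg _

section ins
variable [DecidableEq α]

lemma Lap_insert (b : α → ι → ℝ) {F : Finset α} {σ : α} (h : σ ∉ F) (w : ι → ℝ) :
    Lap b (insert σ F) *ᵥ w = (b σ ⬝ᵥ w) • b σ + Lap b F *ᵥ w := by
  rw [Lap_mulVec, Lap_mulVec, Finset.sum_insert h]

lemma Hv_insert {l : ℝ} (hl : 0 < l) (b : α → ι → ℝ) {F : Finset α} {σ : α} (h : σ ∉ F)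
    (v : ι → ℝ) : Hv l b (insert σ F) v
      = Hv l b F v - ((b σ ⬝ᵥ Hv l b F v) / (l + QQ l b F (b σ))) • Hv l b F (b σ) := by
  symm
  apply Hv_unique hl
  have hQ := QQ_nonneg hl b F (b σ)
  have h0 : l + QQ l b F (b σ) ≠ 0 := by positivity
  have h1 := Hv_spec hl b F v
  have h2 := Hv_spec hl b F (b σ)
  set r := (b σ ⬝ᵥ Hv l b F v) / (l + QQ l b F (b σ)) with hr
  have h3 : (b σ ⬝ᵥ Hv l b F v) = r * (l + QQ l b F (b σ)) := by rw [hr]; field_simp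
  have h1' : Lap b F *ᵥ Hv l b F v = l • v - l • Hv l b F v := by rw [← h1]; abel
  have h2' : Lap b F *ᵥ Hv l b F (b σ) = l • b σ - l • Hv l b F (b σ) := by
    rw [← h2]; abel
  rw [Lap_insert b h, mulVec_sub, mulVec_smul, h1', h2', dotProduct_sub, dotProduct_smul, h3]
  change _ + ((_ - r • QQ l b F (b σ)) • _ + _) = _
  ext i
  simp only [Pi.add_apply, Pi.sub_apply, Pi.smul_apply, smul_eq_mul]
  ring

lemma Hv_insert_self {l : ℝ} (hl : 0 < l) (b : α → ι → ℝ) {F : Finset α} {σ : α} (h : σ ∉ F)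
     : Hv l b (insert σ F) (b σ) = (l / (l + QQ l b F (b σ))) • Hv l b F (b σ) := by
  rw [Hv_insert hl b h]
  have hQ := QQ_nonneg hl b F (b σ)
  have h0 : l + QQ l b F (b σ) ≠ 0 := by positivity
  ext i
  change _ - QQ l b F (b σ) / _ * _ = _
  simp only [Pi.smul_apply, smul_eq_mul]
  field_simp
  ring

end ins

def xx (l : ℝ) (b : α → ι → ℝ) (F : Finset α) (i : ι) : ℝ := Hv l b F (Pi.single i 1) i

lemma xx_eq_QQ (l : ℝ) (b : α → ι → ℝ) (F : Finset α) (i : ι) :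
    xx l b F i = QQ l b F (Pi.single i 1) := by
  simp [xx, QQ]

lemma Hv_single_symm {l : ℝ} (hl : 0 < l) (b : α → ι → ℝ) (F : Finset α) (i j : ι) :
    Hv l b F (Pi.single i 1) j = Hv l b F (Pi.single j 1) i := by
  have := Hv_symm hl b F (Pi.single j 1) (Pi.single i 1)
  simpa using this

lemma Hv_single_sq {l : ℝ} (hl : 0 < l) (b : α → ι → ℝ) (F : Finset α) (i : ι) :
    ∑ j, (Hv l b F (Pi.single i 1) j) ^ 2 ≤ xx l b F i := by
  have := Hv_sq hl b F (Pi.single i 1)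
  rw [xx_eq_QQ]
  refine le_trans (le_of_eq ?_) this
  simp [dotProduct, sq]

lemma xx_nonneg {l : ℝ} (hl : 0 < l) (b : α → ι → ℝ) (F : Finset α) (i : ι) :
    0 ≤ xx l b F i := by rw [xx_eq_QQ]; exact QQ_nonneg hl b F _

lemma xx_le_one {l : ℝ} (hl : 0 < l) (b : α → ι → ℝ) (F : Finset α) (i : ι) :
    xx l b F i ≤ 1 := by
  have h := Hv_single_sq hl b F i
  have h2 : xx l b F i ^ 2 ≤ ∑ j, (Hv l b F (Pi.single i 1) j) ^ 2 :=
    Finset.single_le_sum (f := fun j => (Hv l b F (Pi.single i 1) j) ^ 2)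
      (fun j _ => sq_nonneg _) (Finset.mem_univ i)
  nlinarith

lemma xx_insert [DecidableEq α] {l : ℝ} (hl : 0 < l) (b : α → ι → ℝ) {F : Finset α} {σ : α}
    (h : σ ∉ F) (i : ι) : xx l b (insert σ F) i
      = xx l b F i - (Hv l b F (b σ) i) ^ 2 / (l + QQ l b F (b σ)) := by
  unfold xx
  rw [Hv_insert hl b h]
  have : b σ ⬝ᵥ Hv l b F (Pi.single i 1) = Hv l b F (b σ) i := by
    rw [Hv_symm hl]; simp
  simp only [Pi.sub_apply, Pi.smul_apply, smul_eq_mul, this]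
  ring

lemma sum_xx_diff [DecidableEq α] {l : ℝ} (hl : 0 < l) (b : α → ι → ℝ) {F : Finset α} {σ : α}
    (h : σ ∉ F) : ∑ i, |xx l b (insert σ F) i - xx l b F i| ≤ 1 := by
  have hQ := QQ_nonneg hl b F (b σ)
  have h0 : 0 < l + QQ l b F (b σ) := by positivity
  have e : ∀ i, |xx l b (insert σ F) i - xx l b F i|
      = (Hv l b F (b σ) i) ^ 2 / (l + QQ l b F (b σ)) := fun i => by
    rw [xx_insert hl b h, sub_sub_cancel_left, abs_neg, abs_of_nonneg]
    positivity
  simp only [e]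
  rw [← Finset.sum_div, div_le_one h0]
  have := Hv_sq hl b F (b σ)
  have h2 : ∑ i, (Hv l b F (b σ) i) ^ 2 = Hv l b F (b σ) ⬝ᵥ Hv l b F (b σ) := by
    simp [dotProduct, sq]
  rw [h2]
  unfold QQ
  linarith

lemma one_sub_xx {l : ℝ} (hl : 0 < l) (b : α → ι → ℝ) (F : Finset α) (i : ι) :
    1 - xx l b F i = ∑ σ ∈ F, b σ i * Hv l b F (b σ) i / l := by
  have h := congrFun (Hv_spec hl b F (Pi.single i 1)) i
  simp only [Lap_mulVec, Pi.add_apply, Pi.smul_apply, smul_eq_mul, Finset.sum_apply,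
    Pi.single_eq_same] at h
  have e : ∀ σ, b σ ⬝ᵥ Hv l b F (Pi.single i 1) = Hv l b F (b σ) i := fun σ => by
    rw [Hv_symm hl]; simp
  simp only [e] at h
  rw [← Finset.sum_div, eq_div_iff hl.ne']
  have : ∑ σ ∈ F, b σ i * Hv l b F (b σ) i = ∑ σ ∈ F, Hv l b F (b σ) i * b σ i :=
    Finset.sum_congr rfl fun _ _ => mul_comm _ _
  rw [this]
  unfold xx
  linarith

lemma xx_inv {l : ℝ} (hl : 0 < l) (b : α → ι → ℝ) (F : Finset α) (i : ι) :
    0 < xx l b F i ∧ 1 / xx l b F i ≤ 1 + (∑ σ ∈ F, b σ i ^ 2) / l := by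
  have h := Hv_spec hl b F (Pi.single i 1)
  set w := Hv l b F (Pi.single i 1) with hw
  set e : ι → ℝ := Pi.single i 1 with he
  set D := ∑ σ ∈ F, b σ i ^ 2 with hD
  have hD0 : 0 ≤ D := Finset.sum_nonneg fun _ _ => sq_nonneg _
  have hx : xx l b F i = w i := rfl
  have ew : e ⬝ᵥ w = w i := by simp [he]
  have ee : e ⬝ᵥ e = 1 := by simp [he]
  have hq := fun t : ℝ => Lap_quad_nonneg b F (w - t • e)
  have hLee : e ⬝ᵥ (Lap b F *ᵥ e) = D := by
    rw [Lap_quad, hD]; exact Finset.sum_congr rfl fun σ _ => by simp [he, sq]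
  have hLw : Lap b F *ᵥ w = l • e - l • w := by rw [← h]; abel
  have hLew : w ⬝ᵥ (Lap b F *ᵥ e) = l - l * w i := by
    have : w ⬝ᵥ (Lap b F *ᵥ e) = e ⬝ᵥ (Lap b F *ᵥ w) := by
      rw [Lap_quad, Lap_quad]; exact Finset.sum_congr rfl fun _ _ => mul_comm _ _
    rw [this, hLw, dotProduct_sub, dotProduct_smul, dotProduct_smul, ee, ew]; simp
  have hn := fun t : ℝ => Finset.sum_nonneg (s := Finset.univ) (f := fun j => ((w - t • e) j) * ((w - t • e) j)) (fun j _ => mul_self_nonneg _)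
  have key : ∀ t : ℝ, 0 ≤ l * w i - 2 * t * l + t ^ 2 * (l + D) := by
    intro t
    have h1 := hq t
    have h2 : 0 ≤ (w - t • e) ⬝ᵥ (w - t • e) := hn t
    have e1 : (w - t • e) ⬝ᵥ (w - t • e) = w ⬝ᵥ w - 2 * t * w i + t ^ 2 := by
      simp only [dotProduct_sub, sub_dotProduct, dotProduct_smul, smul_dotProduct, smul_eq_mul,
        ee, ew, dotProduct_comm w e]
      ring
    have e2 : (w - t • e) ⬝ᵥ (Lap b F *ᵥ (w - t • e))
        = (l * w i - l * (w ⬝ᵥ w)) - 2 * t * (l - l * w i) + t ^ 2 * D := by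
      simp only [mulVec_sub, mulVec_smul, dotProduct_sub, sub_dotProduct, dotProduct_smul,
        smul_dotProduct, smul_eq_mul, hLee, hLew, hLw, ee, ew, dotProduct_comm w e]
      ring
    rw [e1] at h2
    rw [e2] at h1
    nlinarith [mul_nonneg hl.le h2]
  have hpos : 0 < l + D := by positivity
  have h3 := key (l / (l + D))
  have e3 : l * w i - 2 * (l / (l + D)) * l + (l / (l + D)) ^ 2 * (l + D)
      = l * (w i - l / (l + D)) := by field_simp; ring
  rw [e3] at h3
  have h4 : l / (l + D) ≤ w i := by
    have := nonneg_of_mul_nonneg_right h3 hl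
    linarith
  have h5 : 0 < l / (l + D) := by positivity
  rw [hx]
  refine ⟨by linarith, ?_⟩
  rw [div_le_iff₀ (by linarith)]
  have : (1 + D / l) * (l / (l + D)) = 1 := by field_simp
  have h6 : 0 ≤ 1 + D / l := by positivity
  nlinarith

end Mat

end Part2

section Part3

section Luck
open Matrix Polynomial
variable {α ι : Type*} [Fintype ι] [DecidableEq ι]

lemma prod_ge_one {ι : Type*} [Fintype ι] (e : ι → ℝ) (he : ∀ i, 0 ≤ e i) (P : ℤ[X])
    (hP : P.map (Int.castRingHom ℝ) = ∏ i, (X - C (e i))) :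
    1 ≤ ∏ i ∈ univ.filter (fun i => e i ≠ 0), e i := by
  set S := univ.filter (fun i => e i ≠ 0) with hS
  set k := (univ.filter (fun i => ¬ e i ≠ 0)).card with hk
  have h1 : ∏ i, (X - C (e i)) = X ^ k * ∏ i ∈ S, (X - C (e i)) := by
    rw [← Finset.prod_filter_mul_prod_filter_not univ (fun i => e i ≠ 0), mul_comm]
    congr 1
    rw [hk, ← Finset.prod_const]
    refine Finset.prod_congr rfl fun i hi => ?_
    have : e i = 0 := by simpa using hi
    simp [this]
  have h2 : ((P.coeff k : ℤ) : ℝ) = ∏ i ∈ S, (- e i) := by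
    have := congrArg (fun q => q.coeff k) (hP.trans h1)
    simp only [coeff_map, coeff_X_pow_mul'] at this
    simp only [le_refl, if_true, Nat.sub_self, coeff_zero_eq_eval_zero, eval_prod] at this
    simpa using this
  have h3 : (∏ i ∈ S, (- e i)) ≠ 0 := by
    rw [Finset.prod_ne_zero_iff]
    intro i hi
    simpa using (Finset.mem_filter.1 hi).2
  have h4 : P.coeff k ≠ 0 := by
    intro h; rw [h] at h2; exact h3 (by rw [← h2]; simp)
  have h5 : (1 : ℝ) ≤ |((P.coeff k : ℤ) : ℝ)| := by
    rw [← Int.cast_abs]; exact_mod_cast Int.one_le_abs h4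
  rw [h2, Finset.abs_prod] at h5
  refine h5.trans (le_of_eq (Finset.prod_congr rfl fun i _ => ?_))
  rw [abs_neg, abs_of_nonneg (he i)]

lemma log_bound {l e : ℝ} (hl : 0 < l) (hl1 : l < 1) (he : 0 < e) :
    l / (l + e) * Real.log (1 / l) ≤ e - Real.log e := by
  have hw : l / (l + e) + e / (l + e) = 1 := by field_simp
  have hc := strictConcaveOn_log_Ioi.concaveOn.2
    (show 1 / l ∈ Set.Ioi (0 : ℝ) by simp [hl]) (show (1 : ℝ) ∈ Set.Ioi (0 : ℝ) by simp)
    (show 0 ≤ l / (l + e) by positivity) (show 0 ≤ e / (l + e) by positivity) hw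
  simp only [smul_eq_mul, Real.log_one, mul_zero, add_zero, mul_one] at hc
  refine hc.trans ?_
  have : l / (l + e) * (1 / l) + e / (l + e) = (1 + e) / (l + e) := by field_simp
  rw [this]
  have h1 : Real.log ((1 + e) / (l + e)) ≤ Real.log ((1 + e) / e) := by
    apply Real.log_le_log (by positivity)
    gcongr
    linarith
  rw [Real.log_div (by positivity) he.ne'] at h1
  have := Real.log_le_sub_one_of_pos (show 0 < 1 + e by linarith)
  linarith

lemma trace_inv {l : ℝ} (hl : 0 < l) {L : Matrix ι ι ℝ} (hL : L.IsHermitian) (hp : L.PosSemidef) :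
    (l • (1 : Matrix ι ι ℝ) + L)⁻¹.trace = ∑ i, 1 / (l + hL.eigenvalues i) := by
  have hU := hL.spectral_theorem
  rw [Unitary.conjStarAlgAut_apply] at hU
  set U := hL.eigenvectorUnitary with hUd
  have h1 : (U : Matrix ι ι ℝ) * star (U : Matrix ι ι ℝ) = 1 := Unitary.coe_mul_star_self U
  have h2 : star (U : Matrix ι ι ℝ) * (U : Matrix ι ι ℝ) = 1 := Unitary.coe_star_mul_self U
  have hpos : ∀ i, 0 < l + hL.eigenvalues i := fun i => by
    have := hp.eigenvalues_nonneg i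
    linarith
  have hinv : (l • (1 : Matrix ι ι ℝ) + L)⁻¹
      = (U : Matrix ι ι ℝ) * diagonal (fun i => 1 / (l + hL.eigenvalues i)) * star (U : Matrix ι ι ℝ) := by
    apply Matrix.inv_eq_right_inv
    have e1 : l • (1 : Matrix ι ι ℝ) + L
      = (U : Matrix ι ι ℝ) * diagonal (fun i => l + hL.eigenvalues i) * star (U : Matrix ι ι ℝ) := by
      have : diagonal (fun i => l + hL.eigenvalues i)
          = l • (1 : Matrix ι ι ℝ) + diagonal (hL.eigenvalues) := by
        ext i j
        by_cases h : i = j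
        · subst h; simp
        · simp [h]
      rw [this, mul_add, add_mul, mul_smul_comm, mul_one, smul_mul_assoc, h1]
      congr 1
    rw [e1]
    calc _ = (U : Matrix ι ι ℝ) * diagonal (fun i => l + hL.eigenvalues i) *
          (star (U : Matrix ι ι ℝ) * (U : Matrix ι ι ℝ))
          * diagonal (fun i => 1 / (l + hL.eigenvalues i)) * star (U : Matrix ι ι ℝ) := by
          simp only [mul_assoc]
      _ = (U : Matrix ι ι ℝ) * (diagonal (fun i => l + hL.eigenvalues i)
          * diagonal (fun i => 1 / (l + hL.eigenvalues i))) * star (U : Matrix ι ι ℝ) := by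
          rw [h2]; simp only [mul_assoc, one_mul]
      _ = 1 := by
          rw [diagonal_mul_diagonal]
          have : (fun i => (l + hL.eigenvalues i) * (1 / (l + hL.eigenvalues i))) = fun _ => 1 := by
            funext i; have := (hpos i).ne'; field_simp
          rw [this, diagonal_one, mul_one, h1]
  rw [hinv, trace_mul_comm, ← mul_assoc, h2, one_mul, trace_diagonal]

lemma sum_xx (l : ℝ) (b : α → ι → ℝ) (F : Finset α) :
    ∑ i, xx l b F i = l * (l • (1 : Matrix ι ι ℝ) + Lap b F)⁻¹.trace := by
  simp [xx, Hv, Matrix.trace, Finset.mul_sum, AM]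

/-- The Lück-type bound. -/
lemma luck {l : ℝ} (hl : 0 < l) (hl1 : l < 1) (b : α → ι → ℝ) (F : Finset α)
    (hinteg : ∀ σ ∈ F, ∀ i, ∃ z : ℤ, b σ i = z) :
    0 ≤ ((Lap b F).rank : ℝ) - ∑ i, (1 - xx l b F i) ∧
    ((Lap b F).rank : ℝ) - ∑ i, (1 - xx l b F i)
      ≤ (∑ σ ∈ F, ∑ i, b σ i ^ 2) / Real.log (1 / l) := by
  have hL := Lap_herm b F
  have hp := Lap_posSemidef b F
  set e := hL.eigenvalues with he
  have he0 : ∀ i, 0 ≤ e i := hp.eigenvalues_nonneg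
  have hrank : ((Lap b F).rank : ℝ) = ∑ i, if e i ≠ 0 then (1 : ℝ) else 0 := by
    rw [hL.rank_eq_card_non_zero_eigs, Fintype.card_subtype, ← Finset.sum_filter]
    simp [he]
  have hsum : ∑ i, (1 - xx l b F i) = ∑ i, e i / (l + e i) := by
    rw [Finset.sum_sub_distrib, sum_xx, trace_inv hl hL hp, Finset.mul_sum, ← Finset.sum_sub_distrib]
    refine Finset.sum_congr rfl fun i _ => ?_
    have : l + e i ≠ 0 := by have := he0 i; positivity
    change 1 - l * (1 / (l + e i)) = _
    field_simp
    ring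
  have hdiff : ((Lap b F).rank : ℝ) - ∑ i, (1 - xx l b F i)
      = ∑ i ∈ univ.filter (fun i => e i ≠ 0), l / (l + e i) := by
    rw [hrank, hsum, ← Finset.sum_sub_distrib, Finset.sum_filter]
    refine Finset.sum_congr rfl fun i _ => ?_
    by_cases h : e i = 0
    · simp [h]
    · have : l + e i ≠ 0 := by have := he0 i; positivity
      simp only [ne_eq, h, not_false_eq_true, if_true]
      field_simp
      ring
  rw [hdiff]
  refine ⟨Finset.sum_nonneg fun i _ => by have := he0 i; positivity, ?_⟩
  have hlog : 0 < Real.log (1 / l) := Real.log_pos (by rw [lt_div_iff₀ hl]; linarith)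
  rw [le_div_iff₀ hlog, Finset.sum_mul]
  have hpr : 1 ≤ ∏ i ∈ univ.filter (fun i => e i ≠ 0), e i := by
    have hex : ∃ M : Matrix ι ι ℤ, M.map (Int.castRingHom ℝ) = Lap b F := by
      have : ∀ i j, ∃ z : ℤ, (z : ℝ) = Lap b F i j := by
        intro i j
        rw [Lap_apply]
        have h : ∀ σ : α, ∃ z : ℤ, σ ∈ F → (z : ℝ) = b σ i * b σ j := by
          intro σ
          by_cases hσ : σ ∈ F
          · obtain ⟨z, hz⟩ := hinteg σ hσ i
            obtain ⟨z', hz'⟩ := hinteg σ hσ j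
            exact ⟨z * z', fun _ => by rw [hz, hz']; push_cast; rfl⟩
          · exact ⟨0, fun h => absurd h hσ⟩
        choose z hz using h
        refine ⟨∑ σ ∈ F, z σ, ?_⟩
        push_cast
        exact Finset.sum_congr rfl fun σ hσ => hz σ hσ
      choose M hM using this
      exact ⟨Matrix.of M, by ext i j; simp [hM]⟩
    obtain ⟨M, hM⟩ := hex
    refine prod_ge_one e he0 M.charpoly ?_
    rw [← Matrix.charpoly_map, hM, hL.charpoly_eq]
    simp [he]
  have htr : ∑ σ ∈ F, ∑ i, b σ i ^ 2 = ∑ i, e i := by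
    have h1 := hL.trace_eq_sum_eigenvalues
    simp only [Matrix.trace, Matrix.diag, Lap_apply] at h1
    rw [Finset.sum_comm]
    simpa [sq, he] using h1
  have htr2 : ∑ i, e i = ∑ i ∈ univ.filter (fun i => e i ≠ 0), e i := by
    rw [Finset.sum_filter_ne_zero]
  rw [htr, htr2]
  calc _ ≤ ∑ i ∈ univ.filter (fun i => e i ≠ 0), (e i - Real.log (e i)) := by
        refine Finset.sum_le_sum fun i hi => log_bound hl hl1 ?_
        exact lt_of_le_of_ne (he0 i) (Ne.symm (Finset.mem_filter.1 hi).2)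
    _ = ∑ i ∈ univ.filter (fun i => e i ≠ 0), e i
        - Real.log (∏ i ∈ univ.filter (fun i => e i ≠ 0), e i) := by
        rw [Finset.sum_sub_distrib, Real.log_prod]
        intro i hi; exact (Finset.mem_filter.1 hi).2
    _ ≤ _ := by
        have := Real.log_nonneg hpr
        linarith

/-- rank as span dimension -/
def rk (b : α → ι → ℝ) (F : Finset α) : ℕ := Module.finrank ℝ (Submodule.span ℝ (b '' (F : Set α)))

lemma rank_Lap (b : α → ι → ℝ) (F : Finset α) : (Lap b F).rank = rk b F := by
  let B : Matrix ι F ℝ := Matrix.of fun i σ => b σ.1 i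
  have h : Lap b F = B * Bᵀ := by
    ext i j
    rw [Lap_apply, Matrix.mul_apply, ← Finset.sum_coe_sort F (fun σ => b σ i * b σ j)]
    simp [B]
  rw [h, Matrix.rank_self_mul_transpose, Matrix.rank_eq_finrank_span_cols, rk]
  have e : Set.range B.col = b '' (F : Set α) := by
    ext v
    simp only [Set.mem_range, Set.mem_image, SetLike.mem_coe, Subtype.exists]
    constructor
    · rintro ⟨σ, hσ, rfl⟩; exact ⟨σ, hσ, rfl⟩
    · rintro ⟨σ, hσ, rfl⟩; exact ⟨σ, hσ, rfl⟩
  rw [e]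

end Luck

end Part3

section Part4

section SymAbs
open Matrix
variable {α ι : Type*} [Fintype ι] [DecidableEq ι] 

lemma xx_sym {l : ℝ} (hl : 0 < l) (b : α → ι → ℝ) (F : Finset α) (ρ : α ≃ α) (P : ι ≃ ι)
    (s' : α → ℝ) (s : ι → ℝ) (hs' : ∀ a, s' a * s' a = 1) (hs : ∀ i, s i * s i = 1)
    (hb : ∀ σ i, b (ρ σ) (P i) = s' σ * s i * b σ i) (i : ι) :
    xx l b (F.map ρ.toEmbedding) (P i) = xx l b F i := by
  set w := Hv l b F (Pi.single i 1) with hw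
  have hspec := Hv_spec hl b F (Pi.single i 1)
  rw [← hw] at hspec
  have key : (fun j => s i * s (P.symm j) * w (P.symm j))
      = Hv l b (F.map ρ.toEmbedding) (Pi.single (P i) 1) := by
    apply Hv_unique hl
    have hdot : ∀ σ, b (ρ σ) ⬝ᵥ (fun j => s i * s (P.symm j) * w (P.symm j))
        = s i * s' σ * (b σ ⬝ᵥ w) := by
      intro σ
      simp only [dotProduct]
      rw [← P.sum_comp, Finset.mul_sum]
      refine Finset.sum_congr rfl fun j _ => ?_
      rw [hb, Equiv.symm_apply_apply]
      linear_combination (s i * s' σ * b σ j * w j) * hs j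
    rw [Lap_mulVec]
    rw [Lap_mulVec] at hspec
    ext j'
    obtain ⟨j, rfl⟩ := P.surjective j'
    have h := congrFun hspec j
    simp only [Pi.add_apply, Pi.smul_apply, smul_eq_mul, Finset.sum_apply] at h ⊢
    rw [Finset.sum_map]
    simp only [Equiv.coe_toEmbedding, hdot, hb, Equiv.symm_apply_apply]
    have h1 : ∑ x ∈ F, s i * s' x * (b x ⬝ᵥ w) * (s' x * s j * b x j)
        = s i * s j * ∑ x ∈ F, (b x ⬝ᵥ w) * b x j := by
      rw [Finset.mul_sum]
      refine Finset.sum_congr rfl fun x _ => ?_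
      linear_combination (s i * s j * (b x ⬝ᵥ w) * b x j) * hs' x
    rw [h1]
    have h2 : (Pi.single (P i) (1 : ℝ) : ι → ℝ) (P j) = s i * s j * (Pi.single i (1 : ℝ) : ι → ℝ) j := by
      by_cases hij : j = i
      · subst hij; simp [hs]
      · simp [hij]
    rw [h2]
    linear_combination (s i * s j) * h
  have := congrFun key (P i)
  simp only [Equiv.symm_apply_apply, hs, one_mul] at this
  rw [xx, ← this]
  rfl

end SymAbs

section conc
variable {n d : ℕ}

/-- boundary vectors -/
def bC (n : ℕ) (σ τ : Finset (Fin n)) : ℝ := bdCoeff τ σ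

def ridges (n d : ℕ) : Finset (Finset (Fin n)) := Finset.univ.filter (fun τ => τ.card = d)

lemma bC_erase {σ : Finset (Fin n)} {v : Fin n} (hv : v ∈ σ) :
    bC n σ (σ.erase v) = ∏ w ∈ σ.erase v, (if w < v then (-1 : ℝ) else 1) := by
  unfold bC bdCoeff
  rw [if_pos ⟨Finset.erase_subset _ _, Finset.card_erase_add_one hv⟩]
  have : σ \ σ.erase v = {v} := by
    ext w; simp only [Finset.mem_sdiff, Finset.mem_erase, Finset.mem_singleton]
    constructor
    · rintro ⟨h1, h2⟩; by_contra h; exact h2 ⟨h, h1⟩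
    · rintro rfl; exact ⟨hv, by simp⟩
  rw [this, Finset.sum_singleton, Finset.prod_ite, Finset.prod_const, Finset.prod_const_one, mul_one]
  congr 2
  ext w; simp only [mem_filter, mem_erase]
  constructor
  · rintro ⟨h1, h2⟩; exact ⟨⟨h2.ne, h1⟩, h2⟩
  · rintro ⟨h1, h2⟩; exact ⟨h1.2, h2⟩

lemma bC_ne_zero {σ τ : Finset (Fin n)} (h : bC n σ τ ≠ 0) : ∃ v ∈ σ, τ = σ.erase v := by
  unfold bC bdCoeff at h
  split_ifs at h with h1
  · obtain ⟨v, hv⟩ : ∃ v, σ \ τ = {v} := by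
      rw [← Finset.card_eq_one, Finset.card_sdiff_of_subset h1.1]; omega
    have hvm : v ∈ σ \ τ := by rw [hv]; simp
    refine ⟨v, (Finset.mem_sdiff.1 hvm).1, ?_⟩
    rw [← Finset.sdiff_singleton_eq_erase, ← hv, Finset.sdiff_sdiff_eq_self h1.1]
  · exact absurd rfl h

lemma bC_erase_sq {σ : Finset (Fin n)} {v : Fin n} (hv : v ∈ σ) :
    bC n σ (σ.erase v) * bC n σ (σ.erase v) = 1 := by
  rw [bC_erase hv, ← Finset.prod_mul_distrib]
  exact Finset.prod_eq_one fun w _ => by split_ifs <;> simp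

/-- inversion sign -/
def invS (π : Equiv.Perm (Fin n)) (B : Finset (Fin n)) : ℝ :=
  ∏ x ∈ B, ∏ y ∈ B, (if x < y ∧ π y < π x then (-1 : ℝ) else 1)

lemma invS_sq (π : Equiv.Perm (Fin n)) (B : Finset (Fin n)) : invS π B * invS π B = 1 := by
  unfold invS
  rw [← Finset.prod_mul_distrib]
  refine Finset.prod_eq_one fun x _ => ?_
  rw [← Finset.prod_mul_distrib]
  exact Finset.prod_eq_one fun y _ => by split_ifs <;> simp

lemma invS_insert (π : Equiv.Perm (Fin n)) {B : Finset (Fin n)} {v : Fin n} (hv : v ∉ B) :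
    invS π (insert v B) = invS π B * ∏ y ∈ B, ((if v < y ∧ π y < π v then (-1 : ℝ) else 1) *
      (if y < v ∧ π v < π y then (-1 : ℝ) else 1)) := by
  unfold invS
  rw [Finset.prod_insert hv, Finset.prod_insert hv, Finset.prod_mul_distrib]
  have : ∏ x ∈ B, ∏ y ∈ insert v B, (if x < y ∧ π y < π x then (-1 : ℝ) else 1)
      = ∏ x ∈ B, ((if x < v ∧ π v < π x then (-1 : ℝ) else 1) *
        ∏ y ∈ B, (if x < y ∧ π y < π x then (-1 : ℝ) else 1)) :=
    Finset.prod_congr rfl fun x _ => by rw [Finset.prod_insert hv]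
  rw [this, Finset.prod_mul_distrib]
  simp only [lt_irrefl, and_self, if_false, one_mul]
  ring

def permF (π : Equiv.Perm (Fin n)) : Finset (Fin n) ≃ Finset (Fin n) := π.finsetCongr

lemma bC_perm (π : Equiv.Perm (Fin n)) (σ τ : Finset (Fin n)) :
    bC n (permF π σ) (permF π τ) = invS π σ * invS π τ * bC n σ τ := by
  by_cases h : ∃ v ∈ σ, τ = σ.erase v
  · obtain ⟨v, hv, rfl⟩ := h
    have e1 : permF π (σ.erase v) = (permF π σ).erase (π v) := by
      simp [permF, Equiv.finsetCongr_apply, Finset.map_erase]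
    have hv' : π v ∈ permF π σ := by simp [permF, Equiv.finsetCongr_apply, hv]
    rw [e1, bC_erase hv', ← e1]
    have e2 : ∏ w ∈ permF π (σ.erase v), (if w < π v then (-1 : ℝ) else 1)
      = ∏ w ∈ σ.erase v, (if π w < π v then (-1 : ℝ) else 1) := by
      simp [permF, Equiv.finsetCongr_apply, -Finset.map_erase]
    rw [e2, bC_erase hv]
    have e3 := invS_insert π (Finset.notMem_erase v σ)
    rw [Finset.insert_erase hv] at e3
    rw [e3]
    have e4 := invS_sq π (σ.erase v)
    have e5 : ∀ q1 q2 : ℝ, invS π (σ.erase v) * q1 * invS π (σ.erase v) * q2 = q1 * q2 := by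
      intro q1 q2; linear_combination (q1 * q2) * e4
    rw [e5, ← Finset.prod_mul_distrib]
    refine Finset.prod_congr rfl fun y hy => ?_
    have hne : y ≠ v := (Finset.mem_erase.1 hy).1
    have hne' : π y ≠ π v := fun h => hne (π.injective h)
    rcases lt_or_gt_of_ne hne with h1 | h1 <;> rcases lt_or_gt_of_ne hne' with h2 | h2 <;>
      simp [h1, h2, h1.not_gt, h2.not_gt]
  · have h1 : bC n σ τ = 0 := by by_contra h2; exact h (bC_ne_zero h2)
    rw [h1, mul_zero]
    by_contra h2
    obtain ⟨v, hv, hτ⟩ := bC_ne_zero h2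
    apply h
    obtain ⟨v', rfl⟩ := π.surjective v
    have hv' : v' ∈ σ := by simpa [permF, Equiv.finsetCongr_apply] using hv
    refine ⟨v', hv', ?_⟩
    apply (permF π).injective
    rw [hτ]
    simp [permF, Equiv.finsetCongr_apply, Finset.map_erase]

lemma EB_xx_sym {l : ℝ} (hl : 0 < l) (p : ℝ) (φ : ℝ → ℝ) {τ τ' : Finset (Fin n)}
    (h : τ ∈ ridges n d) (h' : τ' ∈ ridges n d) :
    EB p (allFaces n d) (fun F => φ (xx l (bC n) F τ))
      = EB p (allFaces n d) (fun F => φ (xx l (bC n) F τ')) := by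
  have hc : τ.card = d := by simpa [ridges] using h
  have hc' : τ'.card = d := by simpa [ridges] using h'
  obtain ⟨π, hπ⟩ : ∃ π : Equiv.Perm (Fin n), permF π τ = τ' := by
    have hcc : Fintype.card {x // x ∈ τ} = Fintype.card {x // x ∈ τ'} := by simp [hc, hc']
    let e : {x // x ∈ τ} ≃ {x // x ∈ τ'} := Fintype.equivOfCardEq hcc
    refine ⟨e.extendSubtype, ?_⟩
    apply Finset.eq_of_subset_of_card_le
    · intro y hy
      simp only [permF, Equiv.finsetCongr_apply, mem_map_equiv] at hy
      have := e.extendSubtype_mem _ hy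
      simpa using this
    · simp [permF, Equiv.finsetCongr_apply, hc, hc']
  rw [← EB_map p (allFaces n d) (permF π) _ (fun F => φ (xx l (bC n) F τ'))]
  · refine EB_congr p fun F _ => ?_
    rw [← hπ, xx_sym hl (bC n) F (permF π) (permF π) (invS π) (invS π) (invS_sq π) (invS_sq π)
      (bC_perm π)]
  · ext σ
    rw [mem_map_equiv]
    simp [allFaces, permF, Equiv.finsetCongr_symm, Equiv.finsetCongr_apply]

/-- faces -/
def fac (d : ℕ) (σ : Finset (Fin n)) (i : Fin (d + 1)) : Finset (Fin n) :=
  if h : σ.card = d + 1 then σ.erase (σ.orderEmbOfFin h i) else ∅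

lemma mem_allFaces {σ : Finset (Fin n)} : σ ∈ allFaces n d ↔ σ.card = d + 1 := by simp [allFaces]

lemma fac_eq {σ : Finset (Fin n)} (h : σ.card = d + 1) (i : Fin (d + 1)) :
    fac d σ i = σ.erase (σ.orderEmbOfFin h i) := by simp [fac, h]

lemma fac_mem {σ : Finset (Fin n)} (h : σ ∈ allFaces n d) (i : Fin (d + 1)) :
    fac d σ i ∈ ridges n d := by
  rw [mem_allFaces] at h
  rw [fac_eq h]
  simp [ridges, Finset.card_erase_of_mem, h]

lemma fac_inj {σ : Finset (Fin n)} (h : σ ∈ allFaces n d) : Function.Injective (fac d σ) := by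
  rw [mem_allFaces] at h
  intro i j hij
  rw [fac_eq h, fac_eq h, Finset.erase_inj _ (Finset.orderEmbOfFin_mem _ _ _)] at hij
  exact (σ.orderEmbOfFin h).injective hij

lemma bC_fac {σ : Finset (Fin n)} (h : σ ∈ allFaces n d) (i : Fin (d + 1)) :
    bC n σ (fac d σ i) * bC n σ (fac d σ i) = 1 := by
  rw [mem_allFaces] at h
  rw [fac_eq h]
  exact bC_erase_sq (Finset.orderEmbOfFin_mem _ _ _)

lemma bC_supp {σ τ : Finset (Fin n)} (h : σ ∈ allFaces n d) (h1 : bC n σ τ ≠ 0) :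
    ∃ i, τ = fac d σ i := by
  rw [mem_allFaces] at h
  obtain ⟨v, hv, rfl⟩ := bC_ne_zero h1
  have : v ∈ Set.range (σ.orderEmbOfFin h) := by rw [Finset.range_orderEmbOfFin]; exact hv
  obtain ⟨i, rfl⟩ := this
  exact ⟨i, by rw [fac_eq h]⟩

lemma fac_det {σ σ' : Finset (Fin n)} (h : σ ∈ allFaces n d) (h' : σ' ∈ allFaces n d)
    {i k : Fin (d + 1)} (hik : i ≠ k) (h1 : fac d σ i = fac d σ' i) (h2 : fac d σ k = fac d σ' k) :
    σ = σ' := by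
  have key : ∀ {ρ : Finset (Fin n)}, ρ ∈ allFaces n d → ρ = fac d ρ i ∪ fac d ρ k := by
    intro ρ hρ
    rw [mem_allFaces] at hρ
    rw [fac_eq hρ, fac_eq hρ]
    ext w
    simp only [mem_union, mem_erase]
    constructor
    · intro hw
      by_cases hwi : w = ρ.orderEmbOfFin hρ i
      · right
        refine ⟨?_, hw⟩
        rw [hwi]
        exact fun h => hik ((ρ.orderEmbOfFin hρ).injective h)
      · exact Or.inl ⟨hwi, hw⟩
    · rintro (h | h) <;> exact h.2
  rw [key h, key h', h1, h2]

lemma card_allFaces (n d : ℕ) : (allFaces n d).card = n.choose (d + 1) := by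
  have : allFaces n d = Finset.powersetCard (d + 1) univ := by
    ext σ; simp [allFaces, Finset.mem_powersetCard]
  rw [this, Finset.card_powersetCard]; simp

lemma card_ridges (n d : ℕ) : (ridges n d).card = n.choose d := by
  have : ridges n d = Finset.powersetCard d univ := by
    ext σ; simp [ridges, Finset.mem_powersetCard]
  rw [this, Finset.card_powersetCard]; simp

lemma card_rel (n d : ℕ) (h : d ≤ n) :
    ((d : ℝ) + 1) * (allFaces n d).card = ((n : ℝ) - d) * (ridges n d).card := by
  rw [card_allFaces, card_ridges]
  have := Nat.choose_succ_right_eq n d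
  rw [← Nat.cast_sub h]
  have h2 : ((n.choose (d + 1) * (d + 1) : ℕ) : ℝ) = ((n.choose d * (n - d) : ℕ) : ℝ) := by
    rw [this]
  push_cast at h2 ⊢
  linarith

lemma dimKer_eq (n : ℕ) (F : Finset (Finset (Fin n))) :
    (dimKer n F : ℝ) = F.card - rk (bC n) F := by
  have h := LinearMap.finrank_range_add_finrank_ker (boundaryMap n F)
  have h2 : Module.finrank ℝ (LinearMap.range (boundaryMap n F)) = rk (bC n) F := by
    unfold rk
    let B : Matrix (Finset (Fin n)) F ℝ := Matrix.of fun i σ => bC n σ.1 i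
    have e : LinearMap.range (boundaryMap n F) = Submodule.span ℝ (bC n '' (F : Set (Finset (Fin n)))) := by
      have e1 : boundaryMap n F = B.mulVecLin := by
        refine LinearMap.ext fun x => funext fun τ => ?_
        simp only [boundaryMap, B, bC, LinearMap.coe_mk, AddHom.coe_mk, Matrix.mulVecLin_apply,
          Matrix.mulVec, dotProduct, Matrix.of_apply, Finset.univ_eq_attach]
        exact Finset.sum_congr rfl fun _ _ => mul_comm _ _
      rw [e1, Matrix.range_mulVecLin]
      congr 1
      ext v
      simp only [Set.mem_range, Set.mem_image, SetLike.mem_coe, Subtype.exists]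
      constructor
      · rintro ⟨σ, hσ, rfl⟩; exact ⟨σ, hσ, rfl⟩
      · rintro ⟨σ, hσ, rfl⟩; exact ⟨σ, hσ, rfl⟩
    rw [e]
  rw [h2] at h
  have h3 : Module.finrank ℝ (↥F → ℝ) = F.card := by simp
  rw [h3] at h
  unfold dimKer
  rw [← h]
  push_cast; ring

end conc

end Part4

section Part5

/-- average over faces and the randomness -/
def Av (n d : ℕ) (p l : ℝ) (Φ : (Fin (d + 1) → ℝ) → ℝ) : ℝ :=
  (∑ σ ∈ allFaces n d, EB p (allFaces n d) (fun F => Φ (fun i => xx l (bC n) F (fac d σ i))))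
    / (allFaces n d).card

/-- average over ridges -/
def mR (n d : ℕ) (p l : ℝ) (φ : ℝ → ℝ) : ℝ :=
  (∑ τ ∈ ridges n d, EB p (allFaces n d) (fun F => φ (xx l (bC n) F τ))) / (ridges n d).card

section fin
variable {n d : ℕ} {p l : ℝ}

lemma ridges_pos (h : d ≤ n) : 0 < ((ridges n d).card : ℝ) := by
  rw [card_ridges]; exact_mod_cast Nat.choose_pos h

lemma allFaces_pos (h : d + 1 ≤ n) : 0 < ((allFaces n d).card : ℝ) := by
  rw [card_allFaces]; exact_mod_cast Nat.choose_pos h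

lemma mR_eq (hl : 0 < l) (φ : ℝ → ℝ) {τ : Finset (Fin n)} (h : τ ∈ ridges n d) :
    EB p (allFaces n d) (fun F => φ (xx l (bC n) F τ)) = mR n d p l φ := by
  unfold mR
  rw [Finset.sum_congr rfl (fun τ' h' => EB_xx_sym (d := d) hl p φ h' h), Finset.sum_const,
    nsmul_eq_mul]
  have : ((ridges n d).card : ℝ) ≠ 0 := by
    have := Finset.card_pos.2 ⟨τ, h⟩
    positivity
  field_simp

lemma Av_coord (hl : 0 < l) (hn : d + 1 ≤ n) (φ : ℝ → ℝ) (i : Fin (d + 1)) :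
    Av n d p l (fun x => φ (x i)) = mR n d p l φ := by
  unfold Av
  rw [Finset.sum_congr rfl (fun σ hσ => mR_eq hl φ (fac_mem hσ i)), Finset.sum_const, nsmul_eq_mul]
  have := (allFaces_pos hn).ne'
  field_simp

/-- sum over faces through pairs of facets -/
lemma sum_pair {i k : Fin (d + 1)} (hik : i ≠ k) (g : Finset (Fin n) → Finset (Fin n) → ℝ)
    (hg : ∀ a b, 0 ≤ g a b) :
    ∑ σ ∈ allFaces n d, g (fac d σ i) (fac d σ k) ≤ ∑ τ ∈ ridges n d, ∑ τ' ∈ ridges n d, g τ τ' := by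
  rw [← Finset.sum_product']
  have hinj : Set.InjOn (fun σ => (fac d σ i, fac d σ k)) (allFaces n d : Set (Finset (Fin n))) := by
    intro σ hσ σ' hσ' h
    simp only [Prod.mk.injEq] at h
    exact fac_det hσ hσ' hik h.1 h.2
  rw [← Finset.sum_image (f := fun q : Finset (Fin n) × Finset (Fin n) => g q.1 q.2) hinj]
  refine Finset.sum_le_sum_of_subset_of_nonneg ?_ fun q _ _ => hg _ _
  intro q hq
  obtain ⟨σ, hσ, rfl⟩ := Finset.mem_image.1 hq
  exact Finset.mem_product.2 ⟨fac_mem hσ i, fac_mem hσ k⟩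

lemma sum_xx_diff_ridges (hl : 0 < l) {F : Finset (Finset (Fin n))} {a : Finset (Fin n)}
    (h : a ∉ F) : ∑ τ ∈ ridges n d, |xx l (bC n) (insert a F) τ - xx l (bC n) F τ| ≤ 1 := by
  refine le_trans (Finset.sum_le_sum_of_subset_of_nonneg (Finset.subset_univ _)
    fun _ _ _ => abs_nonneg _) (sum_xx_diff hl (bC n) h)

lemma pair_bound (hl : 0 < l) {i k : Fin (d + 1)} (hik : i ≠ k) {F F' : Finset (Finset (Fin n))}
    {a : Finset (Fin n)} (h : a ∉ F) (h' : a ∉ F') :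
    ∑ σ ∈ allFaces n d, |xx l (bC n) (insert a F) (fac d σ i) - xx l (bC n) F (fac d σ i)|
      * |xx l (bC n) (insert a F') (fac d σ k) - xx l (bC n) F' (fac d σ k)| ≤ 1 := by
  refine (sum_pair hik (fun τ τ' => |xx l (bC n) (insert a F) τ - xx l (bC n) F τ|
    * |xx l (bC n) (insert a F') τ' - xx l (bC n) F' τ'|) (fun _ _ => by positivity)).trans ?_
  rw [← Finset.sum_mul_sum]
  have h1 := sum_xx_diff_ridges (d := d) hl h
  have h2 := sum_xx_diff_ridges (d := d) hl h'
  have h3 : 0 ≤ ∑ τ ∈ ridges n d, |xx l (bC n) (insert a F') τ - xx l (bC n) F' τ| :=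
    Finset.sum_nonneg fun _ _ => abs_nonneg _
  nlinarith

lemma prod_diff_le {ι : Type*} (I : Finset ι) (f g : ι → ℝ) (hf : ∀ i, |f i| ≤ 1)
    (hg : ∀ i, |g i| ≤ 1) : |∏ i ∈ I, f i - ∏ i ∈ I, g i| ≤ ∑ i ∈ I, |f i - g i| := by
  induction I using Finset.induction_on with
  | empty => simp
  | insert a I ha ih =>
    rw [Finset.prod_insert ha, Finset.prod_insert ha, Finset.sum_insert ha]
    have e : f a * ∏ i ∈ I, f i - g a * ∏ i ∈ I, g i
        = (f a - g a) * ∏ i ∈ I, f i + g a * (∏ i ∈ I, f i - ∏ i ∈ I, g i) := by ring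
    rw [e]
    refine (abs_add_le _ _).trans ?_
    rw [abs_mul, abs_mul]
    have h1 : |∏ i ∈ I, f i| ≤ 1 := by
      rw [Finset.abs_prod]; exact Finset.prod_le_one (fun _ _ => abs_nonneg _) fun i _ => hf i
    have := hg a
    have h2 := abs_nonneg (f a - g a)
    have h3 := abs_nonneg (∏ i ∈ I, f i - ∏ i ∈ I, g i)
    nlinarith [abs_nonneg (g a)]

lemma decor_aux (hl : 0 < l) (h0 : 0 ≤ p) (h1 : p ≤ 1) (φ : Fin (d + 1) → ℝ → ℝ) {K : ℝ}
    (hK : 0 ≤ K)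
    (hφ1 : ∀ i, ∀ x ∈ Set.Icc (0 : ℝ) 1, |φ i x| ≤ 1)
    (hφL : ∀ i, ∀ x ∈ Set.Icc (0 : ℝ) 1, ∀ y ∈ Set.Icc (0 : ℝ) 1, |φ i x - φ i y| ≤ K * |x - y|)
    (I : Finset (Fin (d + 1))) :
    ∑ σ ∈ allFaces n d, |EB p (allFaces n d) (fun F => ∏ i ∈ I, φ i (xx l (bC n) F (fac d σ i)))
      - ∏ i ∈ I, EB p (allFaces n d) (fun F => φ i (xx l (bC n) F (fac d σ i)))|
      ≤ I.card * (p * (allFaces n d).card * ((d + 1) * K ^ 2)) := by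
  have hx : ∀ F τ, xx l (bC n) F τ ∈ Set.Icc (0 : ℝ) 1 := fun F τ =>
    ⟨xx_nonneg hl _ _ _, xx_le_one hl _ _ _⟩
  induction I using Finset.induction_on with
  | empty => simp [EB_const]
  | insert k I hk ih =>
    have hcov := EB_cov h0 h1 (allFaces n d) (K := (d + 1) * K ^ 2) (allFaces n d)
      (fun σ F => ∏ i ∈ I, φ i (xx l (bC n) F (fac d σ i)))
      (fun σ F => φ k (xx l (bC n) F (fac d σ k))) (by
        intro a ha F hF F' hF' hn hn'
        calc _ ≤ ∑ σ ∈ allFaces n d, ∑ i ∈ I, K ^ 2 *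
              (|xx l (bC n) (insert a F) (fac d σ i) - xx l (bC n) F (fac d σ i)|
              * |xx l (bC n) (insert a F') (fac d σ k) - xx l (bC n) F' (fac d σ k)|) := by
              refine Finset.sum_le_sum fun σ _ => ?_
              have e1 := prod_diff_le I (fun i => φ i (xx l (bC n) (insert a F) (fac d σ i)))
                (fun i => φ i (xx l (bC n) F (fac d σ i))) (fun i => hφ1 i _ (hx _ _))
                (fun i => hφ1 i _ (hx _ _))
              have e2 := hφL k _ (hx (insert a F') (fac d σ k)) _ (hx F' (fac d σ k))
              have e3 : |∏ i ∈ I, φ i (xx l (bC n) (insert a F) (fac d σ i))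
                  - ∏ i ∈ I, φ i (xx l (bC n) F (fac d σ i))|
                  ≤ ∑ i ∈ I, K * |xx l (bC n) (insert a F) (fac d σ i) - xx l (bC n) F (fac d σ i)| :=
                e1.trans (Finset.sum_le_sum fun i _ => hφL i _ (hx _ _) _ (hx _ _))
              refine (mul_le_mul e3 e2 (abs_nonneg _) (Finset.sum_nonneg fun _ _ => by positivity)).trans ?_
              rw [Finset.sum_mul]
              exact Finset.sum_le_sum fun i _ => le_of_eq (by ring)
          _ = ∑ i ∈ I, K ^ 2 * ∑ σ ∈ allFaces n d,
              (|xx l (bC n) (insert a F) (fac d σ i) - xx l (bC n) F (fac d σ i)|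
              * |xx l (bC n) (insert a F') (fac d σ k) - xx l (bC n) F' (fac d σ k)|) := by
              rw [Finset.sum_comm]
              exact Finset.sum_congr rfl fun i _ => by rw [Finset.mul_sum]
          _ ≤ ∑ i ∈ I, K ^ 2 * 1 := by
              refine Finset.sum_le_sum fun i hi => ?_
              have hik : i ≠ k := fun h => hk (h ▸ hi)
              have := pair_bound hl hik hn hn'
              have hK2 : 0 ≤ K ^ 2 := by positivity
              exact mul_le_mul_of_nonneg_left this hK2
          _ ≤ _ := by
              rw [Finset.sum_const, nsmul_eq_mul, mul_one]
              have : (I.card : ℝ) ≤ d + 1 := by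
                have := Finset.card_le_univ I
                simp only [Fintype.card_fin] at this
                exact_mod_cast this
              gcongr)
    rw [Finset.card_insert_of_notMem hk]
    push_cast
    calc _ ≤ ∑ σ ∈ allFaces n d, (|EB p (allFaces n d) (fun F => (∏ i ∈ I, φ i (xx l (bC n) F (fac d σ i)))
          * φ k (xx l (bC n) F (fac d σ k)))
          - EB p (allFaces n d) (fun F => ∏ i ∈ I, φ i (xx l (bC n) F (fac d σ i)))
          * EB p (allFaces n d) (fun F => φ k (xx l (bC n) F (fac d σ k)))| +
          |EB p (allFaces n d) (fun F => ∏ i ∈ I, φ i (xx l (bC n) F (fac d σ i)))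
      - ∏ i ∈ I, EB p (allFaces n d) (fun F => φ i (xx l (bC n) F (fac d σ i)))|) := by
          refine Finset.sum_le_sum fun σ _ => ?_
          have e : EB p (allFaces n d) (fun F => ∏ i ∈ insert k I, φ i (xx l (bC n) F (fac d σ i)))
              = EB p (allFaces n d) (fun F => (∏ i ∈ I, φ i (xx l (bC n) F (fac d σ i)))
              * φ k (xx l (bC n) F (fac d σ k))) :=
            EB_congr p fun F _ => by rw [Finset.prod_insert hk, mul_comm]
          rw [e, Finset.prod_insert hk]
          have hb : |EB p (allFaces n d) (fun F => φ k (xx l (bC n) F (fac d σ k)))| ≤ 1 :=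
            EB_abs_le_const h0 h1 fun F _ => hφ1 k _ (hx _ _)
          set a1 := EB p (allFaces n d) (fun F => (∏ i ∈ I, φ i (xx l (bC n) F (fac d σ i)))
              * φ k (xx l (bC n) F (fac d σ k)))
          set a2 := EB p (allFaces n d) (fun F => ∏ i ∈ I, φ i (xx l (bC n) F (fac d σ i)))
          set a3 := EB p (allFaces n d) (fun F => φ k (xx l (bC n) F (fac d σ k)))
          set a4 := ∏ i ∈ I, EB p (allFaces n d) (fun F => φ i (xx l (bC n) F (fac d σ i)))
          have : a1 - a3 * a4 = (a1 - a2 * a3) + a3 * (a2 - a4) := by ring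
          rw [this]
          refine (abs_add_le _ _).trans ?_
          rw [abs_mul a3]
          have := mul_le_of_le_one_left (abs_nonneg (a2 - a4)) hb
          linarith
      _ ≤ _ := by
          rw [Finset.sum_add_distrib]
          linarith

/-- Asymptotic independence. -/
lemma decor (hl : 0 < l) (h0 : 0 ≤ p) (h1 : p ≤ 1) (hn : d + 1 ≤ n)
    (φ : Fin (d + 1) → ℝ → ℝ) {K : ℝ} (hK : 0 ≤ K)
    (hφ1 : ∀ i, ∀ x ∈ Set.Icc (0 : ℝ) 1, |φ i x| ≤ 1)
    (hφL : ∀ i, ∀ x ∈ Set.Icc (0 : ℝ) 1, ∀ y ∈ Set.Icc (0 : ℝ) 1, |φ i x - φ i y| ≤ K * |x - y|) :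
    |Av n d p l (fun x => ∏ i, φ i (x i)) - ∏ i, mR n d p l (φ i)| ≤ p * ((d + 1) ^ 2 * K ^ 2) := by
  have hM := allFaces_pos hn
  have h := decor_aux (n := n) hl h0 h1 φ hK hφ1 hφL Finset.univ
  have e : Av n d p l (fun x => ∏ i, φ i (x i)) - ∏ i, mR n d p l (φ i)
      = (∑ σ ∈ allFaces n d, (EB p (allFaces n d) (fun F => ∏ i, φ i (xx l (bC n) F (fac d σ i)))
      - ∏ i, EB p (allFaces n d) (fun F => φ i (xx l (bC n) F (fac d σ i))))) / (allFaces n d).card := by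
    rw [Finset.sum_sub_distrib, sub_div]
    congr 1
    have : ∑ σ ∈ allFaces n d, ∏ i, EB p (allFaces n d) (fun F => φ i (xx l (bC n) F (fac d σ i)))
        = ∑ σ ∈ allFaces n d, ∏ i, mR n d p l (φ i) :=
      Finset.sum_congr rfl fun σ hσ => Finset.prod_congr rfl fun i _ => mR_eq hl _ (fac_mem hσ i)
    rw [this, Finset.sum_const, nsmul_eq_mul]
    field_simp
  rw [e, abs_div, abs_of_pos hM, div_le_iff₀ hM]
  refine (Finset.abs_sum_le_sum_abs _ _).trans (h.trans (le_of_eq ?_))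
  simp only [Finset.card_univ, Fintype.card_fin]
  push_cast
  ring

end fin

end Part5

section Part6

section fin
variable {n d : ℕ} {p l : ℝ}

lemma bsum {σ : Finset (Fin n)} (hσ : σ ∈ allFaces n d) (S : Finset (Finset (Fin n)))
    (hS : ridges n d ⊆ S) (g : Finset (Fin n) → ℝ) (hg : ∀ τ, bC n σ τ = 0 → g τ = 0) :
    ∑ τ ∈ S, g τ = ∑ i, g (fac d σ i) := by
  rw [← Finset.sum_image (s := univ) (g := fac d σ) (f := g) (fun _ _ _ _ h => fac_inj hσ h)]
  symm
  refine Finset.sum_subset ?_ ?_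
  · intro τ hτ
    obtain ⟨i, _, rfl⟩ := Finset.mem_image.1 hτ
    exact hS (fac_mem hσ i)
  · intro τ _ hτ
    apply hg
    by_contra h
    obtain ⟨i, rfl⟩ := bC_supp hσ h
    exact hτ (Finset.mem_image_of_mem _ (Finset.mem_univ i))

lemma bC_abs {σ : Finset (Fin n)} (h : σ ∈ allFaces n d) (i : Fin (d + 1)) :
    |bC n σ (fac d σ i)| = 1 := by
  have := bC_fac h i
  rw [← abs_mul_abs_self] at this
  nlinarith [abs_nonneg (bC n σ (fac d σ i))]

/-- off-diagonal size -/
def offd (d : ℕ) (l : ℝ) (F : Finset (Finset (Fin n))) (σ : Finset (Fin n)) : ℝ :=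
  ∑ i : Fin (d + 1), ∑ k : Fin (d + 1), if i = k then 0 else
    |Hv l (bC n) F (Pi.single (fac d σ k) 1) (fac d σ i)|

def hh (d : ℕ) (l : ℝ) (F : Finset (Finset (Fin n))) (σ : Finset (Fin n)) (i : Fin (d + 1)) : ℝ :=
  bC n σ (fac d σ i) * Hv l (bC n) F (bC n σ) (fac d σ i)

lemma QQ_eq_sum {σ : Finset (Fin n)} (hσ : σ ∈ allFaces n d) (F : Finset (Finset (Fin n))) :
    QQ l (bC n) F (bC n σ) = ∑ i, hh d l F σ i :=
  bsum hσ univ (Finset.subset_univ _) (fun τ => bC n σ τ * Hv l (bC n) F (bC n σ) τ)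
    (fun τ h => by simp [h])

lemma hh_sub {σ : Finset (Fin n)} (hσ : σ ∈ allFaces n d) (F : Finset (Finset (Fin n)))
    (i : Fin (d + 1)) :
    |hh d l F σ i - xx l (bC n) F (fac d σ i)| ≤
      ∑ k : Fin (d + 1), if i = k then 0 else
      |Hv l (bC n) F (Pi.single (fac d σ k) 1) (fac d σ i)| := by
  unfold hh
  rw [Hv_sum]
  rw [bsum hσ univ (Finset.subset_univ _)
    (fun τ => bC n σ τ * Hv l (bC n) F (Pi.single τ 1) (fac d σ i)) (fun τ h => by simp [h])]
  rw [Finset.mul_sum, ← Finset.add_sum_erase _ _ (Finset.mem_univ i)]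
  have e : bC n σ (fac d σ i) * (bC n σ (fac d σ i) * Hv l (bC n) F (Pi.single (fac d σ i) 1) (fac d σ i))
      = xx l (bC n) F (fac d σ i) := by
    rw [← mul_assoc, bC_fac hσ, one_mul]; rfl
  rw [e, add_sub_cancel_left]
  refine (Finset.abs_sum_le_sum_abs _ _).trans ?_
  rw [← Finset.add_sum_erase univ _ (Finset.mem_univ i)]
  simp only [if_true, zero_add]
  refine Finset.sum_le_sum fun k hk => ?_
  rw [if_neg (Finset.ne_of_mem_erase hk).symm, abs_mul, abs_mul, bC_abs hσ, bC_abs hσ]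
  simp

lemma hh_sub_le {σ : Finset (Fin n)} (hσ : σ ∈ allFaces n d) (F : Finset (Finset (Fin n)))
    (i : Fin (d + 1)) : |hh d l F σ i - xx l (bC n) F (fac d σ i)| ≤ offd d l F σ := by
  refine (hh_sub hσ F i).trans ?_
  exact Finset.single_le_sum (f := fun i => ∑ k : Fin (d + 1), if i = k then 0 else
      |Hv l (bC n) F (Pi.single (fac d σ k) 1) (fac d σ i)|)
      (fun i _ => Finset.sum_nonneg fun k _ => by split_ifs <;> positivity) (Finset.mem_univ i)

lemma QQ_sub_le {σ : Finset (Fin n)} (hσ : σ ∈ allFaces n d) (F : Finset (Finset (Fin n))) :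
    |QQ l (bC n) F (bC n σ) - ∑ i, xx l (bC n) F (fac d σ i)| ≤ offd d l F σ := by
  rw [QQ_eq_sum hσ, ← Finset.sum_sub_distrib]
  exact (Finset.abs_sum_le_sum_abs _ _).trans (Finset.sum_le_sum fun i _ => hh_sub hσ F i)

lemma Hv_single_abs (hl : 0 < l) (F : Finset (Finset (Fin n))) (a b : Finset (Fin n)) :
    |Hv l (bC n) F (Pi.single a 1) b| ≤ 1 := by
  have h1 := Hv_single_sq hl (bC n) F a
  have h2 := xx_le_one hl (bC n) F a
  have h3 : (Hv l (bC n) F (Pi.single a 1) b) ^ 2 ≤ ∑ j, (Hv l (bC n) F (Pi.single a 1) j) ^ 2 :=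
    Finset.single_le_sum (f := fun j => (Hv l (bC n) F (Pi.single a 1) j) ^ 2)
      (fun _ _ => sq_nonneg _) (Finset.mem_univ b)
  rw [← sq_le_one_iff_abs_le_one]
  linarith

lemma offd_nonneg (F : Finset (Finset (Fin n))) (σ : Finset (Fin n)) : 0 ≤ offd d l F σ :=
  Finset.sum_nonneg fun i _ => Finset.sum_nonneg fun k _ => by split_ifs <;> positivity

lemma offd_le (hl : 0 < l) (F : Finset (Finset (Fin n))) (σ : Finset (Fin n)) :
    offd d l F σ ≤ (d + 1) ^ 2 := by
  unfold offd
  calc _ ≤ ∑ i : Fin (d + 1), ∑ k : Fin (d + 1), (1 : ℝ) := by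
        refine Finset.sum_le_sum fun i _ => Finset.sum_le_sum fun k _ => ?_
        split_ifs
        · norm_num
        · exact Hv_single_abs hl F _ _
    _ = _ := by simp; ring

lemma sum_offd_le (hl : 0 < l) (F : Finset (Finset (Fin n))) :
    ∑ σ ∈ allFaces n d, offd d l F σ
      ≤ (d + 1) ^ 2 * Real.sqrt ((allFaces n d).card * (ridges n d).card) := by
  unfold offd
  rw [Finset.sum_comm]
  calc _ ≤ ∑ i : Fin (d + 1), ∑ k : Fin (d + 1),
        Real.sqrt ((allFaces n d).card * (ridges n d).card) := by
        refine Finset.sum_le_sum fun i _ => ?_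
        rw [Finset.sum_comm]
        refine Finset.sum_le_sum fun k _ => ?_
        by_cases hik : i = k
        · simp only [hik, if_true, Finset.sum_const_zero]; positivity
        · simp only [if_neg hik]
          apply Real.le_sqrt_of_sq_le
          refine (sq_sum_le_card_mul_sum_sq).trans ?_
          refine mul_le_mul_of_nonneg_left ?_ (by positivity)
          simp only [sq_abs]
          refine (sum_pair (fun h => hik h.symm) (fun τ τ' => (Hv l (bC n) F (Pi.single τ 1) τ') ^ 2)
            (fun _ _ => sq_nonneg _)).trans ?_
          calc _ ≤ ∑ τ ∈ ridges n d, (1 : ℝ) := by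
                refine Finset.sum_le_sum fun τ _ => ?_
                refine le_trans (Finset.sum_le_sum_of_subset_of_nonneg (Finset.subset_univ _)
                  fun _ _ _ => sq_nonneg _) ((Hv_single_sq hl (bC n) F τ).trans (xx_le_one hl _ _ _))
            _ = _ := by simp
    _ = _ := by simp; ring

/-- limiting functional -/
def PhiF (l : ℝ) (f : ℝ → ℝ) {d : ℕ} (i : Fin (d + 1)) (x : Fin (d + 1) → ℝ) : ℝ :=
  f (x i - x i ^ 2 / (l + ∑ k, x k)) * (x i / (l + ∑ k, x k))

lemma phi_arith {l x h Q S e D B K : ℝ} (f : ℝ → ℝ) (hl : 0 < l) (hx : x ∈ Set.Icc (0 : ℝ) 1)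
    (hxS : x ≤ S) (hQ : 0 ≤ Q) (hhD : |h| ≤ D) (hhx : |h - x| ≤ e) (hQS : |Q - S| ≤ e)
    (hB : ∀ y ∈ Set.Icc (0 : ℝ) 1, |f y| ≤ B) (hK0 : 0 ≤ K)
    (hK : ∀ y ∈ Set.Icc (0 : ℝ) 1, ∀ z ∈ Set.Icc (0 : ℝ) 1, |f y - f z| ≤ K * |y - z|)
    (hy : x - h ^ 2 / (l + Q) ∈ Set.Icc (0 : ℝ) 1) :
    |f (x - h ^ 2 / (l + Q)) * (h / (l + Q)) - f (x - x ^ 2 / (l + S)) * (x / (l + S))|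
      ≤ (K * ((D + 2) / l) * (D / l) + B * (2 / l)) * e := by
  have he : 0 ≤ e := (abs_nonneg _).trans hhx
  have hD : 0 ≤ D := (abs_nonneg _).trans hhD
  have hS0 : 0 ≤ S := hx.1.trans hxS
  have hlQ : 0 < l + Q := by linarith
  have hlS : 0 < l + S := by linarith
  have a1 : |h / (l + Q)| ≤ D / l := by
    rw [abs_div, abs_of_pos hlQ]
    exact div_le_div₀ hD hhD hl (by linarith)
  have a2 : 0 ≤ x / (l + S) := div_nonneg hx.1 hlS.le
  have a3 : x / (l + S) ≤ 1 := by rw [div_le_one hlS]; linarith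
  have a4 : |h / (l + Q) - x / (l + S)| ≤ 2 / l * e := by
    have e1 : h / (l + Q) - x / (l + S) = (h - x) / (l + Q) + (x / (l + S)) * ((S - Q) / (l + Q)) := by
      field_simp; ring
    rw [e1]
    refine (abs_add_le _ _).trans ?_
    have b1 : |(h - x) / (l + Q)| ≤ e / l := by
      rw [abs_div, abs_of_pos hlQ]; exact div_le_div₀ he hhx hl (by linarith)
    have b2 : |(S - Q) / (l + Q)| ≤ e / l := by
      rw [abs_div, abs_of_pos hlQ, abs_sub_comm]; exact div_le_div₀ he hQS hl (by linarith)
    rw [abs_mul, abs_of_nonneg a2]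
    have b3 : x / (l + S) * |(S - Q) / (l + Q)| ≤ 1 * (e / l) :=
      mul_le_mul a3 b2 (abs_nonneg _) (by norm_num)
    have : 2 / l * e = e / l + 1 * (e / l) := by ring
    linarith
  have a5 : |h ^ 2 / (l + Q) - x ^ 2 / (l + S)| ≤ (D + 2) / l * e := by
    have e1 : h ^ 2 / (l + Q) - x ^ 2 / (l + S)
        = (h - x) * (h / (l + Q)) + x * (h / (l + Q) - x / (l + S)) := by
      ring
    rw [e1]
    refine (abs_add_le _ _).trans ?_
    rw [abs_mul, abs_mul, abs_of_nonneg hx.1]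
    have b1 : |h - x| * |h / (l + Q)| ≤ e * (D / l) := mul_le_mul hhx a1 (abs_nonneg _) he
    have b2 : x * |h / (l + Q) - x / (l + S)| ≤ 1 * (2 / l * e) :=
      mul_le_mul hx.2 a4 (abs_nonneg _) (by norm_num)
    have : (D + 2) / l * e = e * (D / l) + 1 * (2 / l * e) := by ring
    linarith
  have hz : x - x ^ 2 / (l + S) ∈ Set.Icc (0 : ℝ) 1 := by
    have e1 : x ^ 2 / (l + S) = x * (x / (l + S)) := by ring
    rw [e1]
    constructor
    · nlinarith [hx.1]
    · nlinarith [hx.1, hx.2, mul_nonneg hx.1 a2]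
  have e1 : f (x - h ^ 2 / (l + Q)) * (h / (l + Q)) - f (x - x ^ 2 / (l + S)) * (x / (l + S))
      = (f (x - h ^ 2 / (l + Q)) - f (x - x ^ 2 / (l + S))) * (h / (l + Q))
        + f (x - x ^ 2 / (l + S)) * (h / (l + Q) - x / (l + S)) := by ring
  rw [e1]
  refine (abs_add_le _ _).trans ?_
  rw [abs_mul, abs_mul]
  have c1 : |f (x - h ^ 2 / (l + Q)) - f (x - x ^ 2 / (l + S))| ≤ K * ((D + 2) / l * e) := by
    refine (hK _ hy _ hz).trans ?_
    refine mul_le_mul_of_nonneg_left ?_ hK0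
    rw [show x - h ^ 2 / (l + Q) - (x - x ^ 2 / (l + S)) = -(h ^ 2 / (l + Q) - x ^ 2 / (l + S)) by ring,
      abs_neg]
    exact a5
  have c2 : |f (x - h ^ 2 / (l + Q)) - f (x - x ^ 2 / (l + S))| * |h / (l + Q)|
      ≤ K * ((D + 2) / l * e) * (D / l) := mul_le_mul c1 a1 (abs_nonneg _) (by positivity)
  have hB0 : 0 ≤ B := (abs_nonneg _).trans (hB _ hz)
  have c3 : |f (x - x ^ 2 / (l + S))| * |h / (l + Q) - x / (l + S)| ≤ B * (2 / l * e) :=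
    mul_le_mul (hB _ hz) a4 (abs_nonneg _) hB0
  have : (K * ((D + 2) / l) * (D / l) + B * (2 / l)) * e
    = K * ((D + 2) / l * e) * (D / l) + B * (2 / l * e) := by ring
  linarith

lemma PhiF_abs {f : ℝ → ℝ} {B : ℝ} (hl : 0 < l) (hB : ∀ y ∈ Set.Icc (0 : ℝ) 1, |f y| ≤ B)
    (i : Fin (d + 1)) (x : Fin (d + 1) → ℝ) (hx : ∀ i, x i ∈ Set.Icc (0 : ℝ) 1) :
    |PhiF l f i x| ≤ B := by
  unfold PhiF
  have hxS : x i ≤ ∑ k, x k := Finset.single_le_sum (fun k _ => (hx k).1) (Finset.mem_univ i)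
  have h0 := (hx i).1
  have h1 := (hx i).2
  have hlS : 0 < l + ∑ k, x k := by linarith
  have a2 : 0 ≤ x i / (l + ∑ k, x k) := div_nonneg h0 hlS.le
  have a3 : x i / (l + ∑ k, x k) ≤ 1 := by rw [div_le_one hlS]; linarith
  have hz : x i - x i ^ 2 / (l + ∑ k, x k) ∈ Set.Icc (0 : ℝ) 1 := by
    have e1 : x i ^ 2 / (l + ∑ k, x k) = x i * (x i / (l + ∑ k, x k)) := by ring
    rw [e1]
    constructor <;> nlinarith
  rw [abs_mul, abs_of_nonneg a2]
  have := hB _ hz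
  nlinarith [abs_nonneg (f (x i - x i ^ 2 / (l + ∑ k, x k)))]

/-- exact Palm identity -/
lemma palm_id (hl : 0 < l) (f : ℝ → ℝ) :
    ∑ τ ∈ ridges n d, EB p (allFaces n d)
      (fun F => f (xx l (bC n) F τ) * (1 - xx l (bC n) F τ))
    = ∑ σ ∈ allFaces n d, p * EB p ((allFaces n d).erase σ) (fun F => ∑ i,
      f (xx l (bC n) F (fac d σ i) - hh d l F σ i ^ 2 / (l + QQ l (bC n) F (bC n σ)))
        * (hh d l F σ i / (l + QQ l (bC n) F (bC n σ)))) := by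
  rw [← EB_sum]
  have e1 : EB p (allFaces n d) (fun F => ∑ τ ∈ ridges n d,
      f (xx l (bC n) F τ) * (1 - xx l (bC n) F τ))
      = EB p (allFaces n d) (fun F => ∑ σ ∈ F, ∑ i, f (xx l (bC n) F (fac d σ i)) *
        (bC n σ (fac d σ i) * Hv l (bC n) F (bC n σ) (fac d σ i) / l)) := by
    refine EB_congr p fun F hF => ?_
    have : ∀ τ, f (xx l (bC n) F τ) * (1 - xx l (bC n) F τ)
        = ∑ σ ∈ F, f (xx l (bC n) F τ) * (bC n σ τ * Hv l (bC n) F (bC n σ) τ / l) := fun τ => by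
      rw [one_sub_xx hl, Finset.mul_sum]
    simp only [this]
    rw [Finset.sum_comm]
    refine Finset.sum_congr rfl fun σ hσ => ?_
    exact bsum (hF hσ) (ridges n d) (Finset.Subset.refl _)
      (fun τ => f (xx l (bC n) F τ) * (bC n σ τ * Hv l (bC n) F (bC n σ) τ / l))
      (fun τ h => by simp [h])
  rw [e1, EB_palm]
  refine Finset.sum_congr rfl fun σ hσ => ?_
  congr 1
  refine EB_congr p fun F hF => ?_
  have hσF : σ ∉ F := fun h => (Finset.notMem_erase σ _) (hF h)
  refine Finset.sum_congr rfl fun i _ => ?_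
  have hQ := QQ_nonneg hl (bC n) F (bC n σ)
  have h0 : l + QQ l (bC n) F (bC n σ) ≠ 0 := by positivity
  rw [xx_insert hl _ hσF, Hv_insert_self hl _ hσF]
  have e2 : Hv l (bC n) F (bC n σ) (fac d σ i) ^ 2 = hh d l F σ i ^ 2 := by
    unfold hh
    rw [mul_pow, sq (bC n σ (fac d σ i)), bC_fac hσ, one_mul]
  rw [e2]
  congr 1
  simp only [Pi.smul_apply, smul_eq_mul]
  unfold hh
  field_simp

end fin

end Part6

section Part7

section fin
variable {n d : ℕ} {p l : ℝ}

lemma palm_term (hl : 0 < l) (h0 : 0 ≤ p) (h1 : p ≤ 1) {f : ℝ → ℝ} {B K : ℝ}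
    (hB : ∀ y ∈ Set.Icc (0 : ℝ) 1, |f y| ≤ B) (hK0 : 0 ≤ K)
    (hK : ∀ y ∈ Set.Icc (0 : ℝ) 1, ∀ z ∈ Set.Icc (0 : ℝ) 1, |f y - f z| ≤ K * |y - z|)
    {C : ℝ} (hC : C = K * (((d : ℝ) ^ 2 + 2 * d + 2 + 2) / l) * (((d : ℝ) ^ 2 + 2 * d + 2) / l) + B * (2 / l))
    {σ : Finset (Fin n)} (hσ : σ ∈ allFaces n d) :
    |EB p ((allFaces n d).erase σ) (fun F => ∑ i,
      f (xx l (bC n) F (fac d σ i) - hh d l F σ i ^ 2 / (l + QQ l (bC n) F (bC n σ)))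
        * (hh d l F σ i / (l + QQ l (bC n) F (bC n σ))))
      - EB p (allFaces n d) (fun F => ∑ i : Fin (d + 1), PhiF l f i (fun k => xx l (bC n) F (fac d σ k)))|
    ≤ (d + 1) * C * EB p (allFaces n d) (fun F => offd d l F σ)
      + 2 * p * ((d + 1) ^ 3 * C + (d + 1) * B) := by
  have hx : ∀ F τ, xx l (bC n) F τ ∈ Set.Icc (0 : ℝ) 1 := fun F τ =>
    ⟨xx_nonneg hl _ _ _, xx_le_one hl _ _ _⟩
  have hB0 : 0 ≤ B := (abs_nonneg _).trans (hB 0 (by simp))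
  have hC0 : 0 ≤ C := by rw [hC]; positivity
  set T : Finset (Finset (Fin n)) → ℝ := fun F => ∑ i,
      f (xx l (bC n) F (fac d σ i) - hh d l F σ i ^ 2 / (l + QQ l (bC n) F (bC n σ)))
        * (hh d l F σ i / (l + QQ l (bC n) F (bC n σ))) with hT
  set U : Finset (Finset (Fin n)) → ℝ := fun F =>
    ∑ i : Fin (d + 1), PhiF l f i (fun k => xx l (bC n) F (fac d σ k)) with hU
  have b1 : |EB p ((allFaces n d).erase σ) T - EB p ((allFaces n d).erase σ) U|
      ≤ (d + 1) * C * EB p ((allFaces n d).erase σ) (fun F => offd d l F σ) := by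
    rw [← EB_sub, ← EB_mul]
    refine (EB_abs_le h0 h1).trans (EB_mono h0 h1 fun F hF => ?_)
    have hσF : σ ∉ F := fun h => (Finset.notMem_erase σ _) (hF h)
    rw [hT, hU]
    simp only
    rw [← Finset.sum_sub_distrib]
    refine (Finset.abs_sum_le_sum_abs _ _).trans ?_
    calc _ ≤ ∑ i : Fin (d + 1), C * offd d l F σ := by
          refine Finset.sum_le_sum fun i _ => ?_
          rw [hC]
          refine phi_arith (D := (d : ℝ) ^ 2 + 2 * d + 2) f hl (hx _ _) ?_ (QQ_nonneg hl _ _ _) ?_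
            (hh_sub_le hσ F i) (QQ_sub_le hσ F) hB hK0 hK ?_
          · exact Finset.single_le_sum (f := fun k => xx l (bC n) F (fac d σ k))
              (fun k _ => (hx _ _).1) (Finset.mem_univ i)
          · have e1 := (hh_sub_le (l := l) hσ F i).trans (offd_le hl F σ)
            have e2 := hx F (fac d σ i)
            have e3 := abs_add_le (hh d l F σ i - xx l (bC n) F (fac d σ i)) (xx l (bC n) F (fac d σ i))
            rw [sub_add_cancel, abs_of_nonneg e2.1] at e3
            have := e2.2
            nlinarith
          · have e1 := hx (insert σ F) (fac d σ i)
            rw [xx_insert hl _ hσF] at e1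
            have e2 : Hv l (bC n) F (bC n σ) (fac d σ i) ^ 2 = hh d l F σ i ^ 2 := by
              unfold hh
              rw [mul_pow, sq (bC n σ (fac d σ i)), bC_fac hσ, one_mul]
            rwa [e2] at e1
      _ = _ := by simp; ring
  have b2 : |EB p ((allFaces n d).erase σ) U - EB p (allFaces n d) U| ≤ 2 * p * ((d + 1) * B) := by
    refine EB_erase_near h0 h1 hσ fun F _ => ?_
    rw [hU]
    refine (Finset.abs_sum_le_sum_abs _ _).trans ?_
    calc _ ≤ ∑ i : Fin (d + 1), B := Finset.sum_le_sum fun i _ =>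
          PhiF_abs hl hB i _ fun k => hx _ _
      _ = _ := by simp
  have b3 : |EB p ((allFaces n d).erase σ) (fun F => offd d l F σ)
      - EB p (allFaces n d) (fun F => offd d l F σ)| ≤ 2 * p * (d + 1) ^ 2 := by
    refine EB_erase_near h0 h1 hσ fun F _ => ?_
    rw [abs_of_nonneg (offd_nonneg F σ)]
    exact offd_le hl F σ
  have b3' := (abs_le.1 b3).2
  have e : EB p ((allFaces n d).erase σ) T - EB p (allFaces n d) U
    = (EB p ((allFaces n d).erase σ) T - EB p ((allFaces n d).erase σ) U)
      + (EB p ((allFaces n d).erase σ) U - EB p (allFaces n d) U) := by ring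
  rw [e]
  refine (abs_add_le _ _).trans ?_
  have hdC : 0 ≤ ((d : ℝ) + 1) * C := by positivity
  have b4 := mul_le_mul_of_nonneg_left
    (show EB p ((allFaces n d).erase σ) (fun F => offd d l F σ) ≤
      EB p (allFaces n d) (fun F => offd d l F σ) + 2 * p * (d + 1) ^ 2 by linarith) hdC
  have e5 : ((d : ℝ) + 1) * C * (EB p (allFaces n d) (fun F => offd d l F σ) + 2 * p * (d + 1) ^ 2)
     + 2 * p * ((d + 1) * B) = (d + 1) * C * EB p (allFaces n d) (fun F => offd d l F σ)
      + 2 * p * ((d + 1) ^ 3 * C + (d + 1) * B) := by ring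
  linarith

lemma ratio_le (hn : d + 1 ≤ n) : ((allFaces n d).card : ℝ) ≤ n * (ridges n d).card := by
  have h := card_rel n d (by omega)
  have hN := ridges_pos (n := n) (d := d) (by omega)
  have hM := allFaces_pos hn
  have : (0 : ℝ) ≤ d := by positivity
  nlinarith

lemma palm_bound {c : ℝ} (hl : 0 < l) (hc : 0 < c) {f : ℝ → ℝ} {B K : ℝ}
    (hB : ∀ y ∈ Set.Icc (0 : ℝ) 1, |f y| ≤ B) (hK0 : 0 ≤ K)
    (hK : ∀ y ∈ Set.Icc (0 : ℝ) 1, ∀ z ∈ Set.Icc (0 : ℝ) 1, |f y - f z| ≤ K * |y - z|) :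
    ∃ K' : ℝ, ∀ n : ℕ, d + 1 ≤ n → c ≤ n →
      |mR n d (c / n) l (fun x => f x * (1 - x))
        - (c / n * (allFaces n d).card / (ridges n d).card) *
          Av n d (c / n) l (fun x => ∑ i, PhiF l f i x)| ≤ K' / Real.sqrt n := by
  obtain ⟨C, hC⟩ : ∃ C, C = K * (((d : ℝ) ^ 2 + 2 * d + 2 + 2) / l) *
    (((d : ℝ) ^ 2 + 2 * d + 2) / l) + B * (2 / l) := ⟨_, rfl⟩
  have hB0 : 0 ≤ B := (abs_nonneg _).trans (hB 0 (by simp))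
  have hC0 : 0 ≤ C := by rw [hC]; positivity
  refine ⟨(d + 1) ^ 3 * C * c + 2 * c ^ 2 * ((d + 1) ^ 3 * C + (d + 1) * B), fun n hn hcn => ?_⟩
  have hn0 : (0 : ℝ) < n := by have : 0 < n := by omega
                               exact_mod_cast this
  set p := c / n with hp
  have h0 : 0 ≤ p := by positivity
  have h1 : p ≤ 1 := by rw [hp, div_le_one hn0]; exact hcn
  have hN := ridges_pos (n := n) (d := d) (by omega)
  have hM := allFaces_pos hn
  set N := ((ridges n d).card : ℝ) with hNd
  set M := ((allFaces n d).card : ℝ) with hMd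
  have hr := ratio_le hn
  have e1 : mR n d p l (fun x => f x * (1 - x)) - (p * M / N) * Av n d p l (fun x => ∑ i, PhiF l f i x)
      = (∑ σ ∈ allFaces n d, p * (EB p ((allFaces n d).erase σ) (fun F => ∑ i,
      f (xx l (bC n) F (fac d σ i) - hh d l F σ i ^ 2 / (l + QQ l (bC n) F (bC n σ)))
        * (hh d l F σ i / (l + QQ l (bC n) F (bC n σ))))
      - EB p (allFaces n d) (fun F => ∑ i : Fin (d + 1), PhiF l f i (fun k => xx l (bC n) F (fac d σ k))))) / N := by
    simp only [mul_sub, Finset.sum_sub_distrib]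
    rw [← palm_id hl f, ← Finset.mul_sum]
    unfold mR Av
    rw [← hNd, ← hMd]
    field_simp
  rw [e1, abs_div, abs_of_pos hN, div_le_iff₀ hN]
  refine (Finset.abs_sum_le_sum_abs _ _).trans ?_
  calc _ ≤ ∑ σ ∈ allFaces n d, p * ((d + 1) * C * EB p (allFaces n d) (fun F => offd d l F σ)
      + 2 * p * ((d + 1) ^ 3 * C + (d + 1) * B)) := by
        refine Finset.sum_le_sum fun σ hσ => ?_
        rw [abs_mul, abs_of_nonneg h0]
        exact mul_le_mul_of_nonneg_left (palm_term hl h0 h1 hB hK0 hK hC hσ) h0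
    _ = p * ((d + 1) * C) * EB p (allFaces n d) (fun F => ∑ σ ∈ allFaces n d, offd d l F σ)
        + 2 * (p ^ 2 * M) * ((d + 1) ^ 3 * C + (d + 1) * B) := by
        rw [EB_sum, Finset.mul_sum]
        simp only [mul_add, Finset.sum_add_distrib]
        simp only [Finset.sum_const, nsmul_eq_mul, ← hMd]
        congr 1
        · exact Finset.sum_congr rfl fun σ _ => by ring
        · ring
    _ ≤ p * ((d + 1) * C) * ((d + 1) ^ 2 * Real.sqrt (M * N))
        + 2 * (p ^ 2 * M) * ((d + 1) ^ 3 * C + (d + 1) * B) := by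
        gcongr
        have := EB_mono h0 h1 (A := allFaces n d) (f := fun F => ∑ σ ∈ allFaces n d, offd d l F σ)
          (g := fun _ => (d + 1) ^ 2 * Real.sqrt (M * N)) (fun F _ => sum_offd_le hl F)
        rwa [EB_const] at this
    _ ≤ _ := by
        have hs : Real.sqrt (M * N) ≤ Real.sqrt n * N := by
          apply Real.sqrt_le_iff.2
          refine ⟨by positivity, ?_⟩
          rw [mul_pow, Real.sq_sqrt hn0.le]
          nlinarith
        have hsn : 0 < Real.sqrt n := Real.sqrt_pos.2 hn0
        have hsq : Real.sqrt n * Real.sqrt n = n := Real.mul_self_sqrt hn0.le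
        have e2 : p * Real.sqrt (M * N) ≤ c / Real.sqrt n * N := by
          have : c / Real.sqrt n * N = p * (Real.sqrt n * N) := by
            rw [hp]; nth_rw 2 [← hsq]; field_simp
          rw [this]
          exact mul_le_mul_of_nonneg_left hs h0
        have e3 : p ^ 2 * M ≤ c ^ 2 / Real.sqrt n * N := by
          have h3 : p ^ 2 * M ≤ p ^ 2 * (n * N) := mul_le_mul_of_nonneg_left hr (by positivity)
          have h4 : p ^ 2 * (n * N) = c ^ 2 / n * N := by rw [hp]; field_simp
          have h5 : c ^ 2 / n ≤ c ^ 2 / Real.sqrt n := by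
            have h1n : (1 : ℝ) ≤ n := by
              have : 1 ≤ n := by omega
              exact_mod_cast this
            have : Real.sqrt n ≤ n := by
              rw [Real.sqrt_le_iff]; exact ⟨hn0.le, by nlinarith⟩
            gcongr
          rw [h4] at h3
          exact h3.trans (mul_le_mul_of_nonneg_right h5 hN.le)
        have q1 := mul_le_mul_of_nonneg_left e2 (show 0 ≤ ((d : ℝ) + 1) ^ 3 * C by positivity)
        have q2 := mul_le_mul_of_nonneg_left e3
          (show 0 ≤ 2 * (((d : ℝ) + 1) ^ 3 * C + (d + 1) * B) by positivity)
        have : (((d : ℝ) + 1) ^ 3 * C * c + 2 * c ^ 2 * ((d + 1) ^ 3 * C + (d + 1) * B)) / Real.sqrt n * N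
          = ((d : ℝ) + 1) ^ 3 * C * (c / Real.sqrt n * N)
            + 2 * (((d : ℝ) + 1) ^ 3 * C + (d + 1) * B) * (c ^ 2 / Real.sqrt n * N) := by ring
        rw [this]
        calc _ = ((d : ℝ) + 1) ^ 3 * C * (p * Real.sqrt (M * N))
            + 2 * (((d : ℝ) + 1) ^ 3 * C + (d + 1) * B) * (p ^ 2 * M) := by ring
          _ ≤ _ := by linarith

lemma sum_sq_b {σ : Finset (Fin n)} (hσ : σ ∈ allFaces n d) (S : Finset (Finset (Fin n)))
    (hS : ridges n d ⊆ S) : ∑ τ ∈ S, bC n σ τ ^ 2 = d + 1 := by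
  rw [bsum hσ S hS (fun τ => bC n σ τ ^ 2) (fun τ h => by simp [h])]
  have : ∀ i, bC n σ (fac d σ i) ^ 2 = 1 := fun i => by rw [sq, bC_fac hσ]
  simp [this]

lemma pMN_le {c : ℝ} (hc : 0 < c) (hn : d + 1 ≤ n) :
    (d + 1) * (c / n * (allFaces n d).card) ≤ c * (ridges n d).card := by
  have h := card_rel n d (by omega)
  have hN := ridges_pos (n := n) (d := d) (by omega)
  have hn0 : (0 : ℝ) < n := by have : 0 < n := by omega
                               exact_mod_cast this
  have : ((d : ℝ) + 1) * (c / n * (allFaces n d).card) = c / n * (((n : ℝ) - d) * (ridges n d).card) := by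
    rw [← h]; ring
  rw [this, div_mul_eq_mul_div, div_le_iff₀ hn0]
  have hd : (0 : ℝ) ≤ d := by positivity
  nlinarith [mul_pos hc hN, mul_nonneg (mul_pos hc hN).le hd]

/-- (c) -/
lemma inv_bound {c : ℝ} (hl : 0 < l) (hc : 0 < c) (hn : d + 1 ≤ n) (hcn : c ≤ n) :
    mR n d (c / n) l (fun x => 1 / x) ≤ 1 + c / l := by
  have hn0 : (0 : ℝ) < n := by have : 0 < n := by omega
                               exact_mod_cast this
  set p := c / n with hp
  have h0 : 0 ≤ p := by positivity
  have h1 : p ≤ 1 := by rw [hp, div_le_one hn0]; exact hcn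
  have hN := ridges_pos (n := n) (d := d) (by omega)
  unfold mR
  rw [div_le_iff₀ hN, ← EB_sum]
  calc _ ≤ EB p (allFaces n d) (fun F => (ridges n d).card + (d + 1) / l * F.card) := by
        refine EB_mono h0 h1 fun F hF => ?_
        calc _ ≤ ∑ τ ∈ ridges n d, (1 + (∑ σ ∈ F, bC n σ τ ^ 2) / l) :=
              Finset.sum_le_sum fun τ _ => (xx_inv hl (bC n) F τ).2
          _ = _ := by
              rw [Finset.sum_add_distrib, ← Finset.sum_div, Finset.sum_comm,
                Finset.sum_congr rfl (fun σ hσ => sum_sq_b (hF hσ) (ridges n d) (Finset.Subset.refl _))]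
              simp; ring
    _ = (ridges n d).card + (d + 1) / l * (p * (allFaces n d).card) := by
        rw [EB_add, EB_const, EB_mul, EB_card]
    _ ≤ _ := by
        have := pMN_le hc hn
        have e : ((d : ℝ) + 1) / l * (p * (allFaces n d).card)
          = ((d + 1) * (p * (allFaces n d).card)) / l := by ring
        have e2 : (1 + c / l) * (ridges n d).card = (ridges n d).card + c * (ridges n d).card / l := by ring
        rw [e, e2]
        gcongr

/-- (d) -/
lemma luck_bound {c : ℝ} (hl : 0 < l) (hl1 : l < 1) (hc : 0 < c) (hn : d + 1 ≤ n) (hcn : c ≤ n) :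
    |mR n d (c / n) l (fun x => x) -
      (1 - EB (c / n) (allFaces n d) (fun F => (rk (bC n) F : ℝ)) / (ridges n d).card)|
      ≤ c / Real.log (1 / l) := by
  have hn0 : (0 : ℝ) < n := by have : 0 < n := by omega
                               exact_mod_cast this
  set p := c / n with hp
  have h0 : 0 ≤ p := by positivity
  have h1 : p ≤ 1 := by rw [hp, div_le_one hn0]; exact hcn
  have hN := ridges_pos (n := n) (d := d) (by omega)
  have hlog : 0 < Real.log (1 / l) := Real.log_pos (by rw [lt_div_iff₀ hl]; linarith)
  have e1 : mR n d p l (fun x => x) - (1 - EB p (allFaces n d) (fun F => (rk (bC n) F : ℝ)) / (ridges n d).card)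
      = EB p (allFaces n d) (fun F => (rk (bC n) F : ℝ) - ∑ τ ∈ ridges n d, (1 - xx l (bC n) F τ))
        / (ridges n d).card := by
    unfold mR
    rw [EB_sub, EB_sum]
    simp only [EB_sub, EB_const, Finset.sum_sub_distrib]
    simp
    field_simp
    ring
  rw [e1, abs_div, abs_of_pos hN, div_le_iff₀ hN]
  refine (EB_abs_le h0 h1).trans ?_
  calc _ ≤ EB p (allFaces n d) (fun F => (d + 1) / Real.log (1 / l) * F.card) := by
        refine EB_mono h0 h1 fun F hF => ?_
        have hinteg : ∀ σ ∈ F, ∀ i, ∃ z : ℤ, bC n σ i = z := by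
          intro σ hσ τ
          by_cases h : bC n σ τ = 0
          · exact ⟨0, by simp [h]⟩
          · obtain ⟨i, rfl⟩ := bC_supp (hF hσ) h
            have := bC_fac (hF hσ) i
            rcases mul_self_eq_one_iff.1 this with h | h
            · exact ⟨1, by simp [h]⟩
            · exact ⟨-1, by simp [h]⟩
        have hL := luck hl hl1 (bC n) F hinteg
        rw [rank_Lap] at hL
        have e2 : ∑ τ, (1 - xx l (bC n) F τ) = ∑ τ ∈ ridges n d, (1 - xx l (bC n) F τ) := by
          symm
          refine Finset.sum_subset (Finset.subset_univ _) fun τ _ hτ => ?_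
          rw [one_sub_xx hl]
          refine Finset.sum_eq_zero fun σ hσ => ?_
          have : bC n σ τ = 0 := by
            by_contra h
            obtain ⟨i, rfl⟩ := bC_supp (hF hσ) h
            exact hτ (fac_mem (hF hσ) i)
          simp [this]
        rw [e2, Finset.sum_congr rfl (fun σ hσ => sum_sq_b (hF hσ) univ (Finset.subset_univ _))] at hL
        rw [abs_of_nonneg hL.1]
        refine hL.2.trans (le_of_eq ?_)
        simp; ring
    _ = ((d + 1) * (p * (allFaces n d).card)) / Real.log (1 / l) := by
        rw [EB_mul, EB_card]; ring
    _ ≤ _ := by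
        have := pMN_le hc hn
        have h2 := div_le_div_of_nonneg_right this hlog.le
        rw [← hp] at h2
        exact h2.trans (le_of_eq (by ring))

end fin

end Part7

section Part8

open MeasureTheory Topology

/-- monomials on the cube -/
def mon {m : ℕ} (k : Fin m → ℕ) : C(Fin m → unitInterval, ℝ) :=
  ⟨fun x => ∏ i, (x i : ℝ) ^ k i, by fun_prop⟩

def PIm (m : ℕ) (μ : ProbabilityMeasure unitInterval) : Measure (Fin m → unitInterval) :=
  Measure.pi (fun _ => (μ : Measure unitInterval))

instance (m : ℕ) (μ : ProbabilityMeasure unitInterval) : IsProbabilityMeasure (PIm m μ) := by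
  unfold PIm; infer_instance

lemma PIm_int {m : ℕ} (μ : ProbabilityMeasure unitInterval) {f : (Fin m → unitInterval) → ℝ}
    (hf : Continuous f) : Integrable f (PIm m μ) :=
  (BoundedContinuousFunction.mkOfCompact ⟨f, hf⟩).integrable _

lemma I_int (μ : ProbabilityMeasure unitInterval) {f : unitInterval → ℝ}
    (hf : Continuous f) : Integrable f (μ : Measure unitInterval) :=
  (BoundedContinuousFunction.mkOfCompact ⟨f, hf⟩).integrable _

lemma mon_integral {m : ℕ} (μ : ProbabilityMeasure unitInterval) (k : Fin m → ℕ) :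
    ∫ x, mon k x ∂ (PIm m μ) = ∏ i, ∫ x : unitInterval, (x : ℝ) ^ k i ∂ (μ : Measure unitInterval) :=
  integral_fintype_prod_eq_prod (fun i (x : unitInterval) => (x : ℝ) ^ k i)

def coordC {m : ℕ} (i : Fin m) : C(Fin m → unitInterval, ℝ) := ⟨fun x => (x i : ℝ), by fun_prop⟩

lemma closure_mon {m : ℕ} {Φ : C(Fin m → unitInterval, ℝ)}
    (h : Φ ∈ Submonoid.closure (Set.range (coordC (m := m)))) : ∃ k, Φ = mon k := by
  induction h using Submonoid.closure_induction with
  | mem x hx =>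
    obtain ⟨i, rfl⟩ := hx
    refine ⟨Pi.single i 1, ?_⟩
    ext x
    simp only [coordC, mon, ContinuousMap.coe_mk]
    rw [Finset.prod_eq_single i]
    · simp
    · intro j _ hj; simp [hj]
    · simp
  | one => exact ⟨0, by ext x; simp [mon]⟩
  | mul x y _ _ hx hy =>
    obtain ⟨k, rfl⟩ := hx
    obtain ⟨k', rfl⟩ := hy
    exact ⟨k + k', by ext x; simp [mon, pow_add, Finset.prod_mul_distrib]⟩

lemma pi_limit {ι : Type*} {m : ℕ} (U : Filter ι) (L : ι → C(Fin m → unitInterval, ℝ) →ₗ[ℝ] ℝ)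
    (hL : ∀ᶠ j in U, ∀ Φ, |L j Φ| ≤ ‖Φ‖) (μ : ProbabilityMeasure unitInterval)
    (h : ∀ k : Fin m → ℕ, Tendsto (fun j => L j (mon k)) U
      (𝓝 (∏ i, ∫ x : unitInterval, (x : ℝ) ^ k i ∂ (μ : Measure unitInterval))))
    (Φ : C(Fin m → unitInterval, ℝ)) :
    Tendsto (fun j => L j Φ) U (𝓝 (∫ x, Φ x ∂ (PIm m μ))) := by
  have hspan : ∀ Φ ∈ Submodule.span ℝ (Submonoid.closure (Set.range (coordC (m := m))) : Set C(Fin m → unitInterval, ℝ)),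
      Tendsto (fun j => L j Φ) U (𝓝 (∫ x, Φ x ∂ (PIm m μ))) := by
    intro Φ hΦ
    induction hΦ using Submodule.span_induction with
    | mem x hx =>
      obtain ⟨k, rfl⟩ := closure_mon hx
      rw [mon_integral]
      exact h k
    | zero => simpa using tendsto_const_nhds
    | add x y _ _ hx hy =>
      simp only [map_add, ContinuousMap.add_apply]
      rw [integral_add (PIm_int μ x.continuous) (PIm_int μ y.continuous)]
      exact hx.add hy
    | smul a x _ hx =>
      simp only [map_smul, ContinuousMap.smul_apply, smul_eq_mul]
      rw [integral_const_mul]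
      exact hx.const_mul a
  have hd : (Algebra.adjoin ℝ (Set.range (coordC (m := m)))).topologicalClosure = ⊤ := by
    apply ContinuousMap.subalgebra_topologicalClosure_eq_top_of_separatesPoints
    intro x y hxy
    obtain ⟨i, hi⟩ := Function.ne_iff.1 hxy
    refine ⟨fun x => (x i : ℝ), ⟨coordC i, Algebra.subset_adjoin ⟨i, rfl⟩, rfl⟩, ?_⟩
    exact fun h => hi (Subtype.ext h)
  have hmem : Φ ∈ closure ((Algebra.adjoin ℝ (Set.range (coordC (m := m)))) : Set C(Fin m → unitInterval, ℝ)) := by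
    have : Φ ∈ (Algebra.adjoin ℝ (Set.range (coordC (m := m)))).topologicalClosure := by
      rw [hd]; trivial
    exact this
  rw [Metric.tendsto_nhds]
  intro ε hε
  obtain ⟨G, hG, hd⟩ := Metric.mem_closure_iff.1 hmem (ε / 3) (by positivity)
  have hG' : G ∈ Submodule.span ℝ (Submonoid.closure (Set.range (coordC (m := m))) : Set C(Fin m → unitInterval, ℝ)) := by
    rw [← Algebra.adjoin_eq_span]; exact hG
  have h1 := hspan G hG'
  rw [Metric.tendsto_nhds] at h1
  filter_upwards [h1 (ε / 3) (by positivity), hL] with j hj hLj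
  rw [dist_eq_norm] at hd
  have a1 := hLj (Φ - G)
  rw [map_sub] at a1
  have a2 : |∫ x, G x ∂ (PIm m μ) - ∫ x, Φ x ∂ (PIm m μ)| ≤ ‖Φ - G‖ := by
    rw [← integral_sub (PIm_int μ G.continuous) (PIm_int μ Φ.continuous)]
    have := norm_integral_le_of_norm_le_const (μ := PIm m μ) (f := fun x => G x - Φ x) (C := ‖Φ - G‖)
      (Eventually.of_forall fun x => by
        have := ContinuousMap.norm_coe_le_norm (Φ - G) x
        rw [norm_sub_rev]; exact this)
    simpa using this
  rw [Real.dist_eq] at hj ⊢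
  calc _ = |(L j Φ - L j G) + (L j G - ∫ x, G x ∂ (PIm m μ)) + (∫ x, G x ∂ (PIm m μ) - ∫ x, Φ x ∂ (PIm m μ))| := by ring_nf
    _ ≤ _ := abs_add_three _ _ _
    _ < ε := by linarith

section fin
variable {n d : ℕ} {p l : ℝ}

lemma EB_eq {α : Type*} (p : ℝ) (A : Finset α) (f : Finset α → ℝ) :
    EB p A f = ∑ F ∈ A.powerset, p ^ F.card * (1 - p) ^ (A.card - F.card) * f F := by rfl

def pI (x : ℝ) : unitInterval := Set.projIcc 0 1 zero_le_one x

lemma pI_xx (hl : 0 < l) (F : Finset (Finset (Fin n))) (i : Finset (Fin n)) :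
    (pI (xx l (bC n) F i) : ℝ) = xx l (bC n) F i := by
  have : xx l (bC n) F i ∈ Set.Icc (0 : ℝ) 1 := ⟨xx_nonneg hl _ _ _, xx_le_one hl _ _ _⟩
  simp [pI, Set.projIcc_of_mem zero_le_one this]

def AvL (n d : ℕ) (p l : ℝ) : C(Fin (d + 1) → unitInterval, ℝ) →ₗ[ℝ] ℝ where
  toFun Φ := Av n d p l (fun x => Φ (fun i => pI (x i)))
  map_add' Φ G := by
    simp only [Av, ContinuousMap.add_apply, EB_add, Finset.sum_add_distrib, add_div]
  map_smul' a Φ := by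
    simp only [Av, ContinuousMap.smul_apply, smul_eq_mul, EB_mul, ← Finset.mul_sum, mul_div_assoc,
      RingHom.id_apply]

lemma AvL_eq (hl : 0 < l) (G : (Fin (d + 1) → ℝ) → ℝ) (Φ : C(Fin (d + 1) → unitInterval, ℝ))
    (h : ∀ x, Φ x = G (fun i => (x i : ℝ))) : AvL n d p l Φ = Av n d p l G := by
  simp [AvL, Av, h, pI_xx hl]

lemma Av_le (h0 : 0 ≤ p) (h1 : p ≤ 1) (hn : d + 1 ≤ n) (G : (Fin (d + 1) → ℝ) → ℝ) {B : ℝ}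
    (hG : ∀ x, |G x| ≤ B) : |Av n d p l G| ≤ B := by
  have hM := allFaces_pos hn
  unfold Av
  rw [abs_div, abs_of_pos hM, div_le_iff₀ hM]
  refine (Finset.abs_sum_le_sum_abs _ _).trans ?_
  refine (Finset.sum_le_card_nsmul _ _ B fun σ _ => ?_).trans (le_of_eq ?_)
  · exact EB_abs_le_const h0 h1 fun F _ => hG _
  · rw [nsmul_eq_mul, mul_comm]

lemma AvL_apply (Φ : C(Fin (d + 1) → unitInterval, ℝ)) :
    AvL n d p l Φ = Av n d p l (fun x => Φ (fun i => pI (x i))) := rfl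

lemma AvL_le (h0 : 0 ≤ p) (h1 : p ≤ 1) (hn : d + 1 ≤ n) (Φ : C(Fin (d + 1) → unitInterval, ℝ)) :
    |AvL n d p l Φ| ≤ ‖Φ‖ := by
  rw [AvL_apply]
  refine Av_le h0 h1 hn _ fun x => ?_
  have h := ContinuousMap.norm_coe_le_norm Φ (fun i => pI (x i))
  rw [Real.norm_eq_abs] at h
  exact h

lemma exists_law (hl : 0 < l) (h0 : 0 ≤ p) (h1 : p ≤ 1) (hn : d + 1 ≤ n) :
    ∃ μ : ProbabilityMeasure unitInterval, ∀ φ : ℝ → ℝ,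
      ∫ x : unitInterval, φ x ∂ (μ : Measure unitInterval) = mR n d p l φ := by
  have hN := ridges_pos (n := n) (d := d) (by omega)
  obtain ⟨τ, hτ⟩ : (ridges n d).Nonempty := by
    rw [← Finset.card_pos]; exact_mod_cast hN
  set A := allFaces n d
  set w : Finset (Finset (Fin n)) → ℝ := fun F => p ^ F.card * (1 - p) ^ (A.card - F.card) with hw
  have hw0 : ∀ F, 0 ≤ w F := fun F => by have : 0 ≤ 1 - p := by linarith
                                         positivity
  set ν : Measure unitInterval := ∑ F ∈ A.powerset, ENNReal.ofReal (w F) • Measure.dirac (pI (xx l (bC n) F τ)) with hν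
  have hp : IsProbabilityMeasure ν := by
    constructor
    rw [hν, Measure.finsetSum_apply]
    simp only [Measure.smul_apply, measure_univ, smul_eq_mul, mul_one]
    rw [← ENNReal.ofReal_sum_of_nonneg (fun F _ => hw0 F)]
    have := EB_const p A (1 : ℝ)
    rw [EB_eq] at this
    simp only [mul_one] at this
    rw [this]; simp
  refine ⟨⟨ν, hp⟩, fun φ => ?_⟩
  show ∫ x : unitInterval, φ x ∂ ν = _
  rw [← mR_eq hl φ hτ, EB_eq, hν, integral_finsetSum_measure]
  · refine Finset.sum_congr rfl fun F _ => ?_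
    rw [integral_smul_measure, integral_dirac, pI_xx hl, ENNReal.toReal_ofReal (hw0 F)]
    rfl
  · intro F _
    exact (integrable_dirac (by simp)).smul_measure (by simp)

lemma pow_lip (k : ℕ) {x y : ℝ} (hx : x ∈ Set.Icc (0 : ℝ) 1) (hy : y ∈ Set.Icc (0 : ℝ) 1) :
    |x ^ k - y ^ k| ≤ k * |x - y| := by
  induction k with
  | zero => simp
  | succ k ih =>
    have : x ^ (k + 1) - y ^ (k + 1) = x ^ k * (x - y) + y * (x ^ k - y ^ k) := by ring
    rw [this]
    refine (abs_add_le _ _).trans ?_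
    rw [abs_mul, abs_mul, abs_of_nonneg hy.1, abs_of_nonneg (pow_nonneg hx.1 k)]
    have h1 : x ^ k ≤ 1 := pow_le_one₀ hx.1 hx.2
    push_cast
    nlinarith [abs_nonneg (x - y), abs_nonneg (x ^ k - y ^ k), hy.1, hy.2,
      mul_le_mul_of_nonneg_right h1 (abs_nonneg (x - y)),
      mul_le_mul_of_nonneg_right hy.2 (abs_nonneg (x ^ k - y ^ k))]

/-- the limiting law for fixed `l` -/
lemma limit_law {c : ℝ} (d : ℕ) (hl : 0 < l) (hc : 0 < c) (U : Ultrafilter ℕ) (hU : (U : Filter ℕ) ≤ atTop) :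
    ∃ μ : ProbabilityMeasure unitInterval,
      (∀ φ : ℝ → ℝ, Continuous φ → Tendsto (fun n : ℕ => mR n d (c / n) l φ) U
        (𝓝 (∫ x : unitInterval, φ x ∂ (μ : Measure unitInterval)))) ∧
      (∀ G : (Fin (d + 1) → ℝ) → ℝ, Continuous (fun x : Fin (d + 1) → unitInterval => G (fun i => (x i : ℝ))) →
        Tendsto (fun n : ℕ => Av n d (c / n) l G) U
        (𝓝 (∫ x : Fin (d + 1) → unitInterval, G (fun i => (x i : ℝ)) ∂ (PIm (d + 1) μ)))) := by
  have hev : ∀ᶠ n : ℕ in U, d + 1 ≤ n ∧ c ≤ n ∧ 0 ≤ c / n ∧ c / n ≤ 1 := by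
    apply hU
    filter_upwards [eventually_ge_atTop (d + 1), eventually_ge_atTop ⌈c⌉₊] with n h1 h2
    have h3 : c ≤ n := (Nat.le_ceil c).trans (by exact_mod_cast h2)
    have hn : (0 : ℝ) < n := lt_of_lt_of_le hc h3
    exact ⟨h1, h3, by positivity, by rwa [div_le_one hn]⟩
  have hex : ∀ n : ℕ, ∃ μ : ProbabilityMeasure unitInterval, (d + 1 ≤ n ∧ c ≤ n ∧ 0 ≤ c / n ∧ c / n ≤ 1) →
      ∀ φ : ℝ → ℝ, ∫ x : unitInterval, φ x ∂ (μ : Measure unitInterval) = mR n d (c / n) l φ := by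
    intro n
    by_cases h : d + 1 ≤ n ∧ c ≤ n ∧ 0 ≤ c / n ∧ c / n ≤ 1
    · obtain ⟨μ, hμ⟩ := exists_law (p := c / n) hl h.2.2.1 h.2.2.2 h.1
      exact ⟨μ, fun _ => hμ⟩
    · exact ⟨⟨Measure.dirac 0, inferInstance⟩, fun h' => absurd h' h⟩
  choose μs hμs using hex
  have hlim : Tendsto μs U (𝓝 (U.map μs).lim) := (U.map μs).le_nhds_lim
  set μ := (U.map μs).lim
  have h1 : ∀ φ : ℝ → ℝ, Continuous φ → Tendsto (fun n : ℕ => mR n d (c / n) l φ) U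
        (𝓝 (∫ x : unitInterval, φ x ∂ (μ : Measure unitInterval))) := by
    intro φ hφ
    have := (ProbabilityMeasure.tendsto_iff_forall_integral_tendsto.1 hlim)
      (BoundedContinuousFunction.mkOfCompact ⟨fun x : unitInterval => φ x, by fun_prop⟩)
    refine this.congr' ?_
    filter_upwards [hev] with n hn
    rw [← hμs n hn φ]; rfl
  refine ⟨μ, h1, fun G hG => ?_⟩
  have := pi_limit (m := d + 1) (U : Filter ℕ) (fun n => AvL n d (c / n) l) ?_ μ ?_ ⟨_, hG⟩
  · refine this.congr fun n => ?_
    exact AvL_eq hl G _ (fun x => rfl)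
  · filter_upwards [hev] with n hn
    exact AvL_le hn.2.2.1 hn.2.2.2 hn.1
  · intro k
    have e : ∀ n, AvL n d (c / n) l (mon k) = Av n d (c / n) l (fun x => ∏ i, (x i) ^ k i) := fun n =>
      AvL_eq hl _ _ (fun x => rfl)
    simp only [e]
    have t1 : Tendsto (fun n : ℕ => ∏ i, mR n d (c / n) l (fun x => x ^ k i)) U
      (𝓝 (∏ i, ∫ x : unitInterval, (x : ℝ) ^ k i ∂ (μ : Measure unitInterval))) :=
      tendsto_finsetProd _ fun i _ => h1 (fun x => x ^ k i) (by fun_prop)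
    obtain ⟨K, hK⟩ : ∃ K : ℝ, K = ∑ i, (k i : ℝ) := ⟨_, rfl⟩
    have t2 : Tendsto (fun n : ℕ => c / n * ((d + 1 : ℝ) ^ 2 * K ^ 2)) U (𝓝 0) := by
      have := ((tendsto_const_div_atTop_nhds_zero_nat c).mono_left hU).mul_const ((d + 1 : ℝ) ^ 2 * K ^ 2)
      simpa using this
    have t3 : Tendsto (fun n : ℕ => Av n d (c / n) l (fun x => ∏ i, (x i) ^ k i) -
        ∏ i, mR n d (c / n) l (fun x => x ^ k i)) U (𝓝 0) := by
      refine squeeze_zero_norm' ?_ t2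
      filter_upwards [hev] with n hn
      refine decor hl hn.2.2.1 hn.2.2.2 hn.1 (fun i x => x ^ k i) (K := K) (by rw [hK]; positivity) ?_ ?_
      · intro i x hx
        rw [abs_of_nonneg (pow_nonneg hx.1 _)]
        exact pow_le_one₀ hx.1 hx.2
      · intro i x hx y hy
        refine (pow_lip (k i) hx hy).trans ?_
        refine mul_le_mul_of_nonneg_right ?_ (abs_nonneg _)
        rw [hK]
        exact Finset.single_le_sum (f := fun i => (k i : ℝ)) (fun i _ => by positivity) (Finset.mem_univ i)
    have := t3.add t1
    simpa using this

end fin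

end Part8

section Part9

open MeasureTheory Topology

/-- `exp(-s/x)` -/
def ph (s x : ℝ) : ℝ := expNegInvGlue (x / s)

/-- `exp(-s/x)/x` -/
def gl (s x : ℝ) : ℝ := ph s x / x

lemma ph_pos_eq {s x : ℝ} (hs : 0 < s) (hx : 0 < x) : ph s x = Real.exp (-(s / x)) := by
  have : ¬ (x / s ≤ 0) := not_le.2 (by positivity)
  simp [ph, expNegInvGlue, this]

lemma ph_zero {s x : ℝ} (hs : 0 < s) (hx : x ≤ 0) : ph s x = 0 :=
  expNegInvGlue.zero_of_nonpos (div_nonpos_of_nonpos_of_nonneg hx hs.le)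

lemma ph_nonneg (s x : ℝ) : 0 ≤ ph s x := expNegInvGlue.nonneg _

lemma ph_le_one {s : ℝ} (hs : 0 < s) (x : ℝ) : ph s x ≤ 1 := by
  rcases le_or_gt x 0 with h | h
  · rw [ph_zero hs h]; norm_num
  · rw [ph_pos_eq hs h, Real.exp_le_one_iff]
    have : 0 < s / x := by positivity
    linarith

lemma ph_ge {s x : ℝ} (hs : 0 < s) (hx : 0 < x) : 1 - s / x ≤ ph s x := by
  rw [ph_pos_eq hs hx]
  have := Real.add_one_le_exp (-(s / x))
  linarith

lemma ph_contDiff (s : ℝ) : ContDiff ℝ 1 (ph s) := by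
  have h : ContDiff ℝ 1 expNegInvGlue := expNegInvGlue.contDiff (n := 1)
  exact h.comp (contDiff_id.div_const s)

lemma ph_cont (s : ℝ) : Continuous (ph s) := (ph_contDiff s).continuous

lemma gl_contDiff {s : ℝ} (hs : 0 < s) : ContDiff ℝ 1 (gl s) := by
  have h : ContDiff ℝ 1 (fun x : ℝ => Polynomial.eval x⁻¹ (Polynomial.X : Polynomial ℝ) * expNegInvGlue x) :=
    expNegInvGlue.contDiff_polynomial_eval_inv_mul (n := 1) Polynomial.X
  have h2 := (contDiff_const (c := s⁻¹)).mul (h.comp (contDiff_id.div_const s))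
  have e : gl s = fun x => s⁻¹ * ((fun x => Polynomial.eval x⁻¹ (Polynomial.X : Polynomial ℝ) * expNegInvGlue x) ∘ fun x => id x / s) x := by
    funext x
    simp only [gl, ph, Polynomial.eval_X, Function.comp, id]
    field_simp
  rw [e]
  exact h2

lemma gl_cont {s : ℝ} (hs : 0 < s) : Continuous (gl s) := (gl_contDiff hs).continuous

lemma gl_nonneg {s : ℝ} (hs : 0 < s) (x : ℝ) : 0 ≤ gl s x := by
  rcases le_or_gt x 0 with h | h
  · simp [gl, ph_zero hs h]
  · exact div_nonneg (ph_nonneg _ _) h.le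

lemma gl_le {s : ℝ} (hs : 0 < s) (x : ℝ) : gl s x ≤ 1 / s := by
  rcases le_or_gt x 0 with h | h
  · simp only [gl, ph_zero hs h, zero_div]; positivity
  · have h1 := Real.add_one_le_exp (s / x)
    unfold gl
    rw [ph_pos_eq hs h, div_le_div_iff₀ h hs, Real.exp_neg]
    have : (Real.exp (s / x))⁻¹ * (s / x) ≤ 1 := by
      rw [inv_mul_le_iff₀ (Real.exp_pos _)]; linarith
    have e : (Real.exp (s / x))⁻¹ * s = ((Real.exp (s / x))⁻¹ * (s / x)) * x := by field_simp
    rw [e]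
    exact mul_le_mul_of_nonneg_right this h.le

lemma lip_of_contDiff {f : ℝ → ℝ} (hf : ContDiff ℝ 1 f) (R : ℝ) :
    ∃ K : ℝ, 0 ≤ K ∧ ∀ y ∈ Set.Icc (0 : ℝ) R, ∀ z ∈ Set.Icc (0 : ℝ) R, |f y - f z| ≤ K * |y - z| := by
  obtain ⟨K, hK⟩ := (hf.locallyLipschitz.locallyLipschitzOn (s := Set.Icc (0:ℝ) R)).exists_lipschitzOnWith_of_compact
    isCompact_Icc
  refine ⟨K, K.2, fun y hy z hz => ?_⟩
  have := hK.dist_le_mul y hy z hz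
  simpa [Real.dist_eq] using this

/-- derivative in s -/
lemma ph_deriv {Ω : Type*} [MeasurableSpace Ω] (ν : Measure Ω) [IsProbabilityMeasure ν] (X : Ω → ℝ)
    (hX : Measurable X) {s : ℝ} (hs : 0 < s) :
    HasDerivAt (fun s => ∫ ω, ph s (X ω) ∂ν) (-∫ ω, gl s (X ω) ∂ν) s := by
  rw [← integral_neg]
  refine (hasDerivAt_integral_of_dominated_loc_of_deriv_le (F := fun s ω => ph s (X ω))
    (F' := fun s ω => -gl s (X ω)) (s := Set.Ioi (s / 2)) (bound := fun _ => 2 / s) (Ioi_mem_nhds (by linarith)) ?_ ?_ ?_ ?_ ?_ ?_).2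
  · exact Eventually.of_forall fun s => ((ph_cont s).measurable.comp hX).aestronglyMeasurable
  · refine Integrable.of_bound ((ph_cont s).measurable.comp hX).aestronglyMeasurable 1 ?_
    exact Eventually.of_forall fun ω => by
      rw [Real.norm_eq_abs, abs_of_nonneg (ph_nonneg _ _)]; exact ph_le_one hs _
  · exact ((gl_cont hs).measurable.comp hX).neg.aestronglyMeasurable
  · refine Eventually.of_forall fun ω r hr => ?_
    have hr' : s / 2 < r := hr
    have hr0 : 0 < r := by linarith
    rw [norm_neg, Real.norm_eq_abs, abs_of_nonneg (gl_nonneg hr0 _)]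
    refine (gl_le hr0 _).trans ?_
    rw [div_le_div_iff₀ hr0 hs]; linarith
  · exact integrable_const _
  · refine Eventually.of_forall fun ω r hr => ?_
    have hr' : s / 2 < r := hr
    have hr0 : 0 < r := by linarith
    rcases le_or_gt (X ω) 0 with h | h
    · have : (fun r => ph r (X ω)) =ᶠ[𝓝 r] fun _ => 0 := by
        filter_upwards [Ioi_mem_nhds hr0] with q hq
        exact ph_zero hq h
      rw [this.hasDerivAt_iff]
      simp only [gl, ph_zero hr0 h, zero_div, neg_zero]
      exact hasDerivAt_const _ _
    · have : (fun r => ph r (X ω)) =ᶠ[𝓝 r] fun r => Real.exp (-(r / X ω)) := by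
        filter_upwards [Ioi_mem_nhds hr0] with q hq
        exact ph_pos_eq hq h
      rw [this.hasDerivAt_iff]
      have := (((hasDerivAt_id r).div_const (X ω)).neg).exp
      refine this.congr_deriv ?_
      simp only [gl, ph_pos_eq hr0 h, id, Pi.neg_apply]
      ring

lemma PIm_split {d : ℕ} (μ : ProbabilityMeasure unitInterval) (f : unitInterval → ℝ)
    (g : (Fin d → unitInterval) → ℝ) :
    ∫ x, f (x 0) * g (fun i => x i.succ) ∂ (PIm (d + 1) μ) =
      (∫ x, f x ∂ (μ : Measure unitInterval)) * ∫ y, g y ∂ (PIm d μ) := by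
  have h := measurePreserving_piFinSuccAbove (fun _ : Fin (d + 1) => (μ : Measure unitInterval)) 0
  have := h.integral_comp (MeasurableEquiv.measurableEmbedding _)
    (fun z : unitInterval × (Fin d → unitInterval) => f z.1 * g z.2)
  rw [integral_prod_mul] at this
  exact this

lemma PIm_perm {m : ℕ} (μ : ProbabilityMeasure unitInterval) (e : Equiv.Perm (Fin m))
    (G : (Fin m → unitInterval) → ℝ) :
    ∫ x, G (fun i => x (e i)) ∂ (PIm m μ) = ∫ x, G x ∂ (PIm m μ) := by
  have h := measurePreserving_piCongrLeft (fun _ : Fin m => (μ : Measure unitInterval)) e.symm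
  have := h.integral_comp (MeasurableEquiv.measurableEmbedding _) G
  unfold PIm
  rw [← this]
  congr 1
  funext x
  congr 1
  funext i
  have := MeasurableEquiv.piCongrLeft_apply_apply (β := fun _ : Fin m => unitInterval) e.symm x (e i)
  simpa using this.symm

lemma sum_coord (d : ℕ) (x : Fin (d + 1) → unitInterval) :
    ∑ i, (x i : ℝ) = (x 0 : ℝ) + ∑ i : Fin d, (x i.succ : ℝ) := Fin.sum_univ_succ _

lemma sum_nonneg_I {m : ℕ} (y : Fin m → unitInterval) : 0 ≤ ∑ i, (y i : ℝ) :=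
  Finset.sum_nonneg fun i _ => (y i).2.1

lemma PhiF_cont {d : ℕ} {l : ℝ} (hl : 0 < l) {f : ℝ → ℝ} (hf : Continuous f) (i : Fin (d + 1)) :
    Continuous (fun x : Fin (d + 1) → unitInterval => PhiF l f i (fun j => (x j : ℝ))) := by
  unfold PhiF
  have : ∀ x : Fin (d + 1) → unitInterval, l + ∑ j, (x j : ℝ) ≠ 0 := fun x => by
    have := sum_nonneg_I x
    positivity
  have hc : Continuous (fun x : Fin (d + 1) → unitInterval => l + ∑ j, (x j : ℝ)) := by fun_prop
  refine (hf.comp (Continuous.sub (by fun_prop) (Continuous.div (by fun_prop) hc this))).mul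
    (Continuous.div (by fun_prop) hc this)

lemma ph_y {s l x S : ℝ} (hs : 0 < s) (hl : 0 < l) (hx : 0 < x) (hS : 0 ≤ S) :
    ph s (x - x ^ 2 / (l + (x + S))) = ph s x * ph s (l + S) := by
  have e : x - x ^ 2 / (l + (x + S)) = x * (l + S) / (l + (x + S)) := by
    have : l + (x + S) ≠ 0 := by positivity
    field_simp; ring
  rw [e, ph_pos_eq hs (by positivity), ph_pos_eq hs hx, ph_pos_eq hs (by positivity), ← Real.exp_add]
  congr 1
  have : l + S ≠ 0 := by positivity
  field_simp; ring

lemma PhiF_gl {d : ℕ} {s l : ℝ} (hs : 0 < s) (hl : 0 < l) (x : Fin (d + 1) → unitInterval) :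
    PhiF l (gl s) 0 (fun j => (x j : ℝ)) = ph s (x 0) * gl s (l + ∑ i : Fin d, (x i.succ : ℝ)) := by
  have hS := sum_nonneg_I (fun i : Fin d => x i.succ)
  unfold PhiF
  rw [sum_coord]
  rcases (x 0).2.1.eq_or_lt with h | h
  · simp only [← h, ph_zero hs le_rfl]; simp
  · simp only
    set S := ∑ i : Fin d, (x i.succ : ℝ)
    set X := (x 0 : ℝ)
    unfold gl
    rw [ph_y hs hl h hS]
    have e : X - X ^ 2 / (l + (X + S)) = X * (l + S) / (l + (X + S)) := by
      have : l + (X + S) ≠ 0 := by positivity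
      field_simp; ring
    rw [e]
    have : l + S ≠ 0 := by positivity
    have : l + (X + S) ≠ 0 := by positivity
    field_simp

lemma PhiF_ph {d : ℕ} {s l : ℝ} (hs : 0 < s) (hl : 0 < l) (x : Fin (d + 1) → unitInterval) :
    PhiF l (ph s) 0 (fun j => (x j : ℝ)) =
      ph s (x 0) * ph s (l + ∑ i : Fin d, (x i.succ : ℝ)) * ((x 0 : ℝ) / (l + ∑ i, (x i : ℝ))) := by
  have hS := sum_nonneg_I (fun i : Fin d => x i.succ)
  unfold PhiF
  rw [sum_coord]
  rcases (x 0).2.1.eq_or_lt with h | h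
  · simp only [← h, ph_zero hs le_rfl]; simp
  · rw [ph_y hs hl h hS]

/-- The Laplace-type functional equation for fixed `l`. -/
lemma fixed_l {d : ℕ} {c l C : ℝ} (hl : 0 < l) (μ : ProbabilityMeasure unitInterval)
    (E1 : ∀ f : ℝ → ℝ, ContDiff ℝ 1 f → ∫ x : unitInterval, f x * (1 - x) ∂ (μ : Measure unitInterval)
      = c * ∫ x : Fin (d + 1) → unitInterval, PhiF l f 0 (fun j => (x j : ℝ)) ∂ (PIm (d + 1) μ))
    (E2 : ∀ s > 0, 1 - s * C ≤ ∫ x : unitInterval, ph s x ∂ (μ : Measure unitInterval)) {s : ℝ} (hs : 0 < s) :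
    ∫ x : unitInterval, ph s x ∂ (μ : Measure unitInterval)
      = Real.exp (-s - c * (1 - ∫ y : Fin d → unitInterval, ph s (l + ∑ i, (y i : ℝ)) ∂ (PIm d μ))) := by
  set Ψ : ℝ → ℝ := fun s => ∫ x : unitInterval, ph s x ∂ (μ : Measure unitInterval) with hΨ
  set Θ : ℝ → ℝ := fun s => ∫ y : Fin d → unitInterval, ph s (l + ∑ i, (y i : ℝ)) ∂ (PIm d μ) with hΘ
  have dΨ : ∀ s > 0, HasDerivAt Ψ (-∫ x : unitInterval, gl s x ∂ (μ : Measure unitInterval)) s := fun s hs =>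
    ph_deriv _ (fun x : unitInterval => (x : ℝ)) measurable_subtype_coe hs
  have dΘ : ∀ s > 0, HasDerivAt Θ (-∫ y : Fin d → unitInterval, gl s (l + ∑ i, (y i : ℝ)) ∂ (PIm d μ)) s :=
    fun s hs => ph_deriv _ (fun y : Fin d → unitInterval => l + ∑ i, (y i : ℝ))
      (Continuous.measurable (by fun_prop)) hs
  have key : ∀ s > 0, (∫ x : unitInterval, gl s x ∂ (μ : Measure unitInterval)) - Ψ s =
      c * (Ψ s * ∫ y : Fin d → unitInterval, gl s (l + ∑ i, (y i : ℝ)) ∂ (PIm d μ)) := by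
    intro s hs
    have h := E1 (gl s) (gl_contDiff hs)
    simp only [PhiF_gl hs hl] at h
    rw [PIm_split μ (fun x => ph s x) (fun y => gl s (l + ∑ i, (y i : ℝ)))] at h
    have i1 : Integrable (fun x : unitInterval => gl s x) (μ : Measure unitInterval) :=
      I_int μ ((gl_cont hs).comp continuous_subtype_val)
    have i2 : Integrable (fun x : unitInterval => ph s x) (μ : Measure unitInterval) :=
      I_int μ ((ph_cont s).comp continuous_subtype_val)
    show _ - (∫ x : unitInterval, ph s x ∂ (μ : Measure unitInterval)) = c * ((∫ x : unitInterval, ph s x ∂ (μ : Measure unitInterval)) * _)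
    rw [← h, ← integral_sub i1 i2]
    congr 1
    funext x
    rcases x.2.1.eq_or_lt with h0 | h0
    · simp only [← h0, gl, ph_zero hs le_rfl]; simp
    · simp only [gl]; field_simp
  set W : ℝ → ℝ := fun s => Ψ s * Real.exp (s - c * Θ s) with hW
  have dW : ∀ s ∈ Set.Ioi (0 : ℝ), HasDerivAt W 0 s := by
    intro s hs
    have := (dΨ s hs).mul (((hasDerivAt_id s).sub ((dΘ s hs).const_mul c)).exp)
    refine this.congr_deriv ?_
    have k := key s hs
    have : -(∫ x : unitInterval, gl s x ∂ (μ : Measure unitInterval)) = -Ψ s -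
      c * (Ψ s * ∫ y : Fin d → unitInterval, gl s (l + ∑ i, (y i : ℝ)) ∂ (PIm d μ)) := by linarith
    rw [this]; ring
  obtain ⟨a, ha⟩ := isOpen_Ioi.exists_is_const_of_deriv_eq_zero isPreconnected_Ioi
    (fun s hs => (dW s hs).differentiableAt.differentiableWithinAt) (fun s hs => (dW s hs).deriv)
  have idt : Tendsto (fun s : ℝ => s) (𝓝[>] 0) (𝓝 0) := tendsto_id.mono_left nhdsWithin_le_nhds
  have tΨ : Tendsto Ψ (𝓝[>] 0) (𝓝 1) := by
    refine tendsto_of_tendsto_of_tendsto_of_le_of_le' (g := fun s => 1 - s * C) (h := fun _ => 1) ?_ tendsto_const_nhds ?_ ?_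
    · have := (idt.mul_const C).const_sub 1
      simpa using this
    · filter_upwards [self_mem_nhdsWithin] with s hs using E2 s hs
    · filter_upwards [self_mem_nhdsWithin] with s hs
      have := integral_mono (I_int μ ((ph_cont s).comp continuous_subtype_val)) (integrable_const (1 : ℝ))
        (fun x => ph_le_one hs (x : ℝ))
      simpa using this
  have cΘ : ∀ s, Continuous (fun y : Fin d → unitInterval => ph s (l + ∑ i, (y i : ℝ))) := fun s =>
    (ph_cont s).comp (by fun_prop)
  have tΘ : Tendsto Θ (𝓝[>] 0) (𝓝 1) := by
    refine tendsto_of_tendsto_of_tendsto_of_le_of_le' (g := fun s => 1 - s / l) (h := fun _ => 1) ?_ tendsto_const_nhds ?_ ?_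
    · have := (idt.div_const l).const_sub 1
      simpa using this
    · filter_upwards [self_mem_nhdsWithin] with s hs
      have := integral_mono (integrable_const (1 - s / l)) (PIm_int μ (cΘ s))
        (fun y => (sub_le_sub_left (div_le_div_of_nonneg_left (le_of_lt hs) hl (by
          have := sum_nonneg_I y; linarith)) 1).trans (ph_ge hs (x := l + ∑ i, (y i : ℝ)) (by
          have := sum_nonneg_I y; positivity)))
      simpa using this
    · filter_upwards [self_mem_nhdsWithin] with s hs
      have := integral_mono (PIm_int μ (cΘ s)) (integrable_const (1 : ℝ))
        (fun x => ph_le_one hs _)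
      simpa using this
  have tW : Tendsto W (𝓝[>] 0) (𝓝 (1 * Real.exp (0 - c * 1))) :=
    tΨ.mul ((Real.continuous_exp.tendsto _).comp (idt.sub (tΘ.const_mul c)))
  have ta : Tendsto W (𝓝[>] 0) (𝓝 a) := by
    refine tendsto_const_nhds.congr' ?_
    filter_upwards [self_mem_nhdsWithin] with s hs using (ha s hs).symm
  have hae := tendsto_nhds_unique tW ta
  have hWs : Ψ s * Real.exp (s - c * Θ s) = a := ha s hs
  have : Ψ s = a * Real.exp (-(s - c * Θ s)) := by
    rw [← hWs, mul_assoc, ← Real.exp_add]; simp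
  show Ψ s = _
  rw [this, ← hae, one_mul, ← Real.exp_add]
  congr 1
  show _ = -s - c * (1 - Θ s)
  ring

end Part9

section Part10

open MeasureTheory Topology

lemma ev_n {c : ℝ} (d : ℕ) (hc : 0 < c) : ∀ᶠ n : ℕ in atTop, d + 1 ≤ n ∧ c ≤ n ∧ 0 ≤ c / n ∧ c / n ≤ 1 := by
  filter_upwards [eventually_ge_atTop (d + 1), eventually_ge_atTop ⌈c⌉₊] with n h1 h2
  have h3 : c ≤ n := (Nat.le_ceil c).trans (by exact_mod_cast h2)
  have hn : (0 : ℝ) < n := lt_of_lt_of_le hc h3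
  exact ⟨h1, h3, by positivity, by rwa [div_le_one hn]⟩

lemma ratio_tendsto (c : ℝ) (d : ℕ) :
    Tendsto (fun n : ℕ => c / n * (allFaces n d).card / (ridges n d).card) atTop (𝓝 (c / (d + 1))) := by
  have h1 : Tendsto (fun n : ℕ => c / (d + 1) * (1 - (d : ℝ) / n)) atTop (𝓝 (c / (d + 1) * (1 - 0))) :=
    ((tendsto_const_div_atTop_nhds_zero_nat (d : ℝ)).const_sub 1).const_mul _
  simp only [sub_zero, mul_one] at h1
  refine h1.congr' ?_
  filter_upwards [eventually_ge_atTop (d + 1)] with n hn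
  have hn0 : (0 : ℝ) < n := by have : 0 < n := by omega
                               exact_mod_cast this
  have hN := ridges_pos (n := n) (d := d) (by omega)
  have h := card_rel (n := n) (d := d) (by omega)
  have hM : ((allFaces n d).card : ℝ) = (n - d) * (ridges n d).card / (d + 1) := by
    rw [eq_div_iff (by positivity)]; linarith
  rw [hM]
  field_simp

lemma PhiF_perm {d : ℕ} {l : ℝ} (f : ℝ → ℝ) (μ : ProbabilityMeasure unitInterval) (i : Fin (d + 1)) :
    ∫ x : Fin (d + 1) → unitInterval, PhiF l f i (fun j => (x j : ℝ)) ∂ (PIm (d + 1) μ) =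
    ∫ x : Fin (d + 1) → unitInterval, PhiF l f 0 (fun j => (x j : ℝ)) ∂ (PIm (d + 1) μ) := by
  rw [← PIm_perm μ (Equiv.swap 0 i)]
  congr 1
  funext x
  simp only [PhiF, Equiv.swap_apply_right]
  have : ∑ j, (x (Equiv.swap 0 i j) : ℝ) = ∑ j, (x j : ℝ) :=
    Equiv.sum_comp (Equiv.swap 0 i) (fun j => (x j : ℝ))
  rw [this]

/-- the properties of the limit law at fixed `l` -/
lemma lam_law {c l D : ℝ} (d : ℕ) (hl : 0 < l) (hl1 : l < 1) (hc : 0 < c) (U : Ultrafilter ℕ)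
    (hU : (U : Filter ℕ) ≤ atTop)
    (hD : Tendsto (fun n : ℕ => 1 - EB (c / n) (allFaces n d) (fun F => (rk (bC n) F : ℝ)) / (ridges n d).card) U (𝓝 D)) :
    ∃ μ : ProbabilityMeasure unitInterval,
    (∀ f : ℝ → ℝ, ContDiff ℝ 1 f → ∫ x : unitInterval, f x * (1 - x) ∂ (μ : Measure unitInterval)
      = c * ∫ x : Fin (d + 1) → unitInterval, PhiF l f 0 (fun j => (x j : ℝ)) ∂ (PIm (d + 1) μ)) ∧
    (∀ s > 0, 1 - s * (1 + c / l) ≤ ∫ x : unitInterval, ph s x ∂ (μ : Measure unitInterval)) ∧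
    |∫ x : unitInterval, (x : ℝ) ∂ (μ : Measure unitInterval) - D| ≤ c / Real.log (1 / l) := by
  obtain ⟨μ, h1, h2⟩ := limit_law d hl hc U hU
  have hev : ∀ᶠ n : ℕ in U, d + 1 ≤ n ∧ c ≤ n ∧ 0 ≤ c / n ∧ c / n ≤ 1 := hU (ev_n d hc)
  refine ⟨μ, ?_, ?_, ?_⟩
  · intro f hf
    obtain ⟨K, hK0, hK⟩ := lip_of_contDiff hf 1
    have hB : ∀ y ∈ Set.Icc (0 : ℝ) 1, |f y| ≤ |f 0| + K := by
      intro y hy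
      have := hK y hy 0 (by simp)
      have h3 : |f y| ≤ |f 0| + |f y - f 0| := by
        have := abs_add_le (f 0) (f y - f 0)
        simpa using this
      have h4 : |y - 0| ≤ 1 := by simp [abs_of_nonneg hy.1, hy.2]
      nlinarith
    obtain ⟨K', hK'⟩ := palm_bound (d := d) hl hc hB hK0 hK
    have t1 := h1 (fun x => f x * (1 - x)) (by have := hf.continuous; fun_prop)
    have t2 := h2 (fun x => ∑ i, PhiF l f i x) (continuous_finsetSum _ fun i _ => PhiF_cont hl hf.continuous i)
    have t3 := ((ratio_tendsto c d).mono_left hU).mul t2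
    have t4 : Tendsto (fun n : ℕ => K' / Real.sqrt n) U (𝓝 0) := by
      refine Tendsto.mono_left ?_ hU
      exact Tendsto.const_div_atTop (Real.tendsto_sqrt_atTop.comp tendsto_natCast_atTop_atTop) K'
    have t5 : Tendsto (fun n : ℕ => mR n d (c / n) l (fun x => f x * (1 - x))
        - (c / n * (allFaces n d).card / (ridges n d).card) *
          Av n d (c / n) l (fun x => ∑ i, PhiF l f i x)) U (𝓝 0) :=
      squeeze_zero_norm' (hev.mono fun n hn => hK' n hn.1 hn.2.1) t4
    have := tendsto_nhds_unique t5 (t1.sub t3)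
    have e : ∫ x : Fin (d + 1) → unitInterval, (∑ i, PhiF l f i (fun j => (x j : ℝ))) ∂ (PIm (d + 1) μ)
        = (d + 1) * ∫ x : Fin (d + 1) → unitInterval, PhiF l f 0 (fun j => (x j : ℝ)) ∂ (PIm (d + 1) μ) := by
      rw [integral_finsetSum _ (fun i _ => PIm_int μ (PhiF_cont hl hf.continuous i)),
        Finset.sum_congr rfl (fun i _ => PhiF_perm f μ i)]
      simp
    rw [e] at this
    have h3 := (sub_eq_zero.1 this.symm)
    rw [h3]
    field_simp
  · intro s hs
    refine ge_of_tendsto (h1 (ph s) (ph_cont s)) ?_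
    filter_upwards [hev] with n hn
    have hi := inv_bound (d := d) hl hc hn.1 hn.2.1
    have hN := ridges_pos (n := n) (d := d) (by omega)
    have : 1 - s * mR n d (c / n) l (fun x => 1 / x) ≤ mR n d (c / n) l (ph s) := by
      have e : 1 - s * mR n d (c / n) l (fun x => 1 / x) = mR n d (c / n) l (fun x => 1 - s * (1 / x)) := by
        simp only [mR, EB_sub, EB_mul, EB_const, Finset.sum_sub_distrib, ← Finset.mul_sum]
        simp only [Finset.sum_const, nsmul_eq_mul, mul_one]
        field_simp
      rw [e]
      unfold mR
      refine div_le_div_of_nonneg_right (Finset.sum_le_sum fun τ _ => ?_) hN.le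
      refine EB_mono hn.2.2.1 hn.2.2.2 fun F _ => ?_
      have := ph_ge hs (xx_inv hl (bC n) F τ).1
      show 1 - s * (1 / _) ≤ _
      rw [mul_one_div]; exact this
    nlinarith
  · have t1 := h1 (fun x => x) continuous_id
    refine le_of_tendsto (t1.sub hD).abs ?_
    filter_upwards [hev] with n hn
    exact luck_bound hl hl1 hc hn.1 hn.2.1

/-- cut-off version of `x₀/Σ` -/
def Hs {d : ℕ} (s l : ℝ) (x : Fin (d + 1) → unitInterval) : ℝ :=
  ph s (x 0) * ph s (l + ∑ i : Fin d, (x i.succ : ℝ)) * ((x 0 : ℝ) / (l + ∑ i, (x i : ℝ)))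

lemma Hs_close {d : ℕ} {s : ℝ} (hs : 0 < s) : ∃ K : ℝ, 0 ≤ K ∧ ∀ l, 0 < l → l < 1 →
    (∀ x : Fin (d + 1) → unitInterval, |Hs s l x - Hs s 0 x| ≤ K * l) ∧
    (∀ y : Fin d → unitInterval, |ph s (l + ∑ i, (y i : ℝ)) - ph s (∑ i, (y i : ℝ))| ≤ K * l) := by
  obtain ⟨K, hK0, hK⟩ := lip_of_contDiff (ph_contDiff s) (d + 1)
  have h2 : ∀ l, 0 < l → l < 1 → ∀ y : Fin d → unitInterval,
      |ph s (l + ∑ i, (y i : ℝ)) - ph s (∑ i, (y i : ℝ))| ≤ K * l := by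
    intro l hl hl1 y
    have a1 := sum_nonneg_I y
    have a2 : ∑ i, (y i : ℝ) ≤ d := by
      have := Finset.sum_le_card_nsmul Finset.univ (fun i => (y i : ℝ)) 1 (fun i _ => (y i).2.2)
      simpa using this
    have := hK (l + ∑ i, (y i : ℝ)) ⟨by linarith, by linarith⟩ (∑ i, (y i : ℝ)) ⟨a1, by linarith⟩
    simpa [abs_of_pos hl] using this
  refine ⟨K + 1 / s, by positivity, fun l hl hl1 => ⟨fun x => ?_, fun y => ?_⟩⟩
  · have h3 := h2 l hl hl1 (fun i => x i.succ)
    unfold Hs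
    rw [sum_coord, zero_add, zero_add]
    have hS := sum_nonneg_I (fun i : Fin d => x i.succ)
    rcases (x 0).2.1.eq_or_lt with h | h
    · simp only [← h, zero_div, mul_zero, sub_self, abs_zero]; positivity
    · set S := ∑ i : Fin d, (x i.succ : ℝ)
      set X := (x 0 : ℝ)
      have p1 : X / (l + (X + S)) ≤ 1 := by rw [div_le_one (by positivity)]; linarith
      have p0 : 0 ≤ X / (l + (X + S)) := by positivity
      have e1 : X / (X + S) - X / (l + (X + S)) ≤ l / X := by
        have : X / (X + S) - X / (l + (X + S)) = X * l / ((X + S) * (l + (X + S))) := by field_simp; ring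
        rw [this, div_le_div_iff₀ (by positivity) h]
        nlinarith [mul_pos hl h, mul_nonneg hl.le hS, mul_nonneg hS h.le, mul_nonneg hS hS, mul_nonneg (mul_nonneg hS h.le) hl.le,
          mul_nonneg (mul_nonneg hS hS) hl.le, mul_pos (mul_pos hl hl) h, mul_nonneg (mul_pos hl hl).le hS]
      have e2 : 0 ≤ X / (X + S) - X / (l + (X + S)) := by
        rw [sub_nonneg]
        exact div_le_div_of_nonneg_left h.le (by positivity) (by linarith)
      have e3 := gl_le hs X
      unfold gl at e3
      have q0 := ph_nonneg s X
      have q1 := ph_le_one hs X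
      have r0 := ph_nonneg s S
      have r1 := ph_le_one hs S
      have e : ph s X * ph s (l + S) * (X / (l + (X + S))) - ph s X * ph s S * (X / (X + S))
        = ph s X * (X / (l + (X + S))) * (ph s (l + S) - ph s S)
          - ph s X * ph s S * (X / (X + S) - X / (l + (X + S))) := by ring
      rw [e]
      refine (abs_sub _ _).trans ?_
      rw [abs_mul _ (ph s (l + S) - ph s S), abs_mul _ (X / (X + S) - X / (l + (X + S))), abs_of_nonneg e2, abs_of_nonneg (mul_nonneg q0 p0), abs_of_nonneg (mul_nonneg q0 r0)]
      have f1 : ph s X * (X / (l + (X + S))) * |ph s (l + S) - ph s S| ≤ 1 * (K * l) :=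
        mul_le_mul (mul_le_one₀ q1 p0 p1) h3 (abs_nonneg _) zero_le_one
      have f2 : ph s X * ph s S * (X / (X + S) - X / (l + (X + S))) ≤ ph s X * 1 * (l / X) := by
        gcongr
      have f3 : ph s X * 1 * (l / X) = ph s X / X * l := by ring
      have f4 : ph s X / X * l ≤ 1 / s * l := mul_le_mul_of_nonneg_right e3 hl.le
      linarith
  · refine (h2 l hl hl1 y).trans ?_
    have : 0 < 1 / s := by positivity
    nlinarith

lemma Hs_cont {d : ℕ} {s l : ℝ} (hl : 0 < l) : Continuous (Hs (d := d) s l) := by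
  unfold Hs
  have : ∀ x : Fin (d + 1) → unitInterval, l + ∑ j, (x j : ℝ) ≠ 0 := fun x => by
    have := sum_nonneg_I x
    positivity
  refine ((((ph_cont s).comp (by fun_prop)).mul ((ph_cont s).comp (by fun_prop))).mul
    (Continuous.div (by fun_prop) (by fun_prop) this))

def lk (k : ℕ) : ℝ := 1 / ((k : ℝ) + 2)
lemma lk_pos (k : ℕ) : 0 < lk k := by unfold lk; positivity
lemma lk_lt (k : ℕ) : lk k < 1 := by
  unfold lk; rw [div_lt_one (by positivity)]
  have : (0 : ℝ) ≤ k := by positivity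
  linarith
lemma lk_tendsto : Tendsto lk atTop (𝓝 0) := by
  unfold lk
  exact Tendsto.const_div_atTop (tendsto_atTop_add_const_right _ _ tendsto_natCast_atTop_atTop) 1

lemma Hs0_cont {d : ℕ} {s : ℝ} (hs : 0 < s) : Continuous (Hs (d := d) s 0) := by
  obtain ⟨K, hK0, hK⟩ := Hs_close (d := d) hs
  have : TendstoUniformly (fun k => Hs (d := d) s (lk k)) (Hs s 0) atTop := by
    rw [Metric.tendstoUniformly_iff]
    intro ε hε
    have h := (lk_tendsto.const_mul K)
    rw [mul_zero] at h
    filter_upwards [h.eventually_lt_const hε] with k hk x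
    rw [dist_comm, Real.dist_eq]
    exact ((hK _ (lk_pos k) (lk_lt k)).1 x).trans_lt hk
  exact this.continuous (Frequently.of_forall fun k => Hs_cont (lk_pos k))

lemma tend_close {ι : Type*} {U : Filter ι} {a b e : ι → ℝ} {x : ℝ} (hb : Tendsto b U (𝓝 x))
    (h : ∀ i, |a i - b i| ≤ e i) (he : Tendsto e U (𝓝 0)) : Tendsto a U (𝓝 x) := by
  have := (squeeze_zero_norm h he).add hb
  simpa using this

/-- the limit law at `l = 0` -/
lemma zero_law {c D : ℝ} (d : ℕ) (hc : 0 < c) (U : Ultrafilter ℕ)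
    (hU : (U : Filter ℕ) ≤ atTop)
    (hD : Tendsto (fun n : ℕ => 1 - EB (c / n) (allFaces n d) (fun F => (rk (bC n) F : ℝ)) / (ridges n d).card) U (𝓝 D)) :
    ∃ μ : ProbabilityMeasure unitInterval,
    (∀ s > 0, ∫ x : unitInterval, ph s x ∂ (μ : Measure unitInterval) =
      Real.exp (-s - c * (1 - ∫ y : Fin d → unitInterval, ph s (∑ i, (y i : ℝ)) ∂ (PIm d μ)))) ∧
    (∀ s > 0, ∫ x : unitInterval, ph s x * (1 - x) ∂ (μ : Measure unitInterval) =
      c * ∫ x : Fin (d + 1) → unitInterval, Hs s 0 x ∂ (PIm (d + 1) μ)) ∧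
    ∫ x : unitInterval, (x : ℝ) ∂ (μ : Measure unitInterval) = D := by
  choose μs h1 h2 h3 using fun k => lam_law d (lk_pos k) (lk_lt k) hc U hU hD
  set V : Ultrafilter ℕ := Ultrafilter.of atTop
  have hV : (V : Filter ℕ) ≤ atTop := Ultrafilter.of_le atTop
  have hlim : Tendsto μs V (𝓝 (V.map μs).lim) := (V.map μs).le_nhds_lim
  set μ := (V.map μs).lim
  have hl0 : Tendsto lk V (𝓝 0) := lk_tendsto.mono_left hV
  have t1 : ∀ φ : ℝ → ℝ, Continuous φ → Tendsto (fun k => ∫ x : unitInterval, φ x ∂ (μs k : Measure unitInterval)) V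
        (𝓝 (∫ x : unitInterval, φ x ∂ (μ : Measure unitInterval))) := by
    intro φ hφ
    exact (ProbabilityMeasure.tendsto_iff_forall_integral_tendsto.1 hlim)
      (BoundedContinuousFunction.mkOfCompact ⟨fun x : unitInterval => φ x, by fun_prop⟩)
  have t2 : ∀ m : ℕ, ∀ Φ : (Fin m → unitInterval) → ℝ, Continuous Φ →
      Tendsto (fun k => ∫ x, Φ x ∂ (PIm m (μs k))) V (𝓝 (∫ x, Φ x ∂ (PIm m μ))) := by
    intro m Φ hΦ
    let L : ℕ → C(Fin m → unitInterval, ℝ) →ₗ[ℝ] ℝ := fun k =>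
      { toFun := fun Φ => ∫ x, Φ x ∂ (PIm m (μs k))
        map_add' := fun Φ G => integral_add (PIm_int _ Φ.continuous) (PIm_int _ G.continuous)
        map_smul' := fun a Φ => integral_const_mul _ _ }
    refine pi_limit (V : Filter ℕ) L ?_ μ ?_ ⟨Φ, hΦ⟩
    · refine Eventually.of_forall fun k Φ => ?_
      have := norm_integral_le_of_norm_le_const (μ := PIm m (μs k)) (f := fun x => Φ x) (C := ‖Φ‖)
        (Eventually.of_forall fun x => ContinuousMap.norm_coe_le_norm Φ x)
      have h' : |∫ x, Φ x ∂ (PIm m (μs k))| ≤ ‖Φ‖ := by simpa using this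
      exact h'
    · intro k
      have e : ∀ j, L j (mon k) = ∏ i, ∫ x : unitInterval, (x : ℝ) ^ k i ∂ (μs j : Measure unitInterval) :=
        fun j => mon_integral _ _
      simp only [e]
      exact tendsto_finsetProd _ fun i _ => t1 (fun x => x ^ k i) (by fun_prop)
  have ibd : ∀ {m : ℕ} (k : ℕ) (f g : (Fin m → unitInterval) → ℝ) (C : ℝ), Continuous f → Continuous g →
      (∀ x, |f x - g x| ≤ C) → |∫ x, f x ∂ (PIm m (μs k)) - ∫ x, g x ∂ (PIm m (μs k))| ≤ C := by
    intro m k f g C hf hg h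
    rw [← integral_sub (PIm_int _ hf) (PIm_int _ hg)]
    have := norm_integral_le_of_norm_le_const (μ := PIm m (μs k)) (f := fun x => f x - g x) (C := C)
        (Eventually.of_forall fun x => h x)
    simpa using this
  refine ⟨μ, fun s hs => ?_, fun s hs => ?_, ?_⟩
  · obtain ⟨K, hK0, hK⟩ := Hs_close (d := d) hs
    have c0 : Continuous (fun y : Fin d → unitInterval => ph s (∑ i, (y i : ℝ))) := (ph_cont s).comp (by fun_prop)
    have a1 := t2 d (fun y => ph s (∑ i, (y i : ℝ))) c0
    have a2 : Tendsto (fun k => ∫ y : Fin d → unitInterval, ph s (lk k + ∑ i, (y i : ℝ)) ∂ (PIm d (μs k))) V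
        (𝓝 (∫ y : Fin d → unitInterval, ph s (∑ i, (y i : ℝ)) ∂ (PIm d μ))) := by
      refine tend_close a1 (e := fun k => K * lk k) (fun k => ?_) (by simpa using hl0.const_mul K)
      exact ibd k _ _ _ ((ph_cont s).comp (by fun_prop)) c0 (hK _ (lk_pos k) (lk_lt k)).2
    have a3 := (Real.continuous_exp.tendsto _).comp (((a2.const_sub 1).const_mul c).const_sub (-s))
    refine tendsto_nhds_unique (t1 (ph s) (ph_cont s)) (a3.congr fun k => ?_)
    exact (fixed_l (lk_pos k) (μs k) (h1 k) (h2 k) hs).symm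
  · obtain ⟨K, hK0, hK⟩ := Hs_close (d := d) hs
    have a1 := t2 (d + 1) (Hs s 0) (Hs0_cont hs)
    have a2 : Tendsto (fun k => ∫ y : Fin (d + 1) → unitInterval, Hs s (lk k) y ∂ (PIm (d + 1) (μs k))) V
        (𝓝 (∫ y : Fin (d + 1) → unitInterval, Hs s 0 y ∂ (PIm (d + 1) μ))) := by
      refine tend_close a1 (e := fun k => K * lk k) (fun k => ?_) (by simpa using hl0.const_mul K)
      exact ibd k _ _ _ (Hs_cont (lk_pos k)) (Hs0_cont hs) (hK _ (lk_pos k) (lk_lt k)).1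
    refine tendsto_nhds_unique (t1 (fun x => ph s x * (1 - x)) (by have := ph_cont s; fun_prop)) ((a2.const_mul c).congr fun k => ?_)
    rw [h1 k (ph s) (ph_contDiff s)]
    simp only [PhiF_ph hs (lk_pos k)]
    rfl
  · have a1 := t1 (fun x => x) continuous_id
    have a2 : Tendsto (fun k => c / Real.log (1 / lk k)) V (𝓝 0) := by
      refine Tendsto.mono_left ?_ hV
      refine Tendsto.const_div_atTop (Real.tendsto_log_atTop.comp ?_) c
      have : (fun k => 1 / lk k) = fun k : ℕ => (k : ℝ) + 2 := by funext k; simp [lk]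
      rw [this]
      exact tendsto_atTop_add_const_right _ _ tendsto_natCast_atTop_atTop
    have a3 : Tendsto (fun k => ∫ x : unitInterval, (x : ℝ) ∂ (μs k : Measure unitInterval)) V (𝓝 D) :=
      tend_close tendsto_const_nhds h3 a2
    exact tendsto_nhds_unique a1 a3

end Part10

section Part11

open MeasureTheory Topology

/-- indicator of positivity -/
def up (x : ℝ) : ℝ := if 0 < x then 1 else 0

lemma up_meas : Measurable up := Measurable.ite measurableSet_Ioi measurable_const measurable_const

lemma up_nonneg (x : ℝ) : 0 ≤ up x := by unfold up; split_ifs <;> norm_num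
lemma up_le (x : ℝ) : up x ≤ 1 := by unfold up; split_ifs <;> norm_num

lemma ph_up (x : ℝ) : Tendsto (fun s => ph s x) (𝓝[>] 0) (𝓝 (up x)) := by
  unfold up
  split_ifs with h
  · have h1 : Tendsto (fun s : ℝ => Real.exp (-(s / x))) (𝓝[>] 0) (𝓝 (Real.exp (-(0 / x)))) := by
      refine Tendsto.mono_left ?_ nhdsWithin_le_nhds
      exact Continuous.tendsto (by fun_prop) 0
    simp only [zero_div, neg_zero, Real.exp_zero] at h1
    refine h1.congr' ?_
    filter_upwards [self_mem_nhdsWithin] with s hs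
    rw [ph_pos_eq hs h]
  · refine tendsto_const_nhds.congr' ?_
    filter_upwards [self_mem_nhdsWithin] with s hs
    rw [ph_zero hs (not_lt.1 h)]

lemma int_tend {Ω : Type*} [MeasurableSpace Ω] (ν : Measure Ω) [IsProbabilityMeasure ν]
    (F : ℝ → Ω → ℝ) (G : Ω → ℝ) (hm : ∀ s > 0, Measurable (F s)) (hb : ∀ s > 0, ∀ ω, |F s ω| ≤ 1)
    (hlim : ∀ ω, Tendsto (fun s => F s ω) (𝓝[>] 0) (𝓝 (G ω))) :
    Tendsto (fun s => ∫ ω, F s ω ∂ν) (𝓝[>] 0) (𝓝 (∫ ω, G ω ∂ν)) := by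
  refine tendsto_integral_filter_of_dominated_convergence (fun _ => 1) ?_ ?_ (integrable_const _) ?_
  · filter_upwards [self_mem_nhdsWithin] with s hs using (hm s hs).aestronglyMeasurable
  · filter_upwards [self_mem_nhdsWithin] with s hs using Eventually.of_forall (hb s hs)
  · exact Eventually.of_forall hlim

lemma bdd_int {Ω : Type*} [MeasurableSpace Ω] (ν : Measure Ω) [IsProbabilityMeasure ν]
    (G : Ω → ℝ) (hm : Measurable G) (hb : ∀ ω, |G ω| ≤ 1) : Integrable G ν :=
  Integrable.of_bound hm.aestronglyMeasurable 1 (Eventually.of_forall hb)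

lemma up_abs (x : ℝ) : |up x| ≤ 1 := by rw [abs_of_nonneg (up_nonneg x)]; exact up_le x
lemma ph_abs {s : ℝ} (hs : 0 < s) (x : ℝ) : |ph s x| ≤ 1 := by
  rw [abs_of_nonneg (ph_nonneg s x)]; exact ph_le_one hs x

lemma up_sum {m : ℕ} (y : Fin m → unitInterval) :
    up (∑ i, (y i : ℝ)) = 1 - ∏ i, (1 - up (y i)) := by
  by_cases h : ∀ i, (y i : ℝ) = 0
  · simp [h, up]
  · push Not at h
    obtain ⟨i, hi⟩ := h
    have hi' : 0 < (y i : ℝ) := lt_of_le_of_ne (y i).2.1 hi.symm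
    have : 0 < ∑ i, (y i : ℝ) := Finset.sum_pos' (fun i _ => (y i).2.1) ⟨i, Finset.mem_univ i, hi'⟩
    rw [Finset.prod_eq_zero (Finset.mem_univ i)]
    · simp [up, this]
    · simp [up, hi']

lemma sumI_meas (m : ℕ) : Measurable (fun y : Fin m → unitInterval => ∑ i, (y i : ℝ)) :=
  Continuous.measurable (by fun_prop)

lemma up_sum_int {m : ℕ} (μ : ProbabilityMeasure unitInterval) :
    ∫ y : Fin m → unitInterval, up (∑ i, (y i : ℝ)) ∂ (PIm m μ)
      = 1 - (1 - ∫ x : unitInterval, up x ∂ (μ : Measure unitInterval)) ^ m := by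
  have mu : Measurable (fun x : unitInterval => up x) := up_meas.comp measurable_subtype_coe
  have e : ∫ y : Fin m → unitInterval, ∏ i, (1 - up (y i)) ∂ (PIm m μ)
      = ∏ i : Fin m, ∫ x : unitInterval, (1 - up x) ∂ (μ : Measure unitInterval) :=
    integral_fintype_prod_eq_prod (fun i (x : unitInterval) => 1 - up (x : ℝ))
  have e2 : ∫ x : unitInterval, (1 - up x) ∂ (μ : Measure unitInterval)
      = 1 - ∫ x : unitInterval, up x ∂ (μ : Measure unitInterval) := by
    rw [integral_sub (integrable_const _) (bdd_int _ _ mu (fun x => up_abs x))]; simp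
  have e3 : ∫ y : Fin m → unitInterval, (∏ i, (1 - up (y i))) ∂ (PIm m μ)
      = 1 - ∫ y : Fin m → unitInterval, up (∑ i, (y i : ℝ)) ∂ (PIm m μ) := by
    have : ∀ y : Fin m → unitInterval, ∏ i, (1 - up (y i)) = 1 - up (∑ i, (y i : ℝ)) := fun y => by
      rw [up_sum]; ring
    simp only [this]
    have mS : Measurable (fun y : Fin m → unitInterval => up (∑ i, (y i : ℝ))) := up_meas.comp (sumI_meas m)
    rw [integral_sub (integrable_const _) (bdd_int _ _ mS (fun x => up_abs _))]; simp
  rw [e3, e2] at e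
  simp at e
  linarith

lemma frac_abs {d : ℕ} (x : Fin (d + 1) → unitInterval) (i : Fin (d + 1)) :
    0 ≤ (x i : ℝ) / (∑ j, (x j : ℝ)) ∧ (x i : ℝ) / (∑ j, (x j : ℝ)) ≤ 1 :=
  ⟨div_nonneg (x i).2.1 (sum_nonneg_I x), div_le_one_of_le₀
    (Finset.single_le_sum (f := fun j => (x j : ℝ)) (fun j _ => (x j).2.1) (Finset.mem_univ i)) (sum_nonneg_I x)⟩

lemma frac_int {d : ℕ} (μ : ProbabilityMeasure unitInterval) :
    ∫ x : Fin (d + 1) → unitInterval, (x 0 : ℝ) / (∑ j, (x j : ℝ)) ∂ (PIm (d + 1) μ)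
      = (1 - (1 - ∫ x : unitInterval, up x ∂ (μ : Measure unitInterval)) ^ (d + 1)) / (d + 1) := by
  rw [eq_div_iff (by positivity), ← up_sum_int]
  have hp : ∀ i : Fin (d + 1), ∫ x : Fin (d + 1) → unitInterval, (x i : ℝ) / (∑ j, (x j : ℝ)) ∂ (PIm (d + 1) μ)
      = ∫ x : Fin (d + 1) → unitInterval, (x 0 : ℝ) / (∑ j, (x j : ℝ)) ∂ (PIm (d + 1) μ) := by
    intro i
    rw [← PIm_perm μ (Equiv.swap 0 i)]
    congr 1
    funext x
    simp only [Equiv.swap_apply_right]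
    have : ∑ j, (x (Equiv.swap 0 i j) : ℝ) = ∑ j, (x j : ℝ) :=
      Equiv.sum_comp (Equiv.swap 0 i) (fun j => (x j : ℝ))
    rw [this]
  have hs : ∀ x : Fin (d + 1) → unitInterval, up (∑ j, (x j : ℝ)) = ∑ i, (x i : ℝ) / (∑ j, (x j : ℝ)) := by
    intro x
    rw [← Finset.sum_div]
    unfold up
    split_ifs with h
    · rw [div_self h.ne']
    · have := le_antisymm (not_lt.1 h) (sum_nonneg_I x)
      rw [this]; simp
  simp only [hs]
  rw [integral_finsetSum, Finset.sum_congr rfl (fun i _ => hp i)]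
  · simp; ring
  · intro i _
    refine bdd_int _ _ ?_ fun x => ?_
    · exact Measurable.div (Continuous.measurable (by fun_prop)) (sumI_meas _)
    · rw [abs_of_nonneg (frac_abs x i).1]; exact (frac_abs x i).2

lemma D_formula {c D : ℝ} (d : ℕ) (hc : 0 < c) (U : Ultrafilter ℕ)
    (hU : (U : Filter ℕ) ≤ atTop)
    (hD : Tendsto (fun n : ℕ => 1 - EB (c / n) (allFaces n d) (fun F => (rk (bC n) F : ℝ)) / (ridges n d).card) U (𝓝 D)) :
    0 ≤ D ∧ ∃ t : ℝ, t ≤ 1 ∧ t = Real.exp (-c * (1 - t) ^ d) ∧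
      D = t - c * ((1 - (1 - t) ^ (d + 1)) / (d + 1) - t * (1 - t) ^ d) := by
  obtain ⟨μ, z1, z2, z3⟩ := zero_law d hc U hU hD
  set t := ∫ x : unitInterval, up x ∂ (μ : Measure unitInterval) with ht
  have mu : Measurable (fun x : unitInterval => up x) := up_meas.comp measurable_subtype_coe
  have iu := bdd_int (μ : Measure unitInterval) _ mu (fun x => up_abs x)
  have idt : Tendsto (fun s : ℝ => s) (𝓝[>] 0) (𝓝 0) := tendsto_id.mono_left nhdsWithin_le_nhds
  have A : Tendsto (fun s => ∫ x : unitInterval, ph s x ∂ (μ : Measure unitInterval)) (𝓝[>] 0) (𝓝 t) :=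
    int_tend _ (fun s (x : unitInterval) => ph s x) _ (fun s _ => (ph_cont s).measurable.comp measurable_subtype_coe)
      (fun s hs x => ph_abs hs _) (fun x => ph_up _)
  have B : Tendsto (fun s => ∫ y : Fin d → unitInterval, ph s (∑ i, (y i : ℝ)) ∂ (PIm d μ)) (𝓝[>] 0)
      (𝓝 (1 - (1 - t) ^ d)) := by
    rw [ht, ← up_sum_int]
    exact int_tend _ (fun s (y : Fin d → unitInterval) => ph s (∑ i, (y i : ℝ))) _
      (fun s _ => (ph_cont s).measurable.comp (sumI_meas d))
      (fun s hs x => ph_abs hs _) (fun x => ph_up _)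
  refine ⟨by rw [← z3]; exact integral_nonneg fun x => x.2.1, t, ?_, ?_, ?_⟩
  · have := integral_mono iu (integrable_const (1 : ℝ)) (fun x => up_le (x : ℝ))
    simpa using this
  · have B' := (Real.continuous_exp.tendsto _).comp (idt.neg.sub ((B.const_sub 1).const_mul c))
    have B'' : Tendsto (fun s => ∫ x : unitInterval, ph s x ∂ (μ : Measure unitInterval)) (𝓝[>] 0)
        (𝓝 (Real.exp (-0 - c * (1 - (1 - (1 - t) ^ d))))) := by
      refine B'.congr' ?_
      filter_upwards [self_mem_nhdsWithin] with s hs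
      rw [z1 s hs]; rfl
    have : t = Real.exp (-0 - c * (1 - (1 - (1 - t) ^ d))) := tendsto_nhds_unique A B''
    refine this.trans (congrArg Real.exp ?_)
    ring
  · have C1 : Tendsto (fun s => ∫ x : unitInterval, ph s x * (1 - x) ∂ (μ : Measure unitInterval)) (𝓝[>] 0)
        (𝓝 (∫ x : unitInterval, up x * (1 - x) ∂ (μ : Measure unitInterval))) := by
      refine int_tend _ (fun s (x : unitInterval) => ph s x * (1 - x)) _ (fun s _ => ?_)
        (fun s hs x => ?_) (fun x => (ph_up _).mul_const _)
      · exact ((ph_cont s).measurable.comp measurable_subtype_coe).mul (measurable_const.sub measurable_subtype_coe)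
      · rw [abs_mul]
        refine mul_le_one₀ (ph_abs hs _) (abs_nonneg _) ?_
        rw [abs_of_nonneg (by linarith [x.2.2])]
        linarith [x.2.1]
    have C2 : ∫ x : unitInterval, up x * (1 - x) ∂ (μ : Measure unitInterval) = t - D := by
      rw [← z3, ht, ← integral_sub iu (I_int μ continuous_subtype_val)]
      congr 1
      funext x
      rcases x.2.1.eq_or_lt with h | h
      · simp [up, ← h]
      · simp [up, h]
    have D1 : Tendsto (fun s => ∫ x : Fin (d + 1) → unitInterval, Hs s 0 x ∂ (PIm (d + 1) μ)) (𝓝[>] 0)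
        (𝓝 (∫ x : Fin (d + 1) → unitInterval, up (x 0) * up (∑ i : Fin d, (x i.succ : ℝ)) *
          ((x 0 : ℝ) / (∑ i, (x i : ℝ))) ∂ (PIm (d + 1) μ))) := by
      refine int_tend _ (fun s x => Hs s 0 x) _ (fun s hs => (Hs0_cont hs).measurable) (fun s hs x => ?_) (fun x => ?_)
      · unfold Hs
        rw [zero_add, zero_add, abs_mul, abs_mul]
        refine mul_le_one₀ (mul_le_one₀ (ph_abs hs _) (abs_nonneg _) (ph_abs hs _)) (abs_nonneg _) ?_
        rw [abs_of_nonneg (frac_abs x 0).1]; exact (frac_abs x 0).2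
      · unfold Hs
        simp only [zero_add]
        exact ((ph_up _).mul (ph_up _)).mul_const _
    have D2 : ∫ x : Fin (d + 1) → unitInterval, up (x 0) * up (∑ i : Fin d, (x i.succ : ℝ)) *
          ((x 0 : ℝ) / (∑ i, (x i : ℝ))) ∂ (PIm (d + 1) μ)
        = (1 - (1 - t) ^ (d + 1)) / (d + 1) - t * (1 - t) ^ d := by
      have e : ∀ x : Fin (d + 1) → unitInterval, up (x 0) * up (∑ i : Fin d, (x i.succ : ℝ)) *
          ((x 0 : ℝ) / (∑ i, (x i : ℝ))) = (x 0 : ℝ) / (∑ i, (x i : ℝ)) -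
          up (x 0) * (1 - up (∑ i : Fin d, (x i.succ : ℝ))) := by
        intro x
        have hS := sum_nonneg_I (fun i : Fin d => x i.succ)
        rw [sum_coord]
        rcases (x 0).2.1.eq_or_lt with h | h
        · simp [up, ← h]
        · rcases hS.eq_or_lt with h' | h'
          · simp only [← h']; simp [up, h, h.ne']
          · simp [up, h, h']
      simp only [e]
      have mS : Measurable (fun y : Fin d → unitInterval => up (∑ i, (y i : ℝ))) := up_meas.comp (sumI_meas d)
      have mt : Measurable (fun x : Fin (d + 1) → unitInterval => (fun i : Fin d => x i.succ)) := by fun_prop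
      rw [integral_sub, frac_int, PIm_split μ (fun x => up x) (fun y => 1 - up (∑ i, (y i : ℝ))),
        integral_sub (integrable_const _) (bdd_int _ _ mS (fun x => up_abs _)), up_sum_int]
      · simp [ht]
      · refine bdd_int _ _ ?_ fun x => ?_
        · exact Measurable.div (Continuous.measurable (by fun_prop)) (sumI_meas _)
        · rw [abs_of_nonneg (frac_abs x 0).1]; exact (frac_abs x 0).2
      · refine bdd_int _ _ ?_ fun x => ?_
        · exact (mu.comp (measurable_pi_apply 0)).mul (measurable_const.sub (mS.comp mt))
        · rw [abs_mul]
          refine mul_le_one₀ (up_abs _) (abs_nonneg _) ?_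
          have h1 := up_nonneg (∑ i : Fin d, (x i.succ : ℝ))
          have h2 := up_le (∑ i : Fin d, (x i.succ : ℝ))
          rw [abs_le]; constructor <;> linarith
    rw [C2] at C1
    rw [D2] at D1
    have C3 := C1.congr' (f₂ := fun s => c * ∫ x : Fin (d + 1) → unitInterval, Hs s 0 x ∂ (PIm (d + 1) μ)) (by
      filter_upwards [self_mem_nhdsWithin] with s hs using z2 s hs)
    have := tendsto_nhds_unique C3 (D1.const_mul c)
    linarith

end Part11

section Part12

section betti
variable {α ι : Type*} [Fintype ι] [DecidableEq α]

/-- span membership -/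
def inS (b : α → ι → ℝ) (F : Finset α) (σ : α) : Prop :=
  b σ ∈ Submodule.span ℝ (b '' (F : Set α))

/-- nullity -/
def beta (b : α → ι → ℝ) (F : Finset α) : ℝ := F.card - rk b F

/-- abstract shadow -/
def Sh (b : α → ι → ℝ) (A F : Finset α) : Finset α := A.filter (fun σ => σ ∉ F ∧ inS b F σ)

lemma inS_mono (b : α → ι → ℝ) {F G : Finset α} (h : F ⊆ G) {σ : α} (hs : inS b F σ) : inS b G σ :=
  Submodule.span_mono (Set.image_mono (by exact_mod_cast h)) hs

lemma rk_insert_in (b : α → ι → ℝ) {F : Finset α} {σ : α} (h : inS b F σ) :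
    rk b (insert σ F) = rk b F := by
  unfold rk
  rw [Finset.coe_insert, Set.image_insert_eq, Submodule.span_insert_eq_span h]

lemma rk_insert_out (b : α → ι → ℝ) {F : Finset α} {σ : α} (h : ¬ inS b F σ) :
    rk b (insert σ F) = rk b F + 1 := by
  unfold rk
  rw [Finset.coe_insert, Set.image_insert_eq, Submodule.span_insert]
  have h0 : b σ ≠ 0 := fun h0 => h (by unfold inS; rw [h0]; exact Submodule.zero_mem _)
  have h1 := Submodule.finrank_sup_add_finrank_inf_eq (Submodule.span ℝ {b σ})
    (Submodule.span ℝ (b '' (F : Set α)))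
  have h2 : Submodule.span ℝ {b σ} ⊓ Submodule.span ℝ (b '' (F : Set α)) = ⊥ := by
    rw [← disjoint_iff]
    rw [disjoint_comm]
    exact (Submodule.disjoint_span_singleton' h0).2 h
  rw [h2, finrank_bot, finrank_span_singleton h0] at h1
  omega

lemma beta_insert (b : α → ι → ℝ) {F : Finset α} {σ : α} (hn : σ ∉ F) :
    beta b (insert σ F) = beta b F + if inS b F σ then 1 else 0 := by
  unfold beta
  rw [Finset.card_insert_of_notMem hn]
  split_ifs with h
  · rw [rk_insert_in b h]; push_cast; ring
  · rw [rk_insert_out b h]; push_cast; ring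

lemma beta_insert_le (b : α → ι → ℝ) (F : Finset α) (σ : α) : beta b F ≤ beta b (insert σ F) := by
  by_cases hn : σ ∈ F
  · rw [Finset.insert_eq_of_mem hn]
  · rw [beta_insert b hn]; split_ifs <;> simp

lemma beta_union (b : α → ι → ℝ) (A F F' : Finset α) :
    (∑ σ ∈ Sh b A F, if σ ∈ F' then (1 : ℝ) else 0) ≤ beta b (F ∪ F') - beta b F := by
  induction F' using Finset.induction_on with
  | empty => simp
  | insert a F' ha ih =>
    rw [Finset.union_insert]
    have e : (∑ σ ∈ Sh b A F, if σ ∈ insert a F' then (1 : ℝ) else 0)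
        = (∑ σ ∈ Sh b A F, if σ ∈ F' then (1 : ℝ) else 0) + if a ∈ Sh b A F then 1 else 0 := by
      rw [← Finset.sum_ite_eq' (Sh b A F) a (fun _ => (1 : ℝ)), ← Finset.sum_add_distrib]
      refine Finset.sum_congr rfl fun σ _ => ?_
      by_cases h : σ = a
      · subst h; simp [ha]
      · simp [h]
    rw [e]
    split_ifs with h
    · obtain ⟨_, h1, h2⟩ := Finset.mem_filter.1 h
      rw [beta_insert b (by simp [h1, ha]), if_pos (inS_mono b Finset.subset_union_left h2)]
      linarith
    · linarith [beta_insert_le b (F ∪ F') a]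

lemma beta_inter (b : α → ι → ℝ) (F F' : Finset α) :
    beta b (F ∪ F') - beta b F ≤
      ∑ σ ∈ F', if σ ∉ F ∧ inS b ((F ∪ F').erase σ) σ then (1 : ℝ) else 0 := by
  induction F' using Finset.induction_on with
  | empty => simp
  | insert a F' ha ih =>
    rw [Finset.union_insert, Finset.sum_insert ha]
    have hm : (∑ σ ∈ F', if σ ∉ F ∧ inS b ((F ∪ F').erase σ) σ then (1 : ℝ) else 0) ≤
        ∑ σ ∈ F', if σ ∉ F ∧ inS b ((insert a (F ∪ F')).erase σ) σ then (1 : ℝ) else 0 := by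
      refine Finset.sum_le_sum fun σ _ => ?_
      by_cases h : σ ∉ F ∧ inS b ((F ∪ F').erase σ) σ
      · rw [if_pos h, if_pos ⟨h.1, inS_mono b (Finset.erase_subset_erase _ (Finset.subset_insert _ _)) h.2⟩]
      · rw [if_neg h]; split_ifs <;> norm_num
    by_cases h : a ∈ F
    · rw [if_neg (by simp [h])]
      rw [Finset.insert_eq_of_mem (Finset.mem_union_left _ h)] at hm ⊢
      linarith
    · have hn : a ∉ F ∪ F' := by simp [h, ha]
      rw [beta_insert b hn, Finset.erase_insert hn]
      simp only [h, not_false_eq_true, true_and]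
      linarith

lemma EB_ind (q : ℝ) {A : Finset α} {σ : α} (h : σ ∈ A) :
    EB q A (fun F => if σ ∈ F then (1 : ℝ) else 0) = q := by
  rw [EB_erase q h]
  rw [EB_congr q (g := fun _ => (0 : ℝ)) (fun F hF => if_neg fun h => Finset.notMem_erase σ A (hF h))]
  simp only [Finset.mem_insert, true_or, if_true, EB_const]
  ring

lemma EB_ind' (q : ℝ) {A : Finset α} {σ : α} (h : σ ∈ A) :
    EB q A (fun F => if σ ∈ F then (0 : ℝ) else 1) = 1 - q := by
  have : ∀ F : Finset α, (if σ ∈ F then (0 : ℝ) else 1) = 1 - (if σ ∈ F then (1 : ℝ) else 0) := by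
    intro F; split_ifs <;> simp
  simp only [this]
  rw [EB_sub, EB_const, EB_ind q h]

lemma Sh_card (b : α → ι → ℝ) (A F : Finset α) :
    ((Sh b A F).card : ℝ) = ∑ σ ∈ A, if σ ∈ F then 0 else (if inS b F σ then (1 : ℝ) else 0) := by
  unfold Sh
  rw [Finset.card_filter]
  push_cast
  refine Finset.sum_congr rfl fun σ _ => ?_
  by_cases h : σ ∈ F <;> simp [h]

lemma L1_pt (b : α → ι → ℝ) {q : ℝ} (h0 : 0 ≤ q) (h1 : q ≤ 1) (A F : Finset α) :
    q * (Sh b A F).card ≤ EB q A (fun F' => beta b (F ∪ F')) - beta b F := by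
  have h := EB_mono h0 h1 (A := A) (fun F' _ => beta_union b A F F')
  rw [EB_sub, EB_const, EB_sum, Finset.sum_congr (s₁ := Sh b A F) rfl (fun σ hσ => EB_ind q (Finset.mem_filter.1 hσ).1),
    Finset.sum_const, nsmul_eq_mul] at h
  linarith

lemma L2_exp (b : α → ι → ℝ) {p q : ℝ} (h0 : 0 ≤ p) (h1 : p ≤ 1) (hq0 : 0 ≤ q) (hq1 : q ≤ 1) (A : Finset α) :
    (1 - p) * (EB p A (beta b) - EB (p * q) A (beta b)) ≤
      (1 - q) * p * EB p A (fun F => ((Sh b A F).card : ℝ)) := by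
  have hpt : ∀ F ⊆ A, beta b F - EB q A (fun F' => beta b (F ∩ F')) ≤
      ∑ σ ∈ F, (1 - q) * (if inS b (F.erase σ) σ then (1 : ℝ) else 0) := by
    intro F hF
    have := EB_mono hq0 hq1 (A := A) (f := fun F' => beta b F - beta b (F ∩ F'))
      (g := fun F' => ∑ σ ∈ F, (if inS b (F.erase σ) σ then (1 : ℝ) else 0) * (if σ ∈ F' then (0 : ℝ) else 1)) (fun F' _ => by
        have h := beta_inter b (F ∩ F') F
        rw [Finset.union_eq_right.2 Finset.inter_subset_left] at h
        refine h.trans (Finset.sum_le_sum fun σ hσ => le_of_eq ?_)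
        by_cases h : σ ∈ F' <;> simp [h, hσ])
    rw [EB_sub, EB_const, EB_sum] at this
    refine this.trans (Finset.sum_le_sum fun σ hσ => le_of_eq ?_)
    rw [EB_mul, EB_ind' q (hF hσ)]; ring
  have h := EB_mono h0 h1 hpt
  rw [EB_sub, EB_inter p q (p * q) rfl, EB_palm] at h
  have hs : EB p A (fun F => ((Sh b A F).card : ℝ)) =
      ∑ σ ∈ A, (1 - p) * EB p (A.erase σ) (fun F => if inS b F σ then (1 : ℝ) else 0) := by
    rw [← EB_palm']
    exact EB_congr p fun F _ => Sh_card b A F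
  have e : ∀ σ ∈ A, p * EB p (A.erase σ) (fun F => (1 - q) * (if inS b ((insert σ F).erase σ) σ then (1 : ℝ) else 0))
      = p * (1 - q) * EB p (A.erase σ) (fun F => if inS b F σ then (1 : ℝ) else 0) := by
    intro σ _
    rw [EB_mul, mul_assoc]
    congr 2
    refine EB_congr p fun F hF => ?_
    rw [Finset.erase_insert (fun h => Finset.notMem_erase σ A (hF h))]
  rw [Finset.sum_congr rfl e, ← Finset.mul_sum] at h
  rw [hs, ← Finset.mul_sum]
  have := mul_le_mul_of_nonneg_left h (by linarith : (0 : ℝ) ≤ 1 - p)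
  linarith

lemma beta_step (b : α → ι → ℝ) (a : α) (F : Finset α) (hn : a ∉ F) :
    |beta b (insert a F) - beta b F| ≤ 1 := by
  rw [beta_insert b hn]; split_ifs <;> simp

lemma beta_dev (b : α → ι → ℝ) {p : ℝ} (h0 : 0 ≤ p) (h1 : p ≤ 1) (A : Finset α) :
    EB p A (fun F => |beta b F - EB p A (beta b)|) ≤ √(p * A.card) := by
  apply Real.le_sqrt_of_sq_le
  exact (EB_abs_sq h0 h1 A _).trans (EB_var h0 h1 A _ fun a _ F _ hn => beta_step b a F hn)

lemma Sh_le (b : α → ι → ℝ) (A F : Finset α) : ((Sh b A F).card : ℝ) ≤ A.card := by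
  exact_mod_cast Finset.card_filter_le _ _

lemma L1_exp (b : α → ι → ℝ) {p q p2 : ℝ} (h0 : 0 ≤ p) (h1 : p ≤ 1) (hq0 : 0 ≤ q) (hq1 : q ≤ 1)
    (hp : 1 - p2 = (1 - p) * (1 - q)) (A : Finset α) :
    q * EB p A (fun F => ((Sh b A F).card : ℝ)) ≤ EB p2 A (beta b) - EB p A (beta b) := by
  have h := EB_mono h0 h1 (A := A) (fun F _ => L1_pt b hq0 hq1 A F)
  rwa [EB_sub, EB_union p q p2 hp, EB_mul] at h

lemma L1_sq (b : α → ι → ℝ) {p q p2 : ℝ} (h0 : 0 ≤ p) (h1 : p ≤ 1) (hq0 : 0 ≤ q) (hq1 : q ≤ 1)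
    (hp : 1 - p2 = (1 - p) * (1 - q)) (A : Finset α) :
    q * EB p A (fun F => ((Sh b A F).card : ℝ) ^ 2) ≤
      EB p A (fun F => ((Sh b A F).card : ℝ)) * (EB p2 A (beta b) - EB p A (beta b)) +
      A.card * (√(p2 * A.card) + √(p * A.card)) := by
  set m1 := EB p A (beta b) with hm1
  set m2 := EB p2 A (beta b) with hm2
  have hp20 : 0 ≤ p2 := by nlinarith
  have hp21 : p2 ≤ 1 := by nlinarith
  have key : ∀ F ⊆ A, q * ((Sh b A F).card : ℝ) ^ 2 ≤
      ((Sh b A F).card : ℝ) * (m2 - m1) +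
       A.card * (EB q A (fun F' => |beta b (F ∪ F') - m2|) + |beta b F - m1|) := by
    intro F _
    have hS := Sh_le b A F
    have hS0 : (0 : ℝ) ≤ (Sh b A F).card := by positivity
    have k1 := mul_le_mul_of_nonneg_left (L1_pt b hq0 hq1 A F) hS0
    have k2 : EB q A (fun F' => beta b (F ∪ F')) - m2 ≤ EB q A (fun F' => |beta b (F ∪ F') - m2|) := by
      have := EB_mono hq0 hq1 (A := A) (fun F' _ => le_abs_self (beta b (F ∪ F') - m2))
      rwa [EB_sub, EB_const] at this
    have k3 := neg_abs_le (beta b F - m1)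
    have k4 : 0 ≤ EB q A (fun F' => |beta b (F ∪ F') - m2|) := EB_nonneg hq0 hq1 fun _ _ => abs_nonneg _
    have k5 := mul_le_mul_of_nonneg_right hS (add_nonneg k4 (abs_nonneg (beta b F - m1)))
    have k6 := mul_le_mul_of_nonneg_left (add_le_add k2 (by linarith : -(beta b F - m1) ≤ |beta b F - m1|)) hS0
    nlinarith
  have h := EB_mono h0 h1 key
  rw [EB_mul, EB_add, EB_mul_right, EB_mul, EB_add, EB_union p q p2 hp A (fun F => |beta b F - m2|)] at h
  refine h.trans ?_
  have := beta_dev b h0 h1 A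
  have := beta_dev b hp20 hp21 A
  gcongr

end betti

lemma dimKer_beta (n : ℕ) (F : Finset (Finset (Fin n))) : (dimKer n F : ℝ) = beta (bC n) F :=
  dimKer_eq n F

lemma shadow_eq (n d : ℕ) (F : Finset (Finset (Fin n))) :
    shadowR n d F = Sh (bC n) (allFaces n d) F := by
  unfold shadowR Sh
  refine Finset.filter_congr fun σ _ => ?_
  refine and_congr_right fun hn => ?_
  have h : (dimKer n F < dimKer n (insert σ F)) ↔ ((dimKer n F : ℝ) < dimKer n (insert σ F)) := by
    norm_cast
  rw [h, dimKer_beta, dimKer_beta, beta_insert _ hn]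
  split_ifs with h <;> simp [h]

lemma beta_nonneg (n : ℕ) (F : Finset (Finset (Fin n))) : 0 ≤ beta (bC n) F := by
  rw [← dimKer_beta]; positivity

end Part12

section Part13

section calculus
open Topology
variable {d : ℕ}

def kk (d : ℕ) (t : ℝ) : ℝ := ((d : ℝ) + 1) * (1 - t) + (1 + (d : ℝ) * t) * Real.log t
def hq (d : ℕ) (t : ℝ) : ℝ := 1 - t + d * (t * Real.log t)
def psi (d : ℕ) (t : ℝ) : ℝ := -Real.log t / (1 - t) ^ d

lemma kk_deriv {t : ℝ} (ht : 0 < t) : HasDerivAt (kk d) (hq d t / t) t := by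
  have h1 := ((hasDerivAt_id t).const_sub 1).const_mul ((d : ℝ) + 1)
  have h2 := (((hasDerivAt_id t).const_mul (d : ℝ)).const_add 1).mul (Real.hasDerivAt_log ht.ne')
  refine (h1.add h2).congr_deriv ?_
  unfold hq
  simp only [id]
  field_simp
  ring

lemma psi_deriv {t : ℝ} (ht : 0 < t) (ht1 : t < 1) :
    HasDerivAt (psi d) (-(hq d t / t) / (1 - t) ^ (d + 1)) t := by
  have h0 : (1 - t) ≠ 0 := by linarith
  have h1 := (Real.hasDerivAt_log ht.ne').neg
  have h2 := ((hasDerivAt_id t).const_sub 1).pow d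
  refine (h1.div h2 (pow_ne_zero d h0)).congr_deriv ?_
  unfold hq
  simp only [id, Pi.neg_apply, Pi.pow_apply]
  rcases d with _ | d
  · simp; field_simp
  · simp only [Nat.add_sub_cancel]
    field_simp
    push_cast
    ring

lemma kk_one : kk d 1 = 0 := by simp [kk]

lemma kk_cont {s : Set ℝ} (hs : ∀ x ∈ s, 0 < x) : ContinuousOn (kk d) s := fun x hx =>
  (kk_deriv (hs x hx)).continuousAt.continuousWithinAt

lemma hq_conv (hd : 0 < d) {a t : ℝ} (ha : 0 < a) (hat : a < t) (ht : t < 1) (h : hq d a ≤ 0) :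
    hq d t < 0 := by
  have hd' : (0 : ℝ) < d := by exact_mod_cast hd
  have h1 : 0 < 1 - a := by linarith
  have w1 : 0 < (1 - t) / (1 - a) := div_pos (by linarith) h1
  have w2 : 0 < (t - a) / (1 - a) := div_pos (by linarith) h1
  have w3 : (1 - t) / (1 - a) + (t - a) / (1 - a) = 1 := by field_simp; ring
  have hc := Real.strictConvexOn_mul_log.2 (Set.mem_Ici.2 ha.le) (Set.mem_Ici.2 (zero_le_one' ℝ))
    (by linarith : a ≠ 1) w1 w2 w3
  have e : ((1 - t) / (1 - a)) • a + ((t - a) / (1 - a)) • (1 : ℝ) = t := by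
    simp only [smul_eq_mul]; field_simp; ring
  rw [e] at hc
  simp only [smul_eq_mul, Real.log_one, mul_zero, add_zero] at hc
  have e2 : (1 - t) / (1 - a) * hq d a = 1 - t + d * ((1 - t) / (1 - a) * (a * Real.log a)) := by
    unfold hq; field_simp
  have e3 : (1 - t) / (1 - a) * hq d a ≤ 0 :=
    mul_nonpos_of_nonneg_of_nonpos (div_nonneg (by linarith) h1.le) h
  have := mul_lt_mul_of_pos_left hc hd'
  rw [e2] at e3
  unfold hq
  linarith

lemma kk_pos_of (hd : 0 < d) {a t : ℝ} (ha : 0 < a) (hat : a ≤ t) (ht : t < 1) (h : hq d a ≤ 0) :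
    0 < kk d t := by
  have hanti : StrictAntiOn (kk d) (Set.Icc a 1) := by
    refine strictAntiOn_of_deriv_neg (convex_Icc a 1) (kk_cont fun x hx => ha.trans_le hx.1) fun x hx => ?_
    rw [interior_Icc] at hx
    have hx0 : 0 < x := ha.trans hx.1
    rw [(kk_deriv hx0).deriv]
    exact div_neg_of_neg_of_pos (hq_conv hd ha hx.1 hx.2 h) hx0
  have := hanti ⟨hat, ht.le⟩ ⟨by linarith, le_refl 1⟩ ht
  rwa [kk_one] at this

lemma hq_pos (hd : 0 < d) {td a : ℝ} (htd1 : td < 1) (hk : kk d td = 0) (ha : 0 < a) (hat : a ≤ td) :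
    0 < hq d a := by
  by_contra h
  have := kk_pos_of hd ha hat htd1 (not_lt.1 h)
  linarith

lemma kk_mono (hd : 0 < d) {td : ℝ} (htd1 : td < 1) (hk : kk d td = 0) :
    StrictMonoOn (kk d) (Set.Ioc 0 td) := by
  refine strictMonoOn_of_deriv_pos (convex_Ioc 0 td) (kk_cont fun x hx => hx.1) fun x hx => ?_
  rw [interior_Ioc] at hx
  rw [(kk_deriv hx.1).deriv]
  exact div_pos (hq_pos hd htd1 hk hx.1 hx.2.le) hx.1

lemma psi_anti (hd : 0 < d) {td : ℝ} (htd1 : td < 1) (hk : kk d td = 0) :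
    StrictAntiOn (psi d) (Set.Ioc 0 td) := by
  refine strictAntiOn_of_deriv_neg (convex_Ioc 0 td) (fun x hx =>
    (psi_deriv hx.1 (hx.2.trans_lt htd1)).continuousAt.continuousWithinAt) fun x hx => ?_
  rw [interior_Ioc] at hx
  have h1 : x < 1 := hx.2.trans htd1
  rw [(psi_deriv hx.1 h1).deriv]
  have := div_pos (hq_pos hd htd1 hk hx.1 hx.2.le) hx.1
  have h2 : 0 < (1 - x) ^ (d + 1) := pow_pos (by linarith) _
  exact div_neg_of_neg_of_pos (by linarith) h2

lemma kk_pos (hd : 0 < d) {td t : ℝ} (htd0 : 0 < td) (hk : kk d td = 0) (ht : td < t) (ht1 : t < 1) :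
    0 < kk d t := by
  by_contra hcon
  have ht0 : 0 < t := htd0.trans ht
  have h1 : 0 < hq d t := by
    by_contra h
    exact hcon (kk_pos_of hd ht0 le_rfl ht1 (not_lt.1 h))
  have h2 : ∀ x, 0 < x → x < t → 0 < hq d x := by
    intro x hx hxt
    by_contra h
    linarith [hq_conv hd hx hxt ht1 (not_lt.1 h)]
  have hm : StrictMonoOn (kk d) (Set.Icc td t) := by
    refine strictMonoOn_of_deriv_pos (convex_Icc td t) (kk_cont fun x hx => htd0.trans_le hx.1) fun x hx => ?_
    rw [interior_Icc] at hx
    have hx0 := htd0.trans hx.1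
    rw [(kk_deriv hx0).deriv]
    exact div_pos (h2 x hx0 hx.2) hx0
  have := hm ⟨le_rfl, ht.le⟩ ⟨ht.le, le_rfl⟩ ht
  rw [hk] at this
  exact hcon this

/-- solving the root equation -/
lemma root_psi {c t : ℝ} (ht1 : t < 1) (h : t = Real.exp (-c * (1 - t) ^ d)) : psi d t = c := by
  have h0 : (1 - t) ^ d ≠ 0 := pow_ne_zero _ (by linarith)
  have : Real.log t = -c * (1 - t) ^ d := by
    conv_lhs => rw [h]
    exact Real.log_exp _
  unfold psi
  rw [this]
  field_simp

lemma root_b {c t : ℝ} (ht1 : t < 1) (h : t = Real.exp (-c * (1 - t) ^ d)) :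
    c / (d + 1) - 1 + (t - c * ((1 - (1 - t) ^ (d + 1)) / (d + 1) - t * (1 - t) ^ d)) =
      -kk d t / (d + 1) := by
  have : Real.log t = -c * (1 - t) ^ d := by
    conv_lhs => rw [h]
    exact Real.log_exp _
  unfold kk
  rw [this]
  field_simp
  ring

lemma mvt_gap (hd : 0 < d) {td a e : ℝ} (htd1 : td < 1) (hk : kk d td = 0) (ha : 0 < a) (hae : a < e) (he : e ≤ td) :
    ∃ ξ ∈ Set.Ioo a e, -kk d a / (d + 1) - -kk d e / (d + 1) = (psi d a - psi d e) * ((1 - ξ) ^ (d + 1) / (d + 1)) := by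
  obtain ⟨ξ, hξ, h⟩ := exists_ratio_hasDerivAt_eq_ratio_slope (psi d) (fun t => -(hq d t / t) / (1 - t) ^ (d + 1)) hae
    (fun x hx => (psi_deriv (ha.trans_le hx.1) (hx.2.trans_lt (he.trans_lt htd1))).continuousAt.continuousWithinAt)
    (fun x hx => psi_deriv (ha.trans hx.1) (hx.2.trans_le he |>.trans htd1))
    (fun t => -kk d t / (d + 1)) (fun t => -(hq d t / t) / (d + 1))
    (fun x hx => ((kk_deriv (d := d) (ha.trans_le hx.1)).neg.div_const _).continuousAt.continuousWithinAt)
    (fun x hx => (kk_deriv (d := d) (ha.trans hx.1)).neg.div_const _)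
  refine ⟨ξ, hξ, ?_⟩
  have hp := div_pos (hq_pos hd htd1 hk (ha.trans hξ.1) (hξ.2.le.trans he)) (ha.trans hξ.1)
  have h2 : (1 - ξ) ^ (d + 1) ≠ 0 := pow_ne_zero _ (by linarith [hξ.2])
  set K := hq d ξ / ξ
  have hK : K ≠ 0 := hp.ne'
  have h3 : (psi d e - psi d a) * ((1 - ξ) ^ (d + 1) / (d + 1)) = (-kk d e / (d + 1) - -kk d a / (d + 1)) := by
    field_simp at h ⊢
    linarith
  linarith

/-- The analytic core. -/
lemma core (hd : 0 < d) {td c tc : ℝ} (htd0 : 0 < td) (htd1 : td < 1) (hk : kk d td = 0)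
    (hc : psi d td < c) (htc : tc ∈ Set.Ioo (0 : ℝ) 1) (htcroot : tc = Real.exp (-c * (1 - tc) ^ d))
    (htcmin : ∀ t ∈ Set.Ioo (0 : ℝ) 1, t = Real.exp (-c * (1 - t) ^ d) → tc ≤ t)
    (b : ℝ → ℝ) (hb0 : ∀ c > 0, 0 ≤ b c) (hbl : ∀ c > 0, c / (d + 1) - 1 ≤ b c)
    (hmono : ∀ c0 c1, 0 < c0 → c0 < c1 → b c0 ≤ b c1)
    (hlip : ∀ c0 c1, 0 < c0 → c0 < c1 → b c1 - b c0 ≤ (c1 - c0))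
    (hform : ∀ c > 0, ∃ t : ℝ, t ≤ 1 ∧ t = Real.exp (-c * (1 - t) ^ d) ∧
      b c = c / (d + 1) - 1 + (t - c * ((1 - (1 - t) ^ (d + 1)) / (d + 1) - t * (1 - t) ^ d))) :
    0 < c ∧ ∀ ε > 0, (∃ c0, 0 < c0 ∧ c0 < c ∧ (c - c0) * (((1 - tc) ^ (d + 1) - ε) / (d + 1)) ≤ b c - b c0) ∧
      (∃ c1, c < c1 ∧ b c1 - b c ≤ (c1 - c) * (((1 - tc) ^ (d + 1) + ε) / (d + 1))) := by
  have hps0 : 0 < psi d td := div_pos (neg_pos.2 (Real.log_neg htd0 htd1)) (pow_pos (by linarith) _)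
  have hd1 : (0 : ℝ) < d + 1 := by positivity
  have hkm := kk_mono hd htd1 hk
  have hpa := psi_anti hd htd1 hk
  -- dichotomy
  have dich : ∀ c' > psi d td, b c' = 0 ∨ ∃ t, 0 < t ∧ t < td ∧ psi d t = c' ∧
      t = Real.exp (-c' * (1 - t) ^ d) ∧ b c' = -kk d t / (d + 1) := by
    intro c' hc'
    have hc0 : 0 < c' := hps0.trans hc'
    obtain ⟨t, ht1, ht, hb⟩ := hform c' hc0
    rcases ht1.lt_or_eq with h1 | h1
    · right
      have ht0 : 0 < t := by rw [ht]; exact Real.exp_pos _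
      rw [root_b h1 ht] at hb
      have hpt := root_psi h1 ht
      refine ⟨t, ht0, ?_, hpt, ht, hb⟩
      by_contra hcon
      rcases (not_lt.1 hcon).lt_or_eq with h2 | h2
      · have h3 := kk_pos hd htd0 hk h2 h1
        have h4 := hb0 c' hc0
        rw [hb] at h4
        have : -kk d t / (d + 1) < 0 := div_neg_of_neg_of_pos (by linarith) hd1
        linarith
      · rw [← h2] at hpt; linarith
    · left
      rw [hb, h1]
      have : d ≠ 0 := hd.ne'
      simp [this]; ring
  have hcont : ContinuousOn b (Set.Ioi 0) := by
    have : LipschitzOnWith 1 b (Set.Ioi 0) := by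
      refine LipschitzOnWith.of_dist_le_mul fun x hx y hy => ?_
      rw [Real.dist_eq, Real.dist_eq, NNReal.coe_one, one_mul]
      rcases lt_trichotomy x y with h | h | h
      · rw [abs_sub_comm, abs_of_nonneg (by linarith [hmono x y hx h]), abs_sub_comm, abs_of_pos (by linarith)]
        exact hlip x y hx h
      · simp [h]
      · rw [abs_of_nonneg (by linarith [hmono y x hy h]), abs_of_pos (by linarith)]
        exact hlip y x hy h
    exact this.continuousOn
  have nz : ∀ c' > psi d td, b c' ≠ 0 := by
    intro c' hc' hz
    have hc0 : 0 < c' := hps0.trans hc'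
    -- point near td
    obtain ⟨t2, ht20, ht2d, ht2⟩ : ∃ t2, 0 < t2 ∧ t2 < td ∧ psi d t2 < c' := by
      have hcn : ContinuousAt (psi d) td := (psi_deriv htd0 htd1).continuousAt
      have h1 : ∀ᶠ t in 𝓝[<] td, psi d t < c' := (hcn.eventually (gt_mem_nhds hc')).filter_mono nhdsWithin_le_nhds
      have h2 : ∀ᶠ t in 𝓝[<] td, t ∈ Set.Ioo 0 td := Ioo_mem_nhdsLT htd0
      obtain ⟨t, h3, h4⟩ := (h1.and h2).exists
      exact ⟨t, h4.1, h4.2, h3⟩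
    set δ := -kk d t2 / (d + 1) with hδ
    have hδ0 : 0 < δ := by
      have := hkm ⟨ht20, ht2d.le⟩ ⟨htd0, le_rfl⟩ ht2d
      exact div_pos (by linarith) hd1
    have gap : ∀ c'' ≥ c', b c'' = 0 ∨ δ ≤ b c'' := by
      intro c'' hc''
      rcases dich c'' (lt_of_lt_of_le hc' hc'') with h | ⟨t, h0, h1, h2, -, h3⟩
      · exact Or.inl h
      · right
        have : t ≤ t2 := by
          by_contra hcon
          have := hpa ⟨ht20, ht2d.le⟩ ⟨h0, h1.le⟩ (not_le.1 hcon)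
          linarith
        rw [h3, hδ]
        have := hkm.monotoneOn ⟨h0, h1.le⟩ ⟨ht20, ht2d.le⟩ this
        gcongr
    set C := c' + (d + 1) + 1
    have hC : 0 < b C := by
      refine lt_of_lt_of_le ?_ (hbl C (by positivity))
      rw [sub_pos, lt_div_iff₀ hd1]
      simp only [C]; linarith
    have hC' : δ ≤ b C := (gap C (by simp only [C]; linarith)).resolve_left hC.ne'
    have hiv := intermediate_value_Icc (by simp only [C]; linarith : c' ≤ C)
      (hcont.mono fun x hx => lt_of_lt_of_le hc0 hx.1)
    obtain ⟨y, hy, hyb⟩ := hiv (show δ / 2 ∈ Set.Icc (b c') (b C) from ⟨by rw [hz]; linarith, by linarith⟩)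
    rcases gap y hy.1 with h | h <;> linarith
  have tb : ∀ t, 0 < t → t < td → b (psi d t) = -kk d t / (d + 1) := by
    intro t h0 h1
    have hgt := hpa ⟨h0, h1.le⟩ ⟨htd0, le_rfl⟩ h1
    rcases dich _ hgt with h | ⟨t', h0', h1', h2, -, h3⟩
    · exact absurd h (nz _ hgt)
    · rw [h3, hpa.injOn ⟨h0', h1'.le⟩ ⟨h0, h1.le⟩ h2]
  have htcd : tc < td := by
    rcases dich c hc with h | ⟨t', h0', h1', h2, h3, -⟩
    · exact absurd h (nz _ hc)
    · exact (htcmin t' ⟨h0', h1'.trans htd1⟩ h3).trans_lt h1'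
  have hpc : psi d tc = c := root_psi htc.2 htcroot
  have hbc := tb tc htc.1 htcd
  rw [hpc] at hbc
  refine ⟨hps0.trans hc, fun ε hε => ?_⟩
  have hcn : ContinuousAt (fun t : ℝ => (1 - t) ^ (d + 1)) tc := by fun_prop
  obtain ⟨η, hη, hball⟩ := Metric.continuousAt_iff.1 hcn ε hε
  have hball' : ∀ x, |x - tc| < η → (1 - tc) ^ (d + 1) - ε ≤ (1 - x) ^ (d + 1) ∧ (1 - x) ^ (d + 1) ≤ (1 - tc) ^ (d + 1) + ε := by
    intro x hx
    have := hball (x := x) (by rwa [Real.dist_eq])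
    rw [Real.dist_eq, abs_lt] at this
    constructor <;> linarith [this.1, this.2]
  constructor
  · set t0 := min (tc + η / 2) ((tc + td) / 2) with ht0
    have h1 : tc < t0 := lt_min (by linarith) (by linarith)
    have h2 : t0 < td := lt_of_le_of_lt (min_le_right _ _) (by linarith)
    have h3 : t0 ≤ tc + η / 2 := min_le_left _ _
    have h4 := hpa ⟨htc.1, htcd.le⟩ ⟨htc.1.trans h1, h2.le⟩ h1
    have h5 := hpa ⟨htc.1.trans h1, h2.le⟩ ⟨htd0, le_rfl⟩ h2
    obtain ⟨ξ, hξ, h⟩ := mvt_gap hd htd1 hk htc.1 h1 h2.le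
    refine ⟨psi d t0, hps0.trans h5, by linarith, ?_⟩
    rw [tb t0 (htc.1.trans h1) h2, hbc, h, hpc]
    have := (hball' ξ (by rw [abs_lt]; constructor <;> linarith [hξ.1, hξ.2])).1
    have h6 : 0 ≤ c - psi d t0 := by linarith
    gcongr
  · set t1 := max (tc - η / 2) (tc / 2) with ht1
    have h0 : 0 < t1 := lt_of_lt_of_le (by linarith [htc.1]) (le_max_right _ _)
    have h1 : t1 < tc := max_lt (by linarith) (by linarith [htc.1])
    have h3 : tc - η / 2 ≤ t1 := le_max_left _ _
    have h4 := hpa ⟨h0, (h1.trans htcd).le⟩ ⟨htc.1, htcd.le⟩ h1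
    obtain ⟨ξ, hξ, h⟩ := mvt_gap hd htd1 hk h0 h1 htcd.le
    refine ⟨psi d t1, by linarith, ?_⟩
    rw [tb t1 h0 (h1.trans htcd), hbc, h, hpc]
    have := (hball' ξ (by rw [abs_lt]; constructor <;> linarith [hξ.1, hξ.2])).2
    have h6 : 0 ≤ psi d t1 - c := by linarith
    gcongr

end calculus

end Part13

section final
open Topology

def bn (d : ℕ) (c : ℝ) (n : ℕ) : ℝ := EB (c / n) (allFaces n d) (beta (bC n)) / (ridges n d).card
def Xn (d : ℕ) (c : ℝ) (n : ℕ) : ℝ :=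
  EB (c / n) (allFaces n d) (fun F => ((Sh (bC n) (allFaces n d) F).card : ℝ)) / (allFaces n d).card
def X2n (d : ℕ) (c : ℝ) (n : ℕ) : ℝ :=
  EB (c / n) (allFaces n d) (fun F => ((Sh (bC n) (allFaces n d) F).card : ℝ) ^ 2) / ((allFaces n d).card : ℝ) ^ 2

lemma ult_lim (U : Ultrafilter ℕ) (f : ℕ → ℝ) {a e : ℝ} (h : ∀ᶠ n in U, f n ∈ Set.Icc a e) :
    ∃ x ∈ Set.Icc a e, Tendsto f U (𝓝 x) := by
  obtain ⟨x, hx, h⟩ := (isCompact_Icc (a := a) (b := e)).ultrafilter_le_nhds (U.map f)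
    (by rw [le_principal_iff]; exact h)
  exact ⟨x, hx, h⟩

lemma bn_bd {c : ℝ} (d : ℕ) (hc : 0 < c) : ∀ᶠ n in atTop, bn d c n ∈ Set.Icc 0 c := by
  filter_upwards [ev_n d hc] with n ⟨h1, h2, h3, h4⟩
  have hN := ridges_pos (n := n) (d := d) (by omega)
  have hM := allFaces_pos h1
  refine ⟨div_nonneg (EB_nonneg h3 h4 fun F _ => beta_nonneg n F) hN.le, ?_⟩
  unfold bn
  rw [div_le_iff₀ hN]
  have k1 : EB (c / n) (allFaces n d) (beta (bC n)) ≤ c / n * (allFaces n d).card := by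
    rw [← EB_card]
    refine EB_mono h3 h4 fun F _ => ?_
    unfold beta
    have : (0 : ℝ) ≤ rk (bC n) F := by positivity
    linarith
  have k2 := pMN_le (d := d) hc h1
  have k3 : 0 ≤ c / n * (allFaces n d).card := by positivity
  have k4 : (0 : ℝ) ≤ d := by positivity
  nlinarith

lemma Xn_bd {c : ℝ} (d : ℕ) (hc : 0 < c) : ∀ᶠ n in atTop, Xn d c n ∈ Set.Icc 0 1 := by
  filter_upwards [ev_n d hc] with n ⟨h1, h2, h3, h4⟩
  have hM := allFaces_pos h1
  refine ⟨div_nonneg (EB_nonneg h3 h4 fun F _ => by positivity) hM.le, ?_⟩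
  unfold Xn
  rw [div_le_one hM]
  have := EB_mono h3 h4 (A := allFaces n d) (fun F _ => Sh_le (bC n) (allFaces n d) F)
  rwa [EB_const] at this

lemma X2n_bd {c : ℝ} (d : ℕ) (hc : 0 < c) : ∀ᶠ n in atTop, X2n d c n ∈ Set.Icc 0 1 := by
  filter_upwards [ev_n d hc] with n ⟨h1, h2, h3, h4⟩
  have hM := allFaces_pos h1
  refine ⟨div_nonneg (EB_nonneg h3 h4 fun F _ => by positivity) (by positivity), ?_⟩
  unfold X2n
  rw [div_le_one (by positivity)]
  have := EB_mono h3 h4 (A := allFaces n d) (fun F _ => pow_le_pow_left₀ (by positivity) (Sh_le (bC n) (allFaces n d) F) 2)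
  rwa [EB_const] at this

lemma Xn_sq {c : ℝ} (d : ℕ) (hc : 0 < c) : ∀ᶠ n in atTop, Xn d c n ^ 2 ≤ X2n d c n := by
  filter_upwards [ev_n d hc] with n ⟨h1, h2, h3, h4⟩
  have hM := allFaces_pos h1
  unfold Xn X2n
  rw [div_pow]
  gcongr
  have := EB_abs_sq h3 h4 (allFaces n d) (fun F => ((Sh (bC n) (allFaces n d) F).card : ℝ))
  simpa using this

lemma step2 {c0 c : ℝ} (d : ℕ) (h0 : 0 < c0) (hc : c0 < c) : ∀ᶠ n : ℕ in atTop,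
    (1 - c / n) * (bn d c n - bn d c0 n) ≤ (c - c0) / n * (allFaces n d).card / (ridges n d).card * Xn d c n := by
  have hc' := h0.trans hc
  filter_upwards [ev_n d hc'] with n ⟨h1, h2, h3, h4⟩
  have hN := ridges_pos (n := n) (d := d) (by omega)
  have hM := allFaces_pos h1
  have hn : (0 : ℝ) < n := lt_of_lt_of_le hc' h2
  have h := L2_exp (bC n) h3 h4 (q := c0 / c) (by positivity) (by rw [div_le_one hc']; exact hc.le) (allFaces n d)
  have e1 : c / n * (c0 / c) = c0 / n := by field_simp
  have e2 : (1 - c0 / c) * (c / n) = (c - c0) / n := by field_simp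
  rw [e1, e2] at h
  unfold bn Xn
  rw [← sub_div, ← mul_div_assoc, div_le_iff₀ hN]
  refine h.trans (le_of_eq ?_)
  field_simp

lemma qn_fact {c c1 : ℝ} {n : ℕ} (hc' : 0 < c) (hc : c < c1) (h2 : c1 ≤ n) :
    0 ≤ (c1 - c) / (n - c) ∧ (c1 - c) / (n - c) ≤ 1 ∧
    1 - c1 / n = (1 - c / n) * (1 - (c1 - c) / (n - c)) ∧ (c1 - c) / n ≤ (c1 - c) / (n - c) := by
  have hn : (0 : ℝ) < n - c := by linarith
  have hn' : (0 : ℝ) < n := by linarith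
  refine ⟨div_nonneg (by linarith) hn.le, ?_, ?_, ?_⟩
  · rw [div_le_one hn]; linarith
  · field_simp; ring
  · exact div_le_div_of_nonneg_left (by linarith) hn (by linarith)

lemma step1 {c c1 : ℝ} (d : ℕ) (h0 : 0 < c) (hc : c < c1) : ∀ᶠ n : ℕ in atTop,
    bn d c n ≤ bn d c1 n := by
  filter_upwards [ev_n d h0, ev_n d (h0.trans hc)] with n ⟨h1, h2, h3, h4⟩ ⟨_, h2', h3', h4'⟩
  have hN := ridges_pos (n := n) (d := d) (by omega)
  obtain ⟨q0, q1, q2, q3⟩ := qn_fact h0 hc h2'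
  have h := L1_exp (bC n) h3 h4 q0 q1 q2 (allFaces n d)
  unfold bn
  gcongr
  have : 0 ≤ EB (c / n) (allFaces n d) (fun F => ((Sh (bC n) (allFaces n d) F).card : ℝ)) :=
    EB_nonneg h3 h4 fun F _ => by positivity
  nlinarith

/-- error term -/
def er (d : ℕ) (c : ℝ) (n : ℕ) : ℝ :=
  √(c / n * (allFaces n d).card / (ridges n d).card) * (√((ridges n d).card : ℝ))⁻¹

lemma step1sq {c c1 : ℝ} (d : ℕ) (h0 : 0 < c) (hc : c < c1) : ∀ᶠ n : ℕ in atTop,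
    (c1 - c) / n * (allFaces n d).card / (ridges n d).card * X2n d c n ≤
      Xn d c n * (bn d c1 n - bn d c n) + (er d c1 n + er d c n) := by
  filter_upwards [ev_n d h0, ev_n d (h0.trans hc)] with n ⟨h1, h2, h3, h4⟩ ⟨_, h2', h3', h4'⟩
  have hN := ridges_pos (n := n) (d := d) (by omega)
  have hM := allFaces_pos h1
  obtain ⟨q0, q1, q2, q3⟩ := qn_fact h0 hc h2'
  have h := L1_sq (bC n) h3 h4 q0 q1 q2 (allFaces n d)
  have herr : ∀ c : ℝ, er d c n = √(c / n * (allFaces n d).card) / (ridges n d).card := by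
    intro c
    unfold er
    rw [Real.sqrt_div' _ hN.le]
    have : √((ridges n d).card : ℝ) * √((ridges n d).card : ℝ) = (ridges n d).card := Real.mul_self_sqrt hN.le
    rw [← div_eq_mul_inv, div_div, this]
  rw [herr, herr]
  have e2 : 0 ≤ EB (c / n) (allFaces n d) (fun F => ((Sh (bC n) (allFaces n d) F).card : ℝ) ^ 2) :=
    EB_nonneg h3 h4 fun F _ => by positivity
  have k := (mul_le_mul_of_nonneg_right q3 e2).trans h
  unfold X2n Xn bn
  set M : ℝ := ((allFaces n d).card : ℝ)
  set N : ℝ := ((ridges n d).card : ℝ)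
  set E2 := EB (c / n) (allFaces n d) (fun F => ((Sh (bC n) (allFaces n d) F).card : ℝ) ^ 2)
  set E1 := EB (c / n) (allFaces n d) (fun F => ((Sh (bC n) (allFaces n d) F).card : ℝ))
  set s1 := √(c1 / n * M)
  set s2 := √(c / n * M)
  set b1 := EB (c1 / n) (allFaces n d) (beta (bC n))
  set b2 := EB (c / n) (allFaces n d) (beta (bC n))
  have l : (c1 - c) / n * M / N * (E2 / M ^ 2) = ((c1 - c) / n * E2) / (M * N) := by
    field_simp
  have r : E1 / M * (b1 / N - b2 / N) + (s1 / N + s2 / N) = (E1 * (b1 - b2) + M * (s1 + s2)) / (M * N) := by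
    field_simp
  rw [l, r]
  gcongr

lemma N_tend {d : ℕ} (hd : 0 < d) : Tendsto (fun n : ℕ => ((ridges n d).card : ℝ)) atTop atTop := by
  have h1 : Tendsto (fun n : ℕ => ((n : ℝ) - d) / d.factorial) atTop atTop :=
    (tendsto_atTop_add_const_right _ _ tendsto_natCast_atTop_atTop).atTop_div_const
      (by exact_mod_cast d.factorial_pos)
  refine tendsto_atTop_mono' _ ?_ h1
  filter_upwards [eventually_ge_atTop d] with n hn
  rw [card_ridges, div_le_iff₀ (by exact_mod_cast d.factorial_pos)]
  have h2 := Nat.pow_le_choose d n (α := ℝ)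
  rw [div_le_iff₀ (by exact_mod_cast d.factorial_pos)] at h2
  refine le_trans ?_ h2
  have h3 : ((n + 1 - d : ℕ) : ℝ) = n + 1 - d := by rw [Nat.cast_sub (by omega)]; push_cast; ring
  have h4 : (1 : ℝ) ≤ ((n + 1 - d : ℕ) : ℝ) := by exact_mod_cast (by omega : 1 ≤ n + 1 - d)
  have h5 := le_self_pow₀ h4 hd.ne'
  linarith

lemma er_tend {d : ℕ} (hd : 0 < d) (c : ℝ) : Tendsto (er d c) atTop (𝓝 0) := by
  have h1 := (Real.continuous_sqrt.tendsto _).comp (ratio_tendsto c d)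
  have h2 : Tendsto (fun n : ℕ => (√((ridges n d).card : ℝ))⁻¹) atTop (𝓝 0) :=
    tendsto_inv_atTop_zero.comp (Real.tendsto_sqrt_atTop.comp (N_tend hd))
  have := h1.mul h2
  rw [mul_zero] at this
  exact this

lemma final_x {d : ℕ} (hd : 0 < d) {td c tc : ℝ} (htd0 : 0 < td) (htd1 : td < 1) (hk : kk d td = 0)
    (hc : psi d td < c) (htc : tc ∈ Set.Ioo (0 : ℝ) 1) (htcroot : tc = Real.exp (-c * (1 - tc) ^ d))
    (htcmin : ∀ t ∈ Set.Ioo (0 : ℝ) 1, t = Real.exp (-c * (1 - t) ^ d) → tc ≤ t)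
    (U : Ultrafilter ℕ) (hU : (U : Filter ℕ) ≤ atTop) :
    0 < c ∧ Tendsto (Xn d c) U (𝓝 ((1 - tc) ^ (d + 1))) ∧
    Tendsto (X2n d c) U (𝓝 (((1 - tc) ^ (d + 1)) ^ 2)) := by
  have hd1 : (0 : ℝ) < d + 1 := by positivity
  have hex : ∀ c > 0, ∃ x, Tendsto (bn d c) U (𝓝 x) := fun c hc => by
    obtain ⟨x, _, h⟩ := ult_lim U (bn d c) (hU (bn_bd d hc))
    exact ⟨x, h⟩
  choose! b hb using hex
  have hD : ∀ c > 0, Tendsto (fun n : ℕ => 1 - EB (c / n) (allFaces n d) (fun F => (rk (bC n) F : ℝ)) / (ridges n d).card) U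
      (𝓝 (b c - c / (d + 1) + 1)) := by
    intro c hc
    refine ((hb c hc).sub ((ratio_tendsto c d).mono_left hU) |>.add_const 1).congr fun n => ?_
    unfold bn
    have : EB (c / n) (allFaces n d) (beta (bC n)) =
      c / n * (allFaces n d).card - EB (c / n) (allFaces n d) (fun F => (rk (bC n) F : ℝ)) := by
      rw [← EB_card, ← EB_sub]; rfl
    rw [this]; ring
  have hDF := fun c hc => D_formula d hc U hU (hD c hc)
  have hx2 : ∀ c0 c x : ℝ, 0 < c0 → c0 < c → Tendsto (Xn d c) U (𝓝 x) → b c - b c0 ≤ (c - c0) / (d + 1) * x := by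
    intro c0 c x h0 h1 hx
    have l1 : Tendsto (fun n : ℕ => (1 - c / n) * (bn d c n - bn d c0 n)) U (𝓝 ((1 - 0) * (b c - b c0))) :=
      (((tendsto_const_div_atTop_nhds_zero_nat c).mono_left hU).const_sub 1).mul
        ((hb c (h0.trans h1)).sub (hb c0 h0))
    have l2 := ((ratio_tendsto (c - c0) d).mono_left hU).mul hx
    have := le_of_tendsto_of_tendsto l1 l2 (hU (step2 d h0 h1))
    linarith
  have hmono : ∀ c0 c1, 0 < c0 → c0 < c1 → b c0 ≤ b c1 := fun c0 c1 h0 h1 =>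
    le_of_tendsto_of_tendsto (hb c0 h0) (hb c1 (h0.trans h1)) (hU (step1 d h0 h1))
  obtain ⟨hc0, hcore⟩ := core hd htd0 htd1 hk hc htc htcroot htcmin b
    (fun c hc => ge_of_tendsto (hb c hc) (hU ((bn_bd d hc).mono fun n h => h.1)))
    (fun c hc => by linarith [(hDF c hc).1])
    hmono
    (fun c0 c1 h0 h1 => by
      obtain ⟨x, hx, h⟩ := ult_lim U (Xn d c1) (hU (Xn_bd d (h0.trans h1)))
      refine (hx2 c0 c1 x h0 h1 h).trans ?_
      have : (c1 - c0) / (d + 1) ≤ c1 - c0 := div_le_self (by linarith) (by linarith [(Nat.cast_nonneg d : (0 : ℝ) ≤ d)])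
      have h3 : 0 ≤ (c1 - c0) / (d + 1) := div_nonneg (by linarith) hd1.le
      nlinarith [hx.1, hx.2])
    (fun c hc => by
      obtain ⟨t, h1, h2, h3⟩ := (hDF c hc).2
      exact ⟨t, h1, h2, by linarith⟩)
  obtain ⟨x, hx, hX⟩ := ult_lim U (Xn d c) (hU (Xn_bd d hc0))
  obtain ⟨y, hy, hY⟩ := ult_lim U (X2n d c) (hU (X2n_bd d hc0))
  set s := (1 - tc) ^ (d + 1) with hs
  have hs0 : 0 < s := pow_pos (by linarith [htc.2]) _
  have hxy : x ^ 2 ≤ y := le_of_tendsto_of_tendsto (hX.pow 2) hY (hU (Xn_sq d hc0))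
  have hsx : s ≤ x := by
    refine le_of_forall_pos_le_add fun ε hε => ?_
    obtain ⟨⟨c0, h0, h1, h2⟩, -⟩ := hcore ε hε
    have h3 := h2.trans (hx2 c0 c x h0 h1 hX)
    have h4 : 0 < (c - c0) / (d + 1) := div_pos (by linarith) hd1
    have h5 : (c - c0) / (d + 1) * (s - ε) ≤ (c - c0) / (d + 1) * x := by
      refine le_trans (le_of_eq ?_) h3
      ring
    linarith [le_of_mul_le_mul_left h5 h4]
  have hyx : y ≤ x * s := by
    refine le_of_forall_pos_le_add fun ε hε => ?_
    obtain ⟨-, ⟨c1, h1, h2⟩⟩ := hcore ε hε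
    have l1 := ((ratio_tendsto (c1 - c) d).mono_left hU).mul hY
    have l2 := (hX.mul ((hb c1 (hc0.trans h1)).sub (hb c hc0))).add
      (((er_tend hd c1).mono_left hU).add ((er_tend hd c).mono_left hU))
    have h3 := le_of_tendsto_of_tendsto l1 l2 (hU (step1sq d hc0 h1))
    have h4 : 0 < (c1 - c) / (d + 1) := div_pos (by linarith) hd1
    have h5 := mul_le_mul_of_nonneg_left h2 hx.1
    have h6 : (c1 - c) / (d + 1) * y ≤ (c1 - c) / (d + 1) * (x * (s + ε)) := by
      refine le_trans (h3.trans (by linarith)) (le_of_eq (a := x * ((c1 - c) * ((s + ε) / (d + 1)))) ?_)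
      ring
    have h7 := le_of_mul_le_mul_left h6 h4
    nlinarith [hx.2]
  have e1 : x = s := by
    refine le_antisymm ?_ hsx
    have hx0 : 0 < x := hs0.trans_le hsx
    by_contra h
    nlinarith [not_le.1 h]
  have e2 : y = s ^ 2 := by
    rw [e1] at hxy hyx
    exact le_antisymm (by linarith [sq s]) hxy
  rw [e1] at hX
  rw [e2] at hY
  exact ⟨hc0, hX, hY⟩

lemma probY_EB (n d : ℕ) (p : ℝ) (E : Finset (Finset (Fin n)) → Prop) :
    probY n d p E = EB p (allFaces n d) (fun F => if E F then 1 else 0) := by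
  rw [EB_eq]
  unfold probY
  refine Finset.sum_congr rfl fun F _ => ?_
  split_ifs <;> simp

lemma cheb {c s ε : ℝ} (d : ℕ) (hc : 0 < c) (hε : 0 < ε) : ∀ᶠ n : ℕ in atTop,
    1 - (X2n d c n - 2 * s * Xn d c n + s ^ 2) / ε ^ 2 ≤
      probY n d (c / n) (fun F => |((shadowR n d F).card : ℝ) / (n.choose (d + 1)) - s| ≤ ε) ∧
    probY n d (c / n) (fun F => |((shadowR n d F).card : ℝ) / (n.choose (d + 1)) - s| ≤ ε) ≤ 1 := by
  filter_upwards [ev_n d hc] with n ⟨h1, h2, h3, h4⟩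
  have hM := allFaces_pos h1
  rw [probY_EB]
  constructor
  · have e : 1 - (X2n d c n - 2 * s * Xn d c n + s ^ 2) / ε ^ 2 =
        EB (c / n) (allFaces n d) (fun F => 1 - ((((Sh (bC n) (allFaces n d) F).card : ℝ) ^ 2 *
          (((allFaces n d).card : ℝ) ^ 2)⁻¹ - 2 * s * (((Sh (bC n) (allFaces n d) F).card : ℝ) *
          ((allFaces n d).card : ℝ)⁻¹) + s ^ 2) * (ε ^ 2)⁻¹)) := by
      rw [EB_sub, EB_const, EB_mul_right, EB_add, EB_const, EB_sub, EB_mul_right, EB_mul, EB_mul_right]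
      unfold X2n Xn
      simp only [div_eq_mul_inv]
    rw [e]
    refine EB_mono h3 h4 fun F _ => ?_
    rw [shadow_eq, ← card_allFaces]
    set S : ℝ := ((Sh (bC n) (allFaces n d) F).card : ℝ)
    set M : ℝ := ((allFaces n d).card : ℝ)
    have e2 : (S ^ 2 * (M ^ 2)⁻¹ - 2 * s * (S * M⁻¹) + s ^ 2) = (S / M - s) ^ 2 := by
      field_simp; ring
    rw [e2]
    split_ifs with h
    · have : 0 ≤ (S / M - s) ^ 2 * (ε ^ 2)⁻¹ := by positivity
      linarith
    · have h5 : ε ^ 2 ≤ (S / M - s) ^ 2 := by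
        rw [← sq_abs (S / M - s)]
        exact pow_le_pow_left₀ hε.le (not_le.1 h).le 2
      rw [← div_eq_mul_inv]
      have := (one_le_div (by positivity : 0 < ε ^ 2)).2 h5
      linarith
  · have := EB_mono h3 h4 (A := allFaces n d)
      (f := fun F => if |((shadowR n d F).card : ℝ) / (n.choose (d + 1)) - s| ≤ ε then (1 : ℝ) else 0)
      (g := fun _ => 1) (fun F _ => by split_ifs <;> norm_num)
    rwa [EB_const] at this

end final

theorem statement3 (d : ℕ) (hd : 2 ≤ d) (c td tc : ℝ)
    (htd : td ∈ Set.Ioo (0 : ℝ) 1)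
    (hroot : ((d : ℝ) + 1) * (1 - td) + (1 + (d : ℝ) * td) * Real.log td = 0)
    (hc : c > -Real.log td / (1 - td) ^ d)
    (htc : tc ∈ Set.Ioo (0 : ℝ) 1)
    (htcroot : tc = Real.exp (-c * (1 - tc) ^ d))
    (htcmin : ∀ t ∈ Set.Ioo (0 : ℝ) 1, t = Real.exp (-c * (1 - t) ^ d) → tc ≤ t) :
    ∀ ε > 0, Filter.Tendsto (fun n : ℕ =>
      probY n d (c / n) (fun F =>
        |((shadowR n d F).card : ℝ) / (n.choose (d + 1)) - (1 - tc) ^ (d + 1)| ≤ ε))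
      atTop (nhds 1) := by
  intro ε hε
  rw [tendsto_iff_ultrafilter]
  intro U hU
  obtain ⟨hc0, hX, hY⟩ := final_x (by omega : 0 < d) htd.1 htd.2 hroot hc htc htcroot htcmin U hU
  set s := (1 - tc) ^ (d + 1)
  have hl := (((hY.sub (hX.const_mul (2 * s))).add_const (s ^ 2)).div_const (ε ^ 2)).const_sub 1
  have e : 1 - (s ^ 2 - 2 * s * s + s ^ 2) / ε ^ 2 = 1 := by ring
  rw [e] at hl
  have hch := cheb (s := s) d hc0 hε
  exact tendsto_of_tendsto_of_tendsto_of_le_of_le' hl tendsto_const_nhds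
    (hU (hch.mono fun n h => h.1)) (hU (hch.mono fun n h => h.2))

end
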